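/- Theorem 1: For all p₁, p₂ ∈ ℝ there exists ε₀ > 0 such that for every ε ∈ (0, ε₀), the perturbed autonomous system ẋ = y, ẏ = x − x³ + ε(p₁ + p₂x − x²)y has at most two limit cycles contained in each of the three domains G₁⁺ = {(x,y) : H(x,y) < 0, x > 0}, G₁⁻ = {(x,y) : H(x,y) < 0, x < 0}, and G₂ = {(x,y) : H(x,y) > 0}, where a limit cycle is the image Γ of a nonconstant periodic solution such that some neighborhood of Γ contains no point of the image of any other nonconstant periodic solution. -/

import Mathlib

/-- The Hamiltonian of the unperturbed Duffing equation: H(x,y) = y²/2 − x²/2 + x⁴/4. -/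
noncomputable def H (x y : ℝ) : ℝ := y ^ 2 / 2 - x ^ 2 / 2 + x ^ 4 / 4

/-- (x, y) is a nonconstant periodic solution of
ẋ = y, ẏ = x − x³ + ε(p₁ + p₂x − x²)y. -/
def IsPeriodicOrbit (ε p₁ p₂ : ℝ) (x y : ℝ → ℝ) : Prop :=
  (∀ t, HasDerivAt x (y t) t) ∧
  (∀ t, HasDerivAt y
    (x t - (x t) ^ 3 + ε * (p₁ + p₂ * x t - (x t) ^ 2) * y t) t) ∧
  (∃ T > (0:ℝ), ∀ t, x (t + T) = x t ∧ y (t + T) = y t) ∧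
  (∃ t₁ t₂, (x t₁, y t₁) ≠ (x t₂, y t₂))

/-- Γ is a limit cycle of the perturbed system: the image of a nonconstant periodic
solution possessing a neighborhood containing no point of the image of any other
nonconstant periodic solution. -/
def IsLimitCycle (ε p₁ p₂ : ℝ) (Γ : Set (ℝ × ℝ)) : Prop :=
  (∃ x y : ℝ → ℝ, IsPeriodicOrbit ε p₁ p₂ x y ∧
    Γ = Set.range fun t => (x t, y t)) ∧
  (∃ U : Set (ℝ × ℝ), IsOpen U ∧ Γ ⊆ U ∧
    ∀ x y : ℝ → ℝ, IsPeriodicOrbit ε p₁ p₂ x y →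
      (Set.range fun t => (x t, y t)) ≠ Γ → ∀ t, (x t, y t) ∉ U)

namespace DuffingVanDerPol

open Real Set Filter Topology MeasureTheory Function

lemma const_of_hasDerivAt_zero {f : ℝ → ℝ} (h : ∀ t, HasDerivAt f 0 t) (s t : ℝ) : f s = f t :=
  is_const_of_deriv_eq_zero (fun t => (h t).differentiableAt) (fun t => (h t).deriv) s t

lemma bounded_of_periodic {f : ℝ → ℝ} (hf : Continuous f) {T : ℝ} (hT : 0 < T)
    (hper : ∀ t, f (t + T) = f t) : ∃ M, ∀ t, |f t| ≤ M := by
  obtain ⟨M, hM⟩ := (isCompact_Icc (a := (0 : ℝ)) (b := T)).exists_bound_of_continuousOn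
    hf.continuousOn
  refine ⟨M, fun t => ?_⟩
  obtain ⟨s, hs, hst⟩ := Periodic.exists_mem_Ico₀ (f := f) hper hT t
  rw [hst]
  exact hM s ⟨hs.1, hs.2.le⟩

/-- The vector field of the perturbed system. -/
def field (ε p₁ p₂ : ℝ) (z : ℝ × ℝ) : ℝ × ℝ :=
  (z.2, z.1 - z.1 ^ 3 + ε * (p₁ + p₂ * z.1 - z.1 ^ 2) * z.2)

lemma contDiff_field (ε p₁ p₂ : ℝ) : ContDiff ℝ 1 (field ε p₁ p₂) := by
  unfold field; fun_prop

lemma _root_.IsPeriodicOrbit.hasDerivAt_prod {ε p₁ p₂ : ℝ} {x y : ℝ → ℝ}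
    (h : IsPeriodicOrbit ε p₁ p₂ x y) (t : ℝ) :
    HasDerivAt (fun t => (x t, y t)) (field ε p₁ p₂ (x t, y t)) t :=
  (h.1 t).prodMk (h.2.1 t)

lemma _root_.IsPeriodicOrbit.continuous {ε p₁ p₂ : ℝ} {x y : ℝ → ℝ}
    (h : IsPeriodicOrbit ε p₁ p₂ x y) : Continuous x ∧ Continuous y :=
  ⟨continuous_iff_continuousAt.2 fun t => (h.1 t).continuousAt,
    continuous_iff_continuousAt.2 fun t => (h.2.1 t).continuousAt⟩

lemma solution_unique {ε p₁ p₂ : ℝ} {f g : ℝ → ℝ × ℝ} {M : ℝ}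
    (hf : ∀ t, HasDerivAt f (field ε p₁ p₂ (f t)) t ∧ f t ∈ Metric.closedBall (0 : ℝ × ℝ) M)
    (hg : ∀ t, HasDerivAt g (field ε p₁ p₂ (g t)) t ∧ g t ∈ Metric.closedBall (0 : ℝ × ℝ) M)
    {t₀ : ℝ} (h : f t₀ = g t₀) : f = g := by
  obtain ⟨K, hK⟩ := (contDiff_field ε p₁ p₂).contDiffOn.exists_lipschitzOnWith
    (s := Metric.closedBall 0 M) one_ne_zero
    (convex_closedBall _ _) (isCompact_closedBall _ _)
  exact ODE_solution_unique_univ (v := fun _ => field ε p₁ p₂) (fun _ => hK) hf hg h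

lemma _root_.IsPeriodicOrbit.exists_mem_closedBall {ε p₁ p₂ : ℝ} {x y : ℝ → ℝ}
    (h : IsPeriodicOrbit ε p₁ p₂ x y) :
    ∃ M, ∀ t, (x t, y t) ∈ Metric.closedBall (0 : ℝ × ℝ) M := by
  obtain ⟨T, hT, hper⟩ := h.2.2.1
  obtain ⟨M, hM⟩ := bounded_of_periodic h.continuous.1 hT fun t => (hper t).1
  obtain ⟨M', hM'⟩ := bounded_of_periodic h.continuous.2 hT fun t => (hper t).2
  refine ⟨max M M', fun t => ?_⟩
  simp only [mem_closedBall_zero_iff, Prod.norm_def, Real.norm_eq_abs]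
  exact max_le_max (hM t) (hM' t)

lemma _root_.IsPeriodicOrbit.eq_shift {ε p₁ p₂ : ℝ} {x y x' y' : ℝ → ℝ}
    (h : IsPeriodicOrbit ε p₁ p₂ x y) (h' : IsPeriodicOrbit ε p₁ p₂ x' y') {s t : ℝ}
    (hst : (x s, y s) = (x' t, y' t)) (τ : ℝ) :
    (x (s + τ), y (s + τ)) = (x' (t + τ), y' (t + τ)) := by
  obtain ⟨M, hM⟩ := h.exists_mem_closedBall
  obtain ⟨M', hM'⟩ := h'.exists_mem_closedBall
  have key := solution_unique (f := fun τ => (x (s + τ), y (s + τ)))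
    (g := fun τ => (x' (t + τ), y' (t + τ))) (ε := ε) (p₁ := p₁) (p₂ := p₂) (M := max M M')
    (t₀ := 0)
    (fun τ => ⟨(h.hasDerivAt_prod (s + τ)).comp_const_add s τ,
      Metric.closedBall_subset_closedBall (le_max_left _ _) (hM _)⟩)
    (fun τ => ⟨(h'.hasDerivAt_prod (t + τ)).comp_const_add t τ,
      Metric.closedBall_subset_closedBall (le_max_right _ _) (hM' _)⟩)
    (by simpa using hst)
  exact congrFun key τ

lemma _root_.IsPeriodicOrbit.range_eq {ε p₁ p₂ : ℝ} {x y x' y' : ℝ → ℝ}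
    (h : IsPeriodicOrbit ε p₁ p₂ x y) (h' : IsPeriodicOrbit ε p₁ p₂ x' y') {s t : ℝ}
    (hst : (x s, y s) = (x' t, y' t)) :
    range (fun t => (x t, y t)) = range (fun t => (x' t, y' t)) := by
  have key := h.eq_shift h' hst
  ext p
  constructor
  · rintro ⟨u, rfl⟩
    exact ⟨t + (u - s), by simpa using (key (u - s)).symm⟩
  · rintro ⟨u, rfl⟩
    exact ⟨s + (u - t), by simpa using key (u - t)⟩

lemma _root_.IsPeriodicOrbit.field_ne_zero {ε p₁ p₂ : ℝ} {x y : ℝ → ℝ}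
    (h : IsPeriodicOrbit ε p₁ p₂ x y) (t : ℝ) : field ε p₁ p₂ (x t, y t) ≠ 0 := by
  intro h0
  obtain ⟨M, hM⟩ := h.exists_mem_closedBall
  have key := solution_unique (f := fun τ => (x τ, y τ)) (g := fun _ => (x t, y t))
    (t₀ := t) (fun τ => ⟨h.hasDerivAt_prod τ, hM τ⟩)
    (fun τ => ⟨by rw [h0]; exact hasDerivAt_const _ _, hM t⟩) rfl
  obtain ⟨t₁, t₂, hne⟩ := h.2.2.2
  exact hne ((congrFun key t₁).trans (congrFun key t₂).symm)

lemma exists_angle {s c : ℝ} (h : s ^ 2 + c ^ 2 = 1) : ∃ α, s = sin α ∧ c = cos α := by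
  have hn : ‖(⟨c, s⟩ : ℂ)‖ = 1 := by
    rw [Complex.norm_def, Complex.normSq_mk, show c * c + s * s = 1 by linarith, sqrt_one]
  refine ⟨Complex.arg ⟨c, s⟩, ?_, ?_⟩
  · have := Complex.norm_mul_sin_arg ⟨c, s⟩
    simpa [hn] using this.symm
  · have := Complex.norm_mul_cos_arg ⟨c, s⟩
    simpa [hn] using this.symm

/-- A periodic curve rotating with positive angular speed is a `2π`-periodic graph over the
angle. -/
lemma exists_polar_graph {z : ℝ → ℝ × ℝ} {S C R ω : ℝ → ℝ} {Ψ : ℝ → ℝ → ℝ → ℝ × ℝ}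
    {g : ℝ → ℝ → ℝ → ℝ} {T : ℝ} (hT : 0 < T)
    (hS : ∀ t, HasDerivAt S (ω t * C t) t) (hC : ∀ t, HasDerivAt C (-(ω t * S t)) t)
    (hSC : ∀ t, S t ^ 2 + C t ^ 2 = 1) (hω : Continuous ω) (hpos : ∀ t, 0 < ω t)
    (hR : ∀ t, HasDerivAt R (ω t * g (R t) (S t) (C t)) t)
    (hz : ∀ t, z t = Ψ (R t) (S t) (C t))
    (hinj : ∀ s t, z s = z t → R s = R t ∧ S s = S t ∧ C s = C t ∧ ω s = ω t)
    (hzT : ∀ t, z (t + T) = z t)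
    (hdet : ∀ s t, z s = z t → ∀ τ, z (s + τ) = z (t + τ)) :
    ∃ ρ : ℝ → ℝ, (∀ θ, ρ (θ + 2 * π) = ρ θ) ∧
      (∀ θ, HasDerivAt ρ (g (ρ θ) (sin θ) (cos θ)) θ) ∧
      ∀ θ, ∃ t, z t = Ψ (ρ θ) (sin θ) (cos θ) ∧ R t = ρ θ := by
  obtain ⟨c, hc, hcω⟩ : ∃ c > 0, ∀ t, c ≤ ω t := by
    obtain ⟨t₀, -, ht₀⟩ := (isCompact_Icc (a := (0 : ℝ)) (b := T)).exists_isMinOn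
      (nonempty_Icc.2 hT.le) hω.continuousOn
    refine ⟨ω t₀, hpos t₀, fun t => ?_⟩
    obtain ⟨s, hs, hst⟩ := Periodic.exists_mem_Ico₀ (f := ω) (c := T)
      (fun t => (hinj _ _ (hzT t)).2.2.2) hT t
    rw [hst]
    exact ht₀ ⟨hs.1, hs.2.le⟩
  obtain ⟨α₀, hα₀S, hα₀C⟩ := exists_angle (hSC 0)
  set α : ℝ → ℝ := fun t => α₀ + ∫ u in (0 : ℝ)..t, ω u with hα
  have hαd : ∀ t, HasDerivAt α (ω t) t := fun t =>
    (hω.integral_hasStrictDerivAt 0 t).hasDerivAt.const_add α₀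
  have hα0 : α 0 = α₀ := by simp [hα]
  have hmono : StrictMono α := strictMono_of_deriv_pos fun t => by
    rw [(hαd t).deriv]; exact hpos t
  have hαc : Continuous α := continuous_iff_continuousAt.2 fun t => (hαd t).continuousAt
  have hlin' : ∀ t, HasDerivAt (fun t => α t - c * t) (ω t - c) t := fun t => by
    exact ((hαd t).sub ((hasDerivAt_id t).const_mul c)).congr_deriv (by ring)
  have hlin : Monotone fun t => α t - c * t := by
    apply monotone_of_deriv_nonneg
    · exact fun t => (hlin' t).differentiableAt
    · intro t
      rw [(hlin' t).deriv]
      linarith [hcω t]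
  have hsurj : Surjective α := by
    apply hαc.surjective
    · refine tendsto_atTop_mono' _ (f₁ := fun t => c * t + α₀) ?_
        (tendsto_atTop_add_const_right _ _ (tendsto_id.const_mul_atTop hc))
      filter_upwards [eventually_ge_atTop 0] with t ht
      have := hlin ht
      simp only [mul_zero, sub_zero, hα0] at this
      linarith
    · refine tendsto_atBot_mono' (f₁ := fun t => c * t + α₀) _ ?_
        (tendsto_atBot_add_const_right _ _ (tendsto_id.const_mul_atBot hc))
      filter_upwards [eventually_le_atBot 0] with t ht
      have := hlin ht
      simp only [mul_zero, sub_zero, hα0] at this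
      linarith
  have hA : ∀ t, S t * cos (α t) - C t * sin (α t) = 0 := fun t => by
    rw [const_of_hasDerivAt_zero (f := fun t => S t * cos (α t) - C t * sin (α t)) _ t 0, hα0,
      hα₀S, hα₀C]
    · ring
    · intro t
      exact (((hS t).mul (hαd t).cos).sub ((hC t).mul (hαd t).sin)).congr_deriv (by ring)
  have hB : ∀ t, S t * sin (α t) + C t * cos (α t) = 1 := fun t => by
    rw [const_of_hasDerivAt_zero (f := fun t => S t * sin (α t) + C t * cos (α t)) _ t 0, hα0,
      hα₀S, hα₀C]
    · nlinarith [sin_sq_add_cos_sq α₀]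
    · intro t
      exact (((hS t).mul (hαd t).sin).add ((hC t).mul (hαd t).cos)).congr_deriv (by ring)
  have hSα : ∀ t, S t = sin (α t) := fun t => by
    linear_combination cos (α t) * hA t + sin (α t) * hB t - S t * sin_sq_add_cos_sq (α t)
  have hCα : ∀ t, C t = cos (α t) := fun t => by
    linear_combination cos (α t) * hB t - sin (α t) * hA t - C t * sin_sq_add_cos_sq (α t)
  set e := hmono.orderIsoOfSurjective α hsurj
  set β : ℝ → ℝ := fun θ => e.symm θ with hβ
  have hαβ : ∀ θ, α (β θ) = θ := fun θ => e.apply_symm_apply θ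
  have hβα : ∀ t, β (α t) = t := fun t => e.symm_apply_apply t
  have hβd : ∀ θ, HasDerivAt β (ω (β θ))⁻¹ θ := fun θ =>
    HasDerivAt.of_local_left_inverse e.symm.continuous.continuousAt (hαd _) (hpos _).ne'
      (Eventually.of_forall hαβ)
  have hρd : ∀ θ, HasDerivAt (R ∘ β) (g (R (β θ)) (sin θ) (cos θ)) θ := fun θ => by
    refine ((hR (β θ)).comp θ (hβd θ)).congr_deriv ?_
    rw [hSα, hCα, hαβ]
    field_simp [(hpos (β θ)).ne']
  have hpt : ∀ θ, z (β θ) = Ψ (R (β θ)) (sin θ) (cos θ) := fun θ => by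
    rw [hz, hSα, hCα, hαβ]
  have hshift : ∀ s, (∀ t, z (t + s) = z t) → ∀ t u, α (t + s) - α t = α (u + s) - α u := by
    intro s hs
    refine const_of_hasDerivAt_zero (f := fun t => α (t + s) - α t) fun t => ?_
    refine (((hαd (t + s)).comp_add_const t s).sub (hαd t)).congr_deriv ?_
    rw [(hinj _ _ (hs t)).2.2.2]; ring
  have hρc : Continuous (R ∘ β) := continuous_iff_continuousAt.2 fun t => (hρd t).continuousAt
  refine ⟨R ∘ β, ?_, hρd, fun θ => ⟨β θ, hpt θ, rfl⟩⟩
  obtain ⟨n, hn⟩ : ∃ n : ℕ, α (0 + T) - α 0 = n * (2 * π) ∧ 0 < n := by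
    have h1 : cos (α (0 + T) - α 0) = 1 := by
      rw [cos_sub, ← hCα, ← hCα, ← hSα, ← hSα, (hinj _ _ (hzT 0)).2.1, (hinj _ _ (hzT 0)).2.2.1]
      linarith [hSC 0]
    obtain ⟨m, hm⟩ := (cos_eq_one_iff _).1 h1
    have hmpos : (0 : ℝ) < m := by
      have : 0 < α (0 + T) - α 0 := sub_pos.2 (hmono (by linarith))
      rw [← hm] at this
      exact pos_of_mul_pos_left this (by positivity)
    lift m to ℕ using by exact_mod_cast hmpos.le
    exact ⟨m, by simpa using hm.symm, by exact_mod_cast hmpos⟩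
  have hper : ∀ θ, (R ∘ β) (θ + n * (2 * π)) = (R ∘ β) θ := fun θ => by
    have h1 : α (β θ + T) = θ + n * (2 * π) := by
      have := hshift T hzT (β θ) 0
      rw [hn.1, hαβ] at this
      linarith
    simp only [comp_apply]
    rw [← h1, hβα, (hinj _ _ (hzT (β θ))).1]
  have hsum : ∑ j ∈ Finset.range n,
      ((R ∘ β) ((j : ℝ) * (2 * π) + 2 * π) - (R ∘ β) ((j : ℝ) * (2 * π))) = 0 := by
    have := Finset.sum_range_sub (fun j : ℕ => (R ∘ β) ((j : ℝ) * (2 * π))) n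
    rw [show (R ∘ β) ((n : ℝ) * (2 * π)) = (R ∘ β) (((0 : ℕ) : ℝ) * (2 * π)) by
      simpa using hper 0, sub_self] at this
    rw [← this]
    refine Finset.sum_congr rfl fun j _ => ?_
    push_cast
    ring_nf
  obtain ⟨θ₁, hθ₁⟩ : (0 : ℝ) ∈ range fun θ => (R ∘ β) (θ + 2 * π) - (R ∘ β) θ := by
    have hne : (Finset.range n).Nonempty := Finset.nonempty_range_iff.2 hn.2.ne'
    apply mem_range_of_exists_le_of_exists_ge
    · exact (hρc.comp (continuous_id.add continuous_const)).sub hρc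
    · by_contra! h
      exact (Finset.sum_pos (fun (j : ℕ) _ => h ((j : ℝ) * (2 * π))) hne).ne' hsum
    · by_contra! h
      exact (Finset.sum_neg (fun (j : ℕ) _ => h ((j : ℝ) * (2 * π))) hne).ne hsum
  have hz1 : z (β (θ₁ + 2 * π)) = z (β θ₁) := by
    rw [hpt, hpt, sin_add_two_pi, cos_add_two_pi]
    congr 1
    simpa [sub_eq_zero] using hθ₁
  set s := β (θ₁ + 2 * π) - β θ₁ with hs
  have hzs : ∀ t, z (t + s) = z t := fun t => by
    have := hdet _ _ hz1 (t - β θ₁)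
    rwa [show β (θ₁ + 2 * π) + (t - β θ₁) = t + s by rw [hs]; ring, add_sub_cancel] at this
  intro θ
  have h1 : α (β θ + s) = θ + 2 * π := by
    have h2 := hshift s hzs (β θ) (β θ₁)
    rw [hαβ, hαβ, show β θ₁ + s = β (θ₁ + 2 * π) by rw [hs]; ring, hαβ] at h2
    linarith
  simp only [comp_apply]
  rw [← h1, hβα, (hinj _ _ (hzs (β θ))).1]

/-- The uncurried form of a function of three real variables. -/
def unc (G : ℝ → ℝ → ℝ → ℝ) (q : ℝ × ℝ × ℝ) : ℝ := G q.1 q.2.1 q.2.2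

/-- The partial derivative in the second variable. -/
noncomputable def pd (G : ℝ → ℝ → ℝ → ℝ) (ε ρ θ : ℝ) : ℝ :=
  fderiv ℝ (unc G) (ε, ρ, θ) (0, 1, 0)

lemma hasDerivAt_pd {G : ℝ → ℝ → ℝ → ℝ} {ε ρ θ : ℝ} {n : WithTop ℕ∞} (hn : n ≠ 0)
    (h : ContDiffAt ℝ n (unc G) (ε, ρ, θ)) :
    HasDerivAt (fun r => G ε r θ) (pd G ε ρ θ) ρ :=
  HasFDerivAt.comp_hasDerivAt (f := fun r => (ε, r, θ)) ρ (h.differentiableAt hn).hasFDerivAt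
    ((hasDerivAt_const ρ ε).prodMk ((hasDerivAt_id ρ).prodMk (hasDerivAt_const ρ θ)))

lemma contDiffAt_pd {G : ℝ → ℝ → ℝ → ℝ} {q : ℝ × ℝ × ℝ} {n m : WithTop ℕ∞} (hnm : n + 1 ≤ m)
    (h : ContDiffAt ℝ m (unc G) q) : ContDiffAt ℝ n (unc (pd G)) q :=
  (h.fderiv_right hnm).clm_apply contDiffAt_const

lemma tendsto_of_continuousAt_unc {G : ℝ → ℝ → ℝ → ℝ} {ℓ θ : ℝ} {ε ξ : ℕ → ℝ}
    (h : ContinuousAt (unc G) (0, ℓ, θ)) (hε : Tendsto ε atTop (𝓝 0))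
    (hξ : Tendsto ξ atTop (𝓝 ℓ)) :
    Tendsto (fun n => G (ε n) (ξ n) θ) atTop (𝓝 (G 0 ℓ θ)) :=
  h.tendsto.comp (hε.prodMk_nhds (hξ.prodMk_nhds tendsto_const_nhds))

/-- The difference quotient in the second variable. -/
noncomputable def dq (G : ℝ → ℝ → ℝ → ℝ) (ε u v θ : ℝ) : ℝ := (G ε v θ - G ε u θ) / (v - u)

/-- The data of a `2π`-periodic scalar equation `ρ' = ε G(ε, ρ, θ)` that is smooth on the interval
`U`, and almost everywhere smooth at an end point `e` of the compact set `K`. -/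
structure Averaging (G : ℝ → ℝ → ℝ → ℝ) (ε₀ e : ℝ) (U K : Set ℝ) : Prop where
  pos : 0 < ε₀
  isOpen : IsOpen U
  ordConnected : U.OrdConnected
  isCompact : IsCompact K
  ordConnected' : K.OrdConnected
  subset : K ⊆ insert e U
  Ioo_subset : ∀ u ∈ K, ∀ v ∈ K, Ioo u v ⊆ U
  smooth : ∀ ε ∈ Icc 0 ε₀, ∀ ρ ∈ U, ∀ θ, ContDiffAt ℝ 3 (unc G) (ε, ρ, θ)
  smooth_end : ∀ᵐ θ : ℝ, ContDiffAt ℝ 3 (unc G) (0, e, θ)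
  bounded : ∃ B, ∀ ε ∈ Icc 0 ε₀, ∀ ρ ∈ K, ∀ θ, |G ε ρ θ| ≤ B

/-- `ρ` is a `2π`-periodic solution of `ρ' = ε G(ε, ρ, θ)` with values in `S`. -/
structure IsSol (G : ℝ → ℝ → ℝ → ℝ) (S : Set ℝ) (ε : ℝ) (ρ : ℝ → ℝ) : Prop where
  per : ∀ θ, ρ (θ + 2 * π) = ρ θ
  deriv : ∀ θ, HasDerivAt ρ (ε * G ε (ρ θ) θ) θ
  mem : ∀ θ, ρ θ ∈ S

lemma IsSol.continuous {G : ℝ → ℝ → ℝ → ℝ} {S : Set ℝ} {ε : ℝ} {ρ : ℝ → ℝ} (h : IsSol G S ε ρ) :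
    Continuous ρ := continuous_iff_continuousAt.2 fun θ => (h.deriv θ).continuousAt

lemma integral_deriv_eq_zero {f f' : ℝ → ℝ} (hper : ∀ θ, f (θ + 2 * π) = f θ)
    (hf : ∀ θ, HasDerivAt f (f' θ) θ) (hf' : Continuous f') : ∫ θ in (0:ℝ)..2 * π, f' θ = 0 := by
  rw [intervalIntegral.integral_eq_sub_of_hasDerivAt (fun θ _ => hf θ)
    (hf'.intervalIntegrable _ _)]
  have := hper 0
  rw [zero_add] at this
  rw [this, sub_self]

section

variable {G : ℝ → ℝ → ℝ → ℝ} {ε₀ e : ℝ} {U K : Set ℝ}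

lemma Averaging.continuous_comp (A : Averaging G ε₀ e U K) {ε : ℝ} (hε : ε ∈ Icc 0 ε₀)
    {ρ : ℝ → ℝ} (hρ : Continuous ρ) (hU : ∀ θ, ρ θ ∈ U) : Continuous fun θ => G ε (ρ θ) θ :=
  continuous_iff_continuousAt.2 fun θ =>
    ContinuousAt.comp (g := unc G) (f := fun θ => (ε, ρ θ, θ))
      (A.smooth ε hε (ρ θ) (hU θ) θ).continuousAt (by fun_prop)

lemma Averaging.ae_contDiffAt (A : Averaging G ε₀ e U K) {ℓ : ℝ} (hℓ : ℓ ∈ K) :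
    ∀ᵐ θ : ℝ, ContDiffAt ℝ 3 (unc G) (0, ℓ, θ) := by
  rcases A.subset hℓ with rfl | h
  · exact A.smooth_end
  · exact Eventually.of_forall fun θ => A.smooth 0 ⟨le_rfl, A.pos.le⟩ ℓ h θ

lemma Averaging.exists_dq_eq (A : Averaging G ε₀ e U K) {ε : ℝ} (hε : ε ∈ Icc 0 ε₀) {u v : ℝ}
    (hu : u ∈ U) (hv : v ∈ U) (huv : u < v) (θ : ℝ) :
    ∃ ξ ∈ Ioo u v, dq G ε u v θ = pd G ε ξ θ := by
  have hd : ∀ r ∈ Icc u v, HasDerivAt (fun r => G ε r θ) (pd G ε r θ) r := fun r hr =>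
    hasDerivAt_pd (by norm_num) (A.smooth ε hε r (A.ordConnected.out hu hv hr) θ)
  obtain ⟨ξ, hξ, h⟩ := exists_hasDerivAt_eq_slope (fun r => G ε r θ) (fun r => pd G ε r θ) huv
    (fun r hr => (hd r hr).continuousAt.continuousWithinAt)
    fun r hr => hd r (Ioo_subset_Icc_self hr)
  exact ⟨ξ, hξ, h.symm⟩

lemma Averaging.exists_local_bound (A : Averaging G ε₀ e U K) {ℓ : ℝ} (hℓ : ℓ ∈ U) :
    ∃ δ > 0, Icc (ℓ - δ) (ℓ + δ) ⊆ U ∧ ∃ M > 0, ∀ ε ∈ Icc 0 ε₀, ∀ ρ ∈ Icc (ℓ - δ) (ℓ + δ),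
      ∀ θ ∈ Icc 0 (2 * π), |pd G ε ρ θ| ≤ M ∧ |pd (pd G) ε ρ θ| ≤ M := by
  obtain ⟨δ, hδ, hU⟩ := Metric.nhds_basis_closedBall.mem_iff.1 (A.isOpen.mem_nhds hℓ)
  rw [Real.closedBall_eq_Icc] at hU
  have hc : IsCompact (Icc 0 ε₀ ×ˢ Icc (ℓ - δ) (ℓ + δ) ×ˢ Icc 0 (2 * π)) :=
    isCompact_Icc.prod (isCompact_Icc.prod isCompact_Icc)
  have hs : ∀ q ∈ Icc 0 ε₀ ×ˢ Icc (ℓ - δ) (ℓ + δ) ×ˢ Icc 0 (2 * π), ContDiffAt ℝ 3 (unc G) q :=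
    fun q hq => A.smooth q.1 hq.1 q.2.1 (hU hq.2.1) q.2.2
  obtain ⟨M₁, hM₁⟩ := hc.exists_bound_of_continuousOn (f := unc (pd G)) fun q hq =>
    (contDiffAt_pd (n := 2) (by norm_num) (hs q hq)).continuousAt.continuousWithinAt
  obtain ⟨M₂, hM₂⟩ := hc.exists_bound_of_continuousOn (f := unc (pd (pd G))) fun q hq =>
    (contDiffAt_pd (n := 1) (by norm_num) (contDiffAt_pd (n := 2) (by norm_num)
      (hs q hq))).continuousAt.continuousWithinAt
  refine ⟨δ, hδ, hU, max 1 (max M₁ M₂), by positivity, fun ε hε ρ hρ θ hθ => ⟨?_, ?_⟩⟩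
  · exact (hM₁ (ε, ρ, θ) ⟨hε, hρ, hθ⟩).trans ((le_max_left _ _).trans (le_max_right _ _))
  · exact (hM₂ (ε, ρ, θ) ⟨hε, hρ, hθ⟩).trans ((le_max_right _ _).trans (le_max_right _ _))

variable {ε : ℕ → ℝ}

lemma Averaging.eventually_near (A : Averaging G ε₀ e U K) (hε : ∀ n, ε n ∈ Ioo 0 ε₀)
    (hε0 : Tendsto ε atTop (𝓝 0)) {ρ : ℕ → ℝ → ℝ} (hρ : ∀ n, IsSol G (K ∩ U) (ε n) (ρ n)) {ℓ : ℝ}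
    (hℓ : Tendsto (fun n => ρ n 0) atTop (𝓝 ℓ)) {δ : ℝ} (hδ : 0 < δ) :
    ∀ᶠ n in atTop, ∀ θ ∈ Icc 0 (2 * π), ρ n θ ∈ Icc (ℓ - δ) (ℓ + δ) := by
  obtain ⟨B, hB⟩ := A.bounded
  have h1 : Tendsto (fun n => |ρ n 0 - ℓ| + ε n * |B| * (2 * π)) atTop (𝓝 0) := by
    have h2 := ((hℓ.sub_const ℓ).abs).add ((hε0.mul_const |B|).mul_const (2 * π))
    simpa using h2
  filter_upwards [h1.eventually (gt_mem_nhds hδ)] with n hn θ hθ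
  have h2 := Convex.norm_image_sub_le_of_norm_hasDerivWithin_le (f := ρ n) (C := ε n * |B|)
    (s := univ) (x := 0) (y := θ) (fun t _ => ((hρ n).deriv t).hasDerivWithinAt)
    (fun t _ => by
      rw [norm_mul, Real.norm_eq_abs, abs_of_pos (hε n).1]
      exact mul_le_mul_of_nonneg_left ((hB _ ⟨(hε n).1.le, (hε n).2.le⟩ _ ((hρ n).mem t).1 t).trans
        (le_abs_self B)) (hε n).1.le) convex_univ (mem_univ _) (mem_univ _)
  rw [Real.norm_eq_abs, Real.norm_eq_abs, sub_zero, abs_of_nonneg hθ.1] at h2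
  have h3 : ε n * |B| * θ ≤ ε n * |B| * (2 * π) :=
    mul_le_mul_of_nonneg_left hθ.2 (mul_nonneg (hε n).1.le (abs_nonneg _))
  have h4 := abs_sub_le (ρ n θ) (ρ n 0) ℓ
  have h5 : |ρ n θ - ℓ| ≤ δ := by linarith
  rw [abs_le] at h5
  exact ⟨by linarith [h5.1], by linarith [h5.2]⟩

lemma Averaging.tendsto_apply (A : Averaging G ε₀ e U K) (hε : ∀ n, ε n ∈ Ioo 0 ε₀)
    (hε0 : Tendsto ε atTop (𝓝 0)) {ρ : ℕ → ℝ → ℝ} (hρ : ∀ n, IsSol G (K ∩ U) (ε n) (ρ n)) {ℓ : ℝ}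
    (hℓ : Tendsto (fun n => ρ n 0) atTop (𝓝 ℓ)) {θ : ℝ} (hθ : θ ∈ Icc 0 (2 * π)) :
    Tendsto (fun n => ρ n θ) atTop (𝓝 ℓ) := by
  rw [Metric.tendsto_nhds]
  intro δ hδ
  filter_upwards [A.eventually_near hε hε0 hρ hℓ (half_pos hδ)] with n hn
  rw [Real.dist_eq, abs_lt]
  have := hn θ hθ
  exact ⟨by linarith [this.1], by linarith [this.2]⟩

lemma Averaging.limit_mem (A : Averaging G ε₀ e U K)
    {ρ : ℕ → ℝ → ℝ} (hρ : ∀ n, IsSol G (K ∩ U) (ε n) (ρ n)) {ℓ : ℝ}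
    (hℓ : Tendsto (fun n => ρ n 0) atTop (𝓝 ℓ)) : ℓ ∈ K :=
  A.isCompact.isClosed.mem_of_tendsto hℓ (Eventually.of_forall fun n => ((hρ n).mem 0).1)

lemma mem_Icc_of_mem_uIoc {θ : ℝ} (hθ : θ ∈ uIoc 0 (2 * π)) : θ ∈ Icc 0 (2 * π) := by
  rw [uIoc_of_le (by positivity)] at hθ
  exact Ioc_subset_Icc_self hθ

lemma Averaging.integral_eq_zero (A : Averaging G ε₀ e U K) (hε : ∀ n, ε n ∈ Ioo 0 ε₀)
    (hε0 : Tendsto ε atTop (𝓝 0)) {ρ : ℕ → ℝ → ℝ} (hρ : ∀ n, IsSol G (K ∩ U) (ε n) (ρ n)) {ℓ : ℝ}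
    (hℓ : Tendsto (fun n => ρ n 0) atTop (𝓝 ℓ)) : ∫ θ in (0:ℝ)..2 * π, G 0 ℓ θ = 0 := by
  have hε' : ∀ n, ε n ∈ Icc 0 ε₀ := fun n => Ioo_subset_Icc_self (hε n)
  have hcont : ∀ n, Continuous fun θ => G (ε n) (ρ n θ) θ := fun n =>
    A.continuous_comp (hε' n) (hρ n).continuous fun θ => ((hρ n).mem θ).2
  have h0 : ∀ n, ∫ θ in (0:ℝ)..2 * π, G (ε n) (ρ n θ) θ = 0 := fun n => by
    have := integral_deriv_eq_zero (hρ n).per (hρ n).deriv (continuous_const.mul (hcont n))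
    rw [intervalIntegral.integral_const_mul] at this
    exact (mul_eq_zero.1 this).resolve_left (hε n).1.ne'
  obtain ⟨B, hB⟩ := A.bounded
  have hlim := intervalIntegral.tendsto_integral_filter_of_dominated_convergence
    (μ := volume) (a := 0) (b := 2 * π) (l := atTop) (F := fun n θ => G (ε n) (ρ n θ) θ)
    (f := fun θ => G 0 ℓ θ) (fun _ => B)
    (Eventually.of_forall fun n => (hcont n).aestronglyMeasurable)
    (Eventually.of_forall fun n => Eventually.of_forall fun θ _ =>
      hB _ (hε' n) _ ((hρ n).mem θ).1 θ)
    intervalIntegrable_const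
    (by
      filter_upwards [A.ae_contDiffAt (A.limit_mem hρ hℓ)] with θ hθ hθ'
      exact tendsto_of_continuousAt_unc hθ.continuousAt hε0
        (A.tendsto_apply hε hε0 hρ hℓ (mem_Icc_of_mem_uIoc hθ')))
  simp only [h0] at hlim
  exact (tendsto_nhds_unique tendsto_const_nhds hlim).symm

lemma Averaging.continuous_dq (A : Averaging G ε₀ e U K) {ε : ℝ} (hε : ε ∈ Ioo 0 ε₀)
    {ρ₁ ρ₂ : ℝ → ℝ} (h₁ : IsSol G (K ∩ U) ε ρ₁) (h₂ : IsSol G (K ∩ U) ε ρ₂)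
    (h₁₂ : ∀ θ, ρ₁ θ < ρ₂ θ) : Continuous fun θ => dq G ε (ρ₁ θ) (ρ₂ θ) θ :=
  ((A.continuous_comp (Ioo_subset_Icc_self hε) h₂.continuous fun θ => (h₂.mem θ).2).sub
    (A.continuous_comp (Ioo_subset_Icc_self hε) h₁.continuous fun θ => (h₁.mem θ).2)).div
    (h₂.continuous.sub h₁.continuous) fun θ => (sub_pos.2 (h₁₂ θ)).ne'

lemma hasDerivAt_log_sub {ε : ℝ} {S : Set ℝ} {ρ₁ ρ₂ : ℝ → ℝ} (h₁ : IsSol G S ε ρ₁)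
    (h₂ : IsSol G S ε ρ₂) (h₁₂ : ∀ θ, ρ₁ θ < ρ₂ θ) (θ : ℝ) :
    HasDerivAt (fun θ => log (ρ₂ θ - ρ₁ θ)) (ε * dq G ε (ρ₁ θ) (ρ₂ θ) θ) θ := by
  refine (((h₂.deriv θ).sub (h₁.deriv θ)).log (sub_pos.2 (h₁₂ θ)).ne').congr_deriv ?_
  simp only [dq, Pi.sub_apply]
  ring

lemma Averaging.integral_dq (A : Averaging G ε₀ e U K) {ε : ℝ} (hε : ε ∈ Ioo 0 ε₀)
    {ρ₁ ρ₂ : ℝ → ℝ} (h₁ : IsSol G (K ∩ U) ε ρ₁) (h₂ : IsSol G (K ∩ U) ε ρ₂)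
    (h₁₂ : ∀ θ, ρ₁ θ < ρ₂ θ) : ∫ θ in (0:ℝ)..2 * π, dq G ε (ρ₁ θ) (ρ₂ θ) θ = 0 := by
  have := integral_deriv_eq_zero (fun θ => by rw [h₁.per, h₂.per]) (hasDerivAt_log_sub h₁ h₂ h₁₂)
    (continuous_const.mul (A.continuous_dq hε h₁ h₂ h₁₂))
  rw [intervalIntegral.integral_const_mul] at this
  exact (mul_eq_zero.1 this).resolve_left hε.1.ne'

lemma Averaging.tendsto_integral_dq (A : Averaging G ε₀ e U K) (hε : ∀ n, ε n ∈ Ioo 0 ε₀)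
    (hε0 : Tendsto ε atTop (𝓝 0)) {ρ₁ ρ₂ : ℕ → ℝ → ℝ} (h₁ : ∀ n, IsSol G (K ∩ U) (ε n) (ρ₁ n))
    (h₂ : ∀ n, IsSol G (K ∩ U) (ε n) (ρ₂ n)) (h₁₂ : ∀ n θ, ρ₁ n θ < ρ₂ n θ) {ℓ : ℝ}
    (hℓ₁ : Tendsto (fun n => ρ₁ n 0) atTop (𝓝 ℓ)) (hℓ₂ : Tendsto (fun n => ρ₂ n 0) atTop (𝓝 ℓ))
    {a b C : ℝ} (ha : 0 ≤ a) (hab : a ≤ b) (hb : b ≤ 2 * π)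
    (hC : ∀ᶠ n in atTop, ∀ θ ∈ Icc a b, |dq G (ε n) (ρ₁ n θ) (ρ₂ n θ) θ| ≤ C) :
    Tendsto (fun n => ∫ θ in a..b, dq G (ε n) (ρ₁ n θ) (ρ₂ n θ) θ) atTop
      (𝓝 (∫ θ in a..b, pd G 0 ℓ θ)) := by
  refine intervalIntegral.tendsto_integral_filter_of_dominated_convergence (fun _ => C)
    (Eventually.of_forall fun n =>
      (A.continuous_dq (hε n) (h₁ n) (h₂ n) (h₁₂ n)).aestronglyMeasurable)
    ?_ intervalIntegrable_const ?_
  · filter_upwards [hC] with n hn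
    refine Eventually.of_forall fun θ hθ => hn θ ?_
    rw [uIoc_of_le hab] at hθ
    exact Ioc_subset_Icc_self hθ
  · filter_upwards [A.ae_contDiffAt (A.limit_mem h₁ hℓ₁)] with θ hθ hθ'
    rw [uIoc_of_le hab] at hθ'
    have hθ2 : θ ∈ Icc 0 (2 * π) := ⟨ha.trans hθ'.1.le, hθ'.2.trans hb⟩
    choose ξ hξ hξe using fun n => A.exists_dq_eq (Ioo_subset_Icc_self (hε n)) ((h₁ n).mem θ).2
      ((h₂ n).mem θ).2 (h₁₂ n θ) θ
    simp only [hξe]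
    exact tendsto_of_continuousAt_unc (contDiffAt_pd (n := 2) (by norm_num) hθ).continuousAt hε0
      (tendsto_of_tendsto_of_tendsto_of_le_of_le (A.tendsto_apply hε hε0 h₁ hℓ₁ hθ2)
        (A.tendsto_apply hε hε0 h₂ hℓ₂ hθ2) (fun n => (hξ n).1.le) (fun n => (hξ n).2.le))

lemma Averaging.eventually_dq_bound (A : Averaging G ε₀ e U K) (hε : ∀ n, ε n ∈ Ioo 0 ε₀)
    (hε0 : Tendsto ε atTop (𝓝 0)) {ρ₁ ρ₂ : ℕ → ℝ → ℝ} (h₁ : ∀ n, IsSol G (K ∩ U) (ε n) (ρ₁ n))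
    (h₂ : ∀ n, IsSol G (K ∩ U) (ε n) (ρ₂ n)) (h₁₂ : ∀ n θ, ρ₁ n θ < ρ₂ n θ) {ℓ : ℝ} (hℓ : ℓ ∈ U)
    (hℓ₁ : Tendsto (fun n => ρ₁ n 0) atTop (𝓝 ℓ)) (hℓ₂ : Tendsto (fun n => ρ₂ n 0) atTop (𝓝 ℓ)) :
    ∃ M > 0, ∀ᶠ n in atTop, ∀ θ ∈ Icc 0 (2 * π), |dq G (ε n) (ρ₁ n θ) (ρ₂ n θ) θ| ≤ M := by
  obtain ⟨δ, hδ, -, M, hM, hb⟩ := A.exists_local_bound hℓ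
  refine ⟨M, hM, ?_⟩
  filter_upwards [A.eventually_near hε hε0 h₁ hℓ₁ hδ, A.eventually_near hε hε0 h₂ hℓ₂ hδ]
    with n hn₁ hn₂ θ hθ
  obtain ⟨ξ, hξ, h⟩ := A.exists_dq_eq (Ioo_subset_Icc_self (hε n)) ((h₁ n).mem θ).2
    ((h₂ n).mem θ).2 (h₁₂ n θ) θ
  rw [h]
  exact (hb _ (Ioo_subset_Icc_self (hε n)) ξ
    ⟨(hn₁ θ hθ).1.trans hξ.1.le, hξ.2.le.trans (hn₂ θ hθ).2⟩ θ hθ).1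

lemma Averaging.integral_pd_eq_zero (A : Averaging G ε₀ e U K) (hε : ∀ n, ε n ∈ Ioo 0 ε₀)
    (hε0 : Tendsto ε atTop (𝓝 0)) {ρ₁ ρ₂ : ℕ → ℝ → ℝ} (h₁ : ∀ n, IsSol G (K ∩ U) (ε n) (ρ₁ n))
    (h₂ : ∀ n, IsSol G (K ∩ U) (ε n) (ρ₂ n)) (h₁₂ : ∀ n θ, ρ₁ n θ < ρ₂ n θ) {ℓ : ℝ} (hℓ : ℓ ∈ U)
    (hℓ₁ : Tendsto (fun n => ρ₁ n 0) atTop (𝓝 ℓ)) (hℓ₂ : Tendsto (fun n => ρ₂ n 0) atTop (𝓝 ℓ)) :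
    ∫ θ in (0:ℝ)..2 * π, pd G 0 ℓ θ = 0 := by
  obtain ⟨M, -, hM⟩ := A.eventually_dq_bound hε hε0 h₁ h₂ h₁₂ hℓ hℓ₁ hℓ₂
  have hlim := A.tendsto_integral_dq hε hε0 h₁ h₂ h₁₂ hℓ₁ hℓ₂ le_rfl (by positivity) le_rfl hM
  simp only [fun n => A.integral_dq (hε n) (h₁ n) (h₂ n) (h₁₂ n)] at hlim
  exact (tendsto_nhds_unique tendsto_const_nhds hlim).symm

end

lemma exists_second_dq {F F₁ F₂ : ℝ → ℝ} {a b c : ℝ} (hab : a < b) (hbc : b < c)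
    (h₁ : ∀ r ∈ Icc a c, HasDerivAt F (F₁ r) r) (h₂ : ∀ r ∈ Icc a c, HasDerivAt F₁ (F₂ r) r) :
    ∃ ξ ∈ Ioo a c, (F c - F b) / (c - b) - (F b - F a) / (b - a) = (c - a) / 2 * F₂ ξ := by
  set m := (F b - F a) / (b - a) with hm
  set q := ((F c - F b) / (c - b) - m) / (c - a) with hq
  have hba := (sub_pos.2 hab).ne'
  have hcb := (sub_pos.2 hbc).ne'
  have hca := (sub_pos.2 (hab.trans hbc)).ne'
  have hmb : m * (b - a) = F b - F a := by rw [hm]; field_simp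
  have hqc : q * (c - a) * (c - b) = F c - F b - m * (c - b) := by rw [hq]; field_simp
  have hd : ∀ r ∈ Icc a c, HasDerivAt (fun r => F r - F a - m * (r - a) - q * ((r - a) * (r - b)))
      (F₁ r - m - q * (2 * r - a - b)) r := fun r hr => by
    have h3 := (((h₁ r hr).sub_const (F a)).sub (((hasDerivAt_id r).sub_const a).const_mul m)).sub
      ((((hasDerivAt_id r).sub_const a).mul ((hasDerivAt_id r).sub_const b)).const_mul q)
    exact h3.congr_deriv (by simp only [id]; ring)
  obtain ⟨ξ₁, hξ₁, e₁⟩ := exists_hasDerivAt_eq_zero hab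
    (fun r hr => (hd r ⟨hr.1, hr.2.trans hbc.le⟩).continuousAt.continuousWithinAt)
    (by linear_combination hmb) (fun r hr => hd r ⟨hr.1.le, hr.2.le.trans hbc.le⟩)
  obtain ⟨ξ₂, hξ₂, e₂⟩ := exists_hasDerivAt_eq_zero hbc
    (fun r hr => (hd r ⟨hab.le.trans hr.1, hr.2⟩).continuousAt.continuousWithinAt)
    (by linear_combination hqc) (fun r hr => hd r ⟨hab.le.trans hr.1.le, hr.2.le⟩)
  have hd₂ : ∀ r ∈ Icc a c, HasDerivAt (fun r => F₁ r - m - q * (2 * r - a - b))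
      (F₂ r - q * 2) r := fun r hr => by
    have h3 := ((h₂ r hr).sub_const m).sub
      (((((hasDerivAt_id r).const_mul 2).sub_const a).sub_const b).const_mul q)
    exact h3.congr_deriv (by ring)
  obtain ⟨ξ, hξ, e₃⟩ := exists_hasDerivAt_eq_zero (hξ₁.2.trans hξ₂.1)
    (fun r hr => (hd₂ r ⟨hξ₁.1.le.trans hr.1, hr.2.trans hξ₂.2.le⟩).continuousAt.continuousWithinAt)
    (e₁.trans e₂.symm) (fun r hr => hd₂ r ⟨hξ₁.1.le.trans hr.1.le, hr.2.le.trans hξ₂.2.le⟩)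
  refine ⟨ξ, ⟨hξ₁.1.trans hξ.1, hξ.2.trans hξ₂.2⟩, ?_⟩
  rw [show F₂ ξ = 2 * q by linarith, hq]
  field_simp

lemma hasDerivAt_integral_pd {F : ℝ → ℝ → ℝ → ℝ} {U : Set ℝ} (hU : IsOpen U)
    (h : ∀ ρ ∈ U, ∀ θ, ContDiffAt ℝ 1 (unc F) (0, ρ, θ)) {ℓ : ℝ} (hℓ : ℓ ∈ U) :
    HasDerivAt (fun ρ => ∫ θ in (0:ℝ)..2 * π, F 0 ρ θ) (∫ θ in (0:ℝ)..2 * π, pd F 0 ℓ θ) ℓ := by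
  obtain ⟨δ, hδ, hδU⟩ := Metric.nhds_basis_closedBall.mem_iff.1 (hU.mem_nhds hℓ)
  have hc : IsCompact (Metric.closedBall ℓ δ ×ˢ Icc 0 (2 * π)) :=
    (isCompact_closedBall _ _).prod isCompact_Icc
  have hpd : ∀ ρ ∈ U, ∀ θ, ContinuousAt (unc (pd F)) (0, ρ, θ) := fun ρ hρ θ =>
    (contDiffAt_pd (n := 0) (by norm_num) (h ρ hρ θ)).continuousAt
  obtain ⟨M, hM⟩ := hc.exists_bound_of_continuousOn (f := fun q : ℝ × ℝ => pd F 0 q.1 q.2)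
    fun q hq => (ContinuousAt.comp (g := unc (pd F)) (f := fun q : ℝ × ℝ => (0, q.1, q.2))
      (hpd q.1 (hδU hq.1) q.2) (by fun_prop)).continuousWithinAt
  have hF : ∀ ρ ∈ U, Continuous fun θ => F 0 ρ θ := fun ρ hρ => continuous_iff_continuousAt.2
    fun θ => ContinuousAt.comp (g := unc F) (f := fun θ => (0, ρ, θ)) (h ρ hρ θ).continuousAt
      (by fun_prop)
  have hF' : ∀ ρ ∈ U, Continuous fun θ => pd F 0 ρ θ := fun ρ hρ => continuous_iff_continuousAt.2
    fun θ => ContinuousAt.comp (g := unc (pd F)) (f := fun θ => (0, ρ, θ)) (hpd ρ hρ θ)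
      (by fun_prop)
  refine (intervalIntegral.hasDerivAt_integral_of_dominated_loc_of_deriv_le
    (F := fun ρ θ => F 0 ρ θ) (F' := fun ρ θ => pd F 0 ρ θ) (bound := fun _ => M)
    (Metric.closedBall_mem_nhds ℓ hδ) ?_ ((hF ℓ hℓ).intervalIntegrable _ _)
    (hF' ℓ hℓ).aestronglyMeasurable ?_ intervalIntegrable_const ?_).2
  · filter_upwards [hU.mem_nhds hℓ] with ρ hρ
    exact (hF ρ hρ).aestronglyMeasurable
  · exact Eventually.of_forall fun θ hθ ρ hρ => hM (ρ, θ) ⟨hρ, mem_Icc_of_mem_uIoc hθ⟩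
  · exact Eventually.of_forall fun θ _ ρ hρ => hasDerivAt_pd one_ne_zero (h ρ (hδU hρ) θ)

/-- A condition forbidding two solutions with values near the end point `e`. -/
def EndCondition (G : ℝ → ℝ → ℝ → ℝ) (ε₀ e : ℝ) (S : Set ℝ) : Prop :=
  ∃ σ C a b M : ℝ, 0 ≤ a ∧ a ≤ b ∧ b ≤ 2 * π ∧
    (∀ ε ∈ Ioo 0 ε₀, ∀ u ∈ S, ∀ v ∈ S, u < v →
      (∀ θ ∈ Icc 0 (2 * π), -C ≤ σ * dq G ε u v θ) ∧ ∀ θ ∈ Icc a b, |dq G ε u v θ| ≤ M) ∧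
    C * (2 * π - (b - a)) < σ * ∫ θ in a..b, pd G 0 e θ

section

variable {G : ℝ → ℝ → ℝ → ℝ} {ε₀ e : ℝ} {U K : Set ℝ} {ε : ℕ → ℝ}

lemma Averaging.not_endCondition (A : Averaging G ε₀ e U K) (hε : ∀ n, ε n ∈ Ioo 0 ε₀)
    (hε0 : Tendsto ε atTop (𝓝 0)) {ρ₁ ρ₂ : ℕ → ℝ → ℝ} (h₁ : ∀ n, IsSol G (K ∩ U) (ε n) (ρ₁ n))
    (h₂ : ∀ n, IsSol G (K ∩ U) (ε n) (ρ₂ n)) (h₁₂ : ∀ n θ, ρ₁ n θ < ρ₂ n θ)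
    (hℓ₁ : Tendsto (fun n => ρ₁ n 0) atTop (𝓝 e)) (hℓ₂ : Tendsto (fun n => ρ₂ n 0) atTop (𝓝 e)) :
    ¬ EndCondition G ε₀ e (K ∩ U) := by
  rintro ⟨σ, C, a, b, M, ha, hab, hb, hC, hlt⟩
  have hlim := A.tendsto_integral_dq hε hε0 h₁ h₂ h₁₂ hℓ₁ hℓ₂ ha hab hb (C := M)
    (Eventually.of_forall fun n θ hθ =>
      (hC _ (hε n) _ ((h₁ n).mem θ) _ ((h₂ n).mem θ) (h₁₂ n θ)).2 θ hθ)
  refine absurd hlt (not_lt.2 (le_of_tendsto (hlim.const_mul σ) (Eventually.of_forall fun n => ?_)))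
  have hc : ∀ u v, IntervalIntegrable (fun θ => σ * dq G (ε n) (ρ₁ n θ) (ρ₂ n θ) θ) volume u v :=
    fun u v => ((A.continuous_dq (hε n) (h₁ n) (h₂ n) (h₁₂ n)).const_mul σ).intervalIntegrable u v
  have h0 : ∫ θ in (0:ℝ)..2 * π, σ * dq G (ε n) (ρ₁ n θ) (ρ₂ n θ) θ = 0 := by
    rw [intervalIntegral.integral_const_mul, A.integral_dq (hε n) (h₁ n) (h₂ n) (h₁₂ n), mul_zero]
  rw [← intervalIntegral.integral_add_adjacent_intervals (hc 0 a) (hc a _),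
    ← intervalIntegral.integral_add_adjacent_intervals (hc a b) (hc b _)] at h0
  have hlow : ∀ u v, 0 ≤ u → u ≤ v → v ≤ 2 * π →
      (v - u) * (-C) ≤ ∫ θ in u..v, σ * dq G (ε n) (ρ₁ n θ) (ρ₂ n θ) θ := fun u v hu huv hv => by
    have := intervalIntegral.integral_mono_on huv intervalIntegrable_const (hc u v)
      fun θ hθ => (hC _ (hε n) _ ((h₁ n).mem θ) _ ((h₂ n).mem θ) (h₁₂ n θ)).1 θ
        ⟨hu.trans hθ.1, hθ.2.trans hv⟩
    rwa [intervalIntegral.integral_const, smul_eq_mul] at this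
  have l₁ := hlow 0 a le_rfl ha (hab.trans hb)
  have l₂ := hlow b (2 * π) (ha.trans hab) hb le_rfl
  rw [← intervalIntegral.integral_const_mul]
  linarith

lemma Averaging.integral_pd_pd_eq_zero (A : Averaging G ε₀ e U K) (hε : ∀ n, ε n ∈ Ioo 0 ε₀)
    (hε0 : Tendsto ε atTop (𝓝 0)) {ρ₁ ρ₂ ρ₃ : ℕ → ℝ → ℝ}
    (h₁ : ∀ n, IsSol G (K ∩ U) (ε n) (ρ₁ n)) (h₂ : ∀ n, IsSol G (K ∩ U) (ε n) (ρ₂ n))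
    (h₃ : ∀ n, IsSol G (K ∩ U) (ε n) (ρ₃ n)) (h₁₂ : ∀ n θ, ρ₁ n θ < ρ₂ n θ)
    (h₂₃ : ∀ n θ, ρ₂ n θ < ρ₃ n θ) {ℓ : ℝ} (hℓ : ℓ ∈ U)
    (hℓ₁ : Tendsto (fun n => ρ₁ n 0) atTop (𝓝 ℓ)) (hℓ₃ : Tendsto (fun n => ρ₃ n 0) atTop (𝓝 ℓ)) :
    ∫ θ in (0:ℝ)..2 * π, pd (pd G) 0 ℓ θ = 0 := by
  have hε' : ∀ n, ε n ∈ Icc 0 ε₀ := fun n => Ioo_subset_Icc_self (hε n)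
  have h₁₃ : ∀ n θ, ρ₁ n θ < ρ₃ n θ := fun n θ => (h₁₂ n θ).trans (h₂₃ n θ)
  obtain ⟨δ, hδ, hδU, M₂, hM₂, hb⟩ := A.exists_local_bound hℓ
  obtain ⟨M, hM, hdq⟩ := A.eventually_dq_bound hε hε0 h₁ h₃ h₁₃ hℓ hℓ₁ hℓ₃
  set w : ℕ → ℝ → ℝ := fun n θ => (ρ₃ n θ - ρ₁ n θ) / (ρ₃ n 0 - ρ₁ n 0) with hw
  have hpos : ∀ n θ, 0 < ρ₃ n θ - ρ₁ n θ := fun n θ => sub_pos.2 (h₁₃ n θ)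
  have hwpos : ∀ n θ, 0 < w n θ := fun n θ => div_pos (hpos n θ) (hpos n 0)
  have hlogw : ∀ᶠ n in atTop, ∀ θ ∈ Icc 0 (2 * π), |log (w n θ)| ≤ ε n * (M * (2 * π)) := by
    filter_upwards [hdq] with n hn θ hθ
    have h2 := Convex.norm_image_sub_le_of_norm_hasDerivWithin_le
      (f := fun θ => log (ρ₃ n θ - ρ₁ n θ)) (C := ε n * M) (s := Icc 0 (2 * π)) (x := 0) (y := θ)
      (fun t _ => (hasDerivAt_log_sub (h₁ n) (h₃ n) (h₁₃ n) t).hasDerivWithinAt)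
      (fun t ht => by
        rw [norm_mul, Real.norm_eq_abs, abs_of_pos (hε n).1]
        exact mul_le_mul_of_nonneg_left (hn t ht) (hε n).1.le) (convex_Icc _ _)
      ⟨le_rfl, by positivity⟩ hθ
    rw [Real.norm_eq_abs, Real.norm_eq_abs, sub_zero, abs_of_nonneg hθ.1] at h2
    rw [hw, log_div (hpos n θ).ne' (hpos n 0).ne']
    refine h2.trans ?_
    rw [mul_assoc]
    exact mul_le_mul_of_nonneg_left (mul_le_mul_of_nonneg_left hθ.2 hM.le) (hε n).1.le
  have hξ : ∀ n θ, ∃ ξ ∈ Ioo (ρ₁ n θ) (ρ₃ n θ),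
      (dq G (ε n) (ρ₂ n θ) (ρ₃ n θ) θ - dq G (ε n) (ρ₁ n θ) (ρ₂ n θ) θ) / (ρ₃ n 0 - ρ₁ n 0)
        = w n θ / 2 * pd (pd G) (ε n) ξ θ := fun n θ => by
    have hU : ∀ r ∈ Icc (ρ₁ n θ) (ρ₃ n θ), ContDiffAt ℝ 3 (unc G) (ε n, r, θ) := fun r hr =>
      A.smooth _ (hε' n) r (A.ordConnected.out ((h₁ n).mem θ).2 ((h₃ n).mem θ).2 hr) θ
    obtain ⟨ξ, hξ, h⟩ := exists_second_dq (F := fun r => G (ε n) r θ)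
      (F₁ := fun r => pd G (ε n) r θ) (F₂ := fun r => pd (pd G) (ε n) r θ) (h₁₂ n θ) (h₂₃ n θ)
      (fun r hr => hasDerivAt_pd (by norm_num) (hU r hr))
      (fun r hr => hasDerivAt_pd (n := 2) (by norm_num) (contDiffAt_pd (by norm_num) (hU r hr)))
    refine ⟨ξ, hξ, ?_⟩
    simp only [dq]
    rw [h, hw]
    ring
  choose ξ hξm hξe using hξ
  have h0 : ∀ n, ∫ θ in (0:ℝ)..2 * π, (dq G (ε n) (ρ₂ n θ) (ρ₃ n θ) θ -
      dq G (ε n) (ρ₁ n θ) (ρ₂ n θ) θ) / (ρ₃ n 0 - ρ₁ n 0) = 0 := fun n => by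
    rw [intervalIntegral.integral_div, intervalIntegral.integral_sub
      ((A.continuous_dq (hε n) (h₂ n) (h₃ n) (h₂₃ n)).intervalIntegrable _ _)
      ((A.continuous_dq (hε n) (h₁ n) (h₂ n) (h₁₂ n)).intervalIntegrable _ _),
      A.integral_dq (hε n) (h₁ n) (h₂ n) (h₁₂ n), A.integral_dq (hε n) (h₂ n) (h₃ n) (h₂₃ n),
      sub_zero, zero_div]
  have hlim := intervalIntegral.tendsto_integral_filter_of_dominated_convergence
    (μ := volume) (a := 0) (b := 2 * π) (l := atTop)
    (F := fun n θ => (dq G (ε n) (ρ₂ n θ) (ρ₃ n θ) θ -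
      dq G (ε n) (ρ₁ n θ) (ρ₂ n θ) θ) / (ρ₃ n 0 - ρ₁ n 0))
    (f := fun θ => 1 / 2 * pd (pd G) 0 ℓ θ) (fun _ => exp (ε₀ * (M * (2 * π))) / 2 * M₂)
    (Eventually.of_forall fun n => (((A.continuous_dq (hε n) (h₂ n) (h₃ n) (h₂₃ n)).sub
      (A.continuous_dq (hε n) (h₁ n) (h₂ n) (h₁₂ n))).div_const _).aestronglyMeasurable)
    ?_ intervalIntegrable_const ?_
  · simp only [h0] at hlim
    have := (tendsto_nhds_unique tendsto_const_nhds hlim).symm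
    rw [intervalIntegral.integral_const_mul] at this
    linarith
  · filter_upwards [hlogw, A.eventually_near hε hε0 h₁ hℓ₁ hδ, A.eventually_near hε hε0 h₃ hℓ₃ hδ]
      with n hn hn₁ hn₃
    refine Eventually.of_forall fun θ hθ => ?_
    have hθ' := mem_Icc_of_mem_uIoc hθ
    rw [hξe, norm_mul, norm_div, Real.norm_eq_abs, Real.norm_eq_abs, Real.norm_eq_abs, abs_two,
      abs_of_pos (hwpos n θ)]
    have h1 : w n θ ≤ exp (ε₀ * (M * (2 * π))) := by
      rw [← log_le_iff_le_exp (hwpos n θ)]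
      refine (le_abs_self _).trans ((hn θ hθ').trans ?_)
      exact mul_le_mul_of_nonneg_right (hε n).2.le (by positivity)
    have h2 := (hb _ (hε' n) (ξ n θ) ⟨(hn₁ θ hθ').1.trans (hξm n θ).1.le,
      (hξm n θ).2.le.trans (hn₃ θ hθ').2⟩ θ hθ').2
    gcongr
  · refine Eventually.of_forall fun θ hθ => ?_
    have hθ' := mem_Icc_of_mem_uIoc hθ
    simp only [hξe]
    have hlog0 : Tendsto (fun n => log (w n θ)) atTop (𝓝 0) := by
      refine squeeze_zero_norm' (a := fun n => ε n * (M * (2 * π))) ?_ ?_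
      · filter_upwards [hlogw] with n hn using hn θ hθ'
      · simpa using hε0.mul_const (M * (2 * π))
    have hw1 : Tendsto (fun n => w n θ) atTop (𝓝 1) := by
      have := (continuous_exp.tendsto 0).comp hlog0
      rw [exp_zero] at this
      exact this.congr fun n => exp_log (hwpos n θ)
    exact (hw1.div_const 2).mul (tendsto_of_continuousAt_unc (contDiffAt_pd (n := 1) (by norm_num)
      (contDiffAt_pd (n := 2) (by norm_num) (A.smooth 0 ⟨le_rfl, A.pos.le⟩ ℓ hℓ θ))).continuousAt
      hε0 (tendsto_of_tendsto_of_tendsto_of_le_of_le (A.tendsto_apply hε hε0 h₁ hℓ₁ hθ')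
        (A.tendsto_apply hε hε0 h₃ hℓ₃ hθ') (fun n => (hξm n θ).1.le) (fun n => (hξm n θ).2.le)))

lemma Averaging.continuousOn_integral (A : Averaging G ε₀ e U K) :
    ContinuousOn (fun ρ => ∫ θ in (0:ℝ)..2 * π, G 0 ρ θ) K := by
  intro ℓ hℓ
  obtain ⟨B, hB⟩ := A.bounded
  have hmem : (0:ℝ) ∈ Icc 0 ε₀ := ⟨le_rfl, A.pos.le⟩
  rcases A.subset hℓ with rfl | hU
  · rw [← continuousWithinAt_sdiff_self]
    have : K \ {ℓ} ⊆ U := fun ρ hρ => (A.subset hρ.1).resolve_left hρ.2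
    refine intervalIntegral.tendsto_integral_filter_of_dominated_convergence (fun _ => B)
      ?_ ?_ intervalIntegrable_const ?_
    · filter_upwards [self_mem_nhdsWithin] with ρ hρ
      exact (A.continuous_comp hmem continuous_const fun _ => this hρ).aestronglyMeasurable
    · filter_upwards [self_mem_nhdsWithin] with ρ hρ
      exact Eventually.of_forall fun θ _ => hB 0 hmem ρ hρ.1 θ
    · filter_upwards [A.smooth_end] with θ hθ _
      exact ((ContinuousAt.comp (g := unc G) (f := fun ρ => (0, ρ, θ)) hθ.continuousAt
        (by fun_prop)).continuousWithinAt).tendsto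
  · exact (hasDerivAt_integral_pd A.isOpen (fun ρ hρ θ => (A.smooth 0 hmem ρ hρ θ).of_le
      (by norm_num)) hU).continuousAt.continuousWithinAt

/-- There is no solution for small parameters if the averaged function has no zero. -/
lemma Averaging.exists_forall_not_isSol (A : Averaging G ε₀ e U K)
    (hN : ∀ ℓ ∈ K, ∫ θ in (0:ℝ)..2 * π, G 0 ℓ θ ≠ 0) :
    ∃ ε₁ > 0, ∀ ε ∈ Ioo 0 ε₁, ∀ ρ, ¬ IsSol G (K ∩ U) ε ρ := by
  by_contra! h
  have hpos : ∀ n : ℕ, (0:ℝ) < min ε₀ (1 / (n + 1)) := fun n => lt_min A.pos (by positivity)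
  choose ε hε ρ hρ using fun n : ℕ => h _ (hpos n)
  have hε' : ∀ n, ε n ∈ Ioo 0 ε₀ := fun n => ⟨(hε n).1, (hε n).2.trans_le (min_le_left _ _)⟩
  have hε0 : Tendsto ε atTop (𝓝 0) := squeeze_zero (fun n => (hε n).1.le)
    (fun n => (hε n).2.le.trans (min_le_right _ _)) tendsto_one_div_add_atTop_nhds_zero_nat
  obtain ⟨ℓ, hℓ, φ, hφ, hlim⟩ := A.isCompact.tendsto_subseq fun n => ((hρ n).mem 0).1
  exact hN ℓ hℓ (A.integral_eq_zero (fun n => hε' (φ n)) (hε0.comp hφ.tendsto_atTop)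
    (fun n => hρ (φ n)) hlim)

/-- There are at most two solutions for small parameters if the averaged function has at
most two zeros, counted with multiplicity, by a condition on its derivatives. -/
lemma Averaging.exists_forall_not_three (A : Averaging G ε₀ e U K)
    (hend : EndCondition G ε₀ e (K ∩ U))
    (hN : (∀ ℓ ∈ U, ∫ θ in (0:ℝ)..2 * π, pd G 0 ℓ θ ≠ 0) ∨ ∃ κ : ℝ, ∀ ℓ ∈ U,
      ∫ θ in (0:ℝ)..2 * π, pd (pd G) 0 ℓ θ < κ * ∫ θ in (0:ℝ)..2 * π, pd G 0 ℓ θ) :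
    ∃ ε₁ > 0, ∀ ε ∈ Ioo 0 ε₁, ∀ ρ₁ ρ₂ ρ₃, IsSol G (K ∩ U) ε ρ₁ → IsSol G (K ∩ U) ε ρ₂ →
      IsSol G (K ∩ U) ε ρ₃ → (∀ θ, ρ₁ θ < ρ₂ θ) → (∀ θ, ρ₂ θ < ρ₃ θ) → False := by
  by_contra! h
  have hpos : ∀ n : ℕ, (0:ℝ) < min ε₀ (1 / (n + 1)) := fun n => lt_min A.pos (by positivity)
  choose ε hε ρ₁ ρ₂ ρ₃ h₁ h₂ h₃ h₁₂ h₂₃ _ using fun n : ℕ => h _ (hpos n)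
  have hε' : ∀ n, ε n ∈ Ioo 0 ε₀ := fun n => ⟨(hε n).1, (hε n).2.trans_le (min_le_left _ _)⟩
  have hε0 : Tendsto ε atTop (𝓝 0) := squeeze_zero (fun n => (hε n).1.le)
    (fun n => (hε n).2.le.trans (min_le_right _ _)) tendsto_one_div_add_atTop_nhds_zero_nat
  obtain ⟨⟨ℓ₁, ℓ₂, ℓ₃⟩, hℓ, φ, hφ, hlim⟩ :=
    (A.isCompact.prod (A.isCompact.prod A.isCompact)).tendsto_subseq
    (x := fun n => (ρ₁ n 0, ρ₂ n 0, ρ₃ n 0))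
    fun n => ⟨((h₁ n).mem 0).1, ((h₂ n).mem 0).1, ((h₃ n).mem 0).1⟩
  have hε0' := hε0.comp hφ.tendsto_atTop
  have t₁ : Tendsto (fun n => ρ₁ (φ n) 0) atTop (𝓝 ℓ₁) :=
    (continuous_fst.tendsto _).comp hlim
  have t₂ : Tendsto (fun n => ρ₂ (φ n) 0) atTop (𝓝 ℓ₂) :=
    ((continuous_fst.comp continuous_snd).tendsto _).comp hlim
  have t₃ : Tendsto (fun n => ρ₃ (φ n) 0) atTop (𝓝 ℓ₃) :=
    ((continuous_snd.comp continuous_snd).tendsto _).comp hlim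
  have z₁ := A.integral_eq_zero (fun n => hε' (φ n)) hε0' (fun n => h₁ (φ n)) t₁
  have z₂ := A.integral_eq_zero (fun n => hε' (φ n)) hε0' (fun n => h₂ (φ n)) t₂
  have z₃ := A.integral_eq_zero (fun n => hε' (φ n)) hε0' (fun n => h₃ (φ n)) t₃
  have l₁₂ : ℓ₁ ≤ ℓ₂ := le_of_tendsto_of_tendsto' t₁ t₂ fun n => (h₁₂ _ 0).le
  have l₂₃ : ℓ₂ ≤ ℓ₃ := le_of_tendsto_of_tendsto' t₂ t₃ fun n => (h₂₃ _ 0).le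
  have hsame : ∀ {ρ ρ' : ℕ → ℝ → ℝ} {ℓ}, (∀ n, IsSol G (K ∩ U) (ε n) (ρ n)) →
      (∀ n, IsSol G (K ∩ U) (ε n) (ρ' n)) → (∀ n θ, ρ n θ < ρ' n θ) →
      Tendsto (fun n => ρ (φ n) 0) atTop (𝓝 ℓ) → Tendsto (fun n => ρ' (φ n) 0) atTop (𝓝 ℓ) →
      ℓ ∈ K → ℓ ∈ U ∧ ∫ θ in (0:ℝ)..2 * π, pd G 0 ℓ θ = 0 := by
    intro ρ ρ' ℓ h h' hlt t t' hK
    rcases A.subset hK with rfl | hU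
    · exact absurd hend (A.not_endCondition (fun n => hε' (φ n)) hε0' (fun n => h (φ n))
        (fun n => h' (φ n)) (fun n => hlt (φ n)) t t')
    · exact ⟨hU, A.integral_pd_eq_zero (fun n => hε' (φ n)) hε0' (fun n => h (φ n))
        (fun n => h' (φ n)) (fun n => hlt (φ n)) hU t t'⟩
  have hmem : (0:ℝ) ∈ Icc 0 ε₀ := ⟨le_rfl, A.pos.le⟩
  have hN0 : ∀ ℓ ∈ U, _ := fun ℓ hℓ => hasDerivAt_integral_pd A.isOpen
    (fun ρ hρ θ => (A.smooth 0 hmem ρ hρ θ).of_le (by norm_num)) hℓ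
  have hN1 : ∀ ℓ ∈ U, _ := fun ℓ hℓ => hasDerivAt_integral_pd (F := pd G) A.isOpen
    (fun ρ hρ θ => (contDiffAt_pd (n := 2) (by norm_num) (A.smooth 0 hmem ρ hρ θ)).of_le
      (by norm_num)) hℓ
  have hrolle : ∀ u ∈ K, ∀ v ∈ K, u < v → ∫ θ in (0:ℝ)..2 * π, G 0 u θ = 0 →
      ∫ θ in (0:ℝ)..2 * π, G 0 v θ = 0 →
      ∃ ξ ∈ Ioo u v, ξ ∈ U ∧ ∫ θ in (0:ℝ)..2 * π, pd G 0 ξ θ = 0 := by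
    intro u hu v hv huv hu0 hv0
    obtain ⟨ξ, hξ, h⟩ := exists_hasDerivAt_eq_zero huv
      (A.continuousOn_integral.mono (A.ordConnected'.out hu hv)) (hu0.trans hv0.symm)
      fun r hr => hN0 r (A.Ioo_subset u hu v hv hr)
    exact ⟨ξ, hξ, A.Ioo_subset u hu v hv hξ, h⟩
  rcases hN with hN | ⟨κ, hκ⟩
  · rcases l₁₂.eq_or_lt with rfl | hlt
    · obtain ⟨hU, h0⟩ := hsame h₁ h₂ h₁₂ t₁ t₂ hℓ.1
      exact hN _ hU h0
    · obtain ⟨ξ, -, hU, h0⟩ := hrolle _ hℓ.1 _ hℓ.2.1 hlt z₁ z₂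
      exact hN _ hU h0
  · have hanti : StrictAntiOn (fun ρ => exp (-κ * ρ) * ∫ θ in (0:ℝ)..2 * π, pd G 0 ρ θ) U := by
      have hd : ∀ ℓ ∈ U, _ := fun ℓ hℓ =>
        (((hasDerivAt_id ℓ).const_mul (-κ)).exp).mul (hN1 ℓ hℓ)
      refine strictAntiOn_of_deriv_neg A.ordConnected.convex
        (fun ℓ hℓ => (hd ℓ hℓ).continuousAt.continuousWithinAt) fun ℓ hℓ => ?_
      have hℓ := interior_subset hℓ
      refine lt_of_eq_of_lt ((hd ℓ hℓ).congr_deriv (g' := exp (-κ * ℓ) *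
        ((∫ θ in (0:ℝ)..2 * π, pd (pd G) 0 ℓ θ) - κ * ∫ θ in (0:ℝ)..2 * π, pd G 0 ℓ θ))
        (by simp only [id]; ring)).deriv ?_
      exact mul_neg_of_pos_of_neg (exp_pos _) (sub_neg.2 (hκ ℓ hℓ))
    have huniq : ∀ u ∈ U, ∀ v ∈ U, ∫ θ in (0:ℝ)..2 * π, pd G 0 u θ = 0 →
        ∫ θ in (0:ℝ)..2 * π, pd G 0 v θ = 0 → u = v := fun u hu v hv h0 h0' =>
      hanti.injOn hu hv (by simp only [h0, h0', mul_zero])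
    rcases l₁₂.eq_or_lt with rfl | hlt
    · obtain ⟨hU, h0⟩ := hsame h₁ h₂ h₁₂ t₁ t₂ hℓ.1
      rcases l₂₃.eq_or_lt with rfl | hlt'
      · have := hκ _ hU
        rw [h0, A.integral_pd_pd_eq_zero (fun n => hε' (φ n)) hε0' (fun n => h₁ (φ n))
          (fun n => h₂ (φ n)) (fun n => h₃ (φ n)) (fun n => h₁₂ (φ n)) (fun n => h₂₃ (φ n))
          hU t₁ t₃] at this
        linarith
      · obtain ⟨ξ, hξ, hξU, hξ0⟩ := hrolle _ hℓ.2.1 _ hℓ.2.2 hlt' z₂ z₃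
        exact hξ.1.ne (huniq _ hU _ hξU h0 hξ0)
    · obtain ⟨ξ, hξ, hξU, hξ0⟩ := hrolle _ hℓ.1 _ hℓ.2.1 hlt z₁ z₂
      rcases l₂₃.eq_or_lt with rfl | hlt'
      · obtain ⟨hU, h0⟩ := hsame h₂ h₃ h₂₃ t₂ t₃ hℓ.2.1
        exact hξ.2.ne (huniq _ hξU _ hU hξ0 h0)
      · obtain ⟨ξ', hξ', hξU', hξ0'⟩ := hrolle _ hℓ.2.1 _ hℓ.2.2 hlt' z₂ z₃
        exact (hξ.2.trans hξ'.1).ne (huniq _ hξU _ hξU' hξ0 hξ0')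

end

/-- The damping coefficient divided by the position, as a function of the position. -/
noncomputable def phi (p₁ p₂ a : ℝ) : ℝ := p₁ / a + p₂ - a

/-- The scaled radial equation inside a loop, in the variable `log r` with `r ^ 2 = 1 + 4 H`. -/
noncomputable def Gin (p₁ p₂ ε ρ θ : ℝ) : ℝ :=
  phi p₁ p₂ √(1 - exp ρ * cos θ) * sin θ ^ 2 /
    (1 + ε * phi p₁ p₂ √(1 - exp ρ * cos θ) * sin θ * cos θ)

lemma sq_sin_le {r s c : ℝ} (h : s ^ 2 + c ^ 2 = 1) (h₀ : 0 ≤ r) (h₁ : r ≤ 1) :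
    s ^ 2 ≤ 2 * (1 - r * c) := by
  rcases le_total 0 c with hc | hc
  · nlinarith [mul_le_mul_of_nonneg_right h₁ hc, sq_nonneg (1 - c)]
  · nlinarith [mul_nonneg h₀ (neg_nonneg.2 hc), sq_nonneg c]

lemma abs_sin_le_sqrt {r s c : ℝ} (h : s ^ 2 + c ^ 2 = 1) (h₀ : 0 ≤ r) (h₁ : r ≤ 1) :
    |s| ≤ 2 * √(1 - r * c) := by
  have h2 := sq_sin_le h h₀ h₁
  apply abs_le_of_sq_le_sq _ (by positivity)
  rw [mul_pow, sq_sqrt (by nlinarith [sq_nonneg s])]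
  nlinarith [sq_nonneg s]

lemma sqrt_le_two {r s c : ℝ} (h : s ^ 2 + c ^ 2 = 1) (h₀ : 0 ≤ r) (h₁ : r ≤ 1) :
    √(1 - r * c) ≤ 2 := by
  rw [sqrt_le_left (by norm_num)]
  nlinarith [sq_nonneg s, sq_nonneg (c + 1), mul_nonneg h₀ (sub_nonneg.2 h₁)]

/-- A bound for `phi * sin`. -/
def bnd (p₁ p₂ : ℝ) : ℝ := 2 * |p₁| + |p₂| + 2

lemma bnd_pos (p₁ p₂ : ℝ) : 0 < bnd p₁ p₂ := by unfold bnd; positivity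

lemma abs_phi_mul_le {p₁ p₂ r s c : ℝ} (h : s ^ 2 + c ^ 2 = 1) (h₀ : 0 ≤ r) (h₁ : r ≤ 1) :
    |phi p₁ p₂ √(1 - r * c) * s| ≤ bnd p₁ p₂ := by
  set a := √(1 - r * c) with ha
  have ha0 : 0 ≤ a := sqrt_nonneg _
  have hs1 : |s| ≤ 1 := by rw [abs_le_one_iff_mul_self_le_one]; nlinarith [sq_nonneg c]
  have hsa := abs_sin_le_sqrt h h₀ h₁
  have ha2 := sqrt_le_two h h₀ h₁
  have hq : |s| / a ≤ 2 := div_le_of_le_mul₀ ha0 (by norm_num) hsa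
  have e : phi p₁ p₂ a * s = p₁ * (s / a) + p₂ * s + -(a * s) := by unfold phi; ring
  rw [e, bnd]
  refine (abs_add_three _ _ _).trans ?_
  rw [abs_neg, abs_mul, abs_mul, abs_mul, abs_div, abs_of_nonneg ha0]
  have := mul_le_mul_of_nonneg_left hq (abs_nonneg p₁)
  have := mul_le_mul_of_nonneg_left hs1 (abs_nonneg p₂)
  have := mul_le_mul ha2 hs1 (abs_nonneg s) (by norm_num)
  linarith

lemma den_mem {p₁ p₂ r s c ε : ℝ} (h : s ^ 2 + c ^ 2 = 1) (h₀ : 0 ≤ r) (h₁ : r ≤ 1)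
    (hε : 0 ≤ ε) (hεB : ε * bnd p₁ p₂ ≤ 1 / 2) :
    1 + ε * phi p₁ p₂ √(1 - r * c) * s * c ∈ Icc (1 / 2) (3 / 2) := by
  have hb := mul_le_mul_of_nonneg_left (abs_phi_mul_le (p₁ := p₁) (p₂ := p₂) h h₀ h₁) hε
  have hc1 : |c| ≤ 1 := by rw [abs_le_one_iff_mul_self_le_one]; nlinarith [sq_nonneg s]
  have : |ε * phi p₁ p₂ √(1 - r * c) * s * c| ≤ 1 / 2 := by
    rw [abs_mul, mul_assoc ε, abs_mul ε, abs_of_nonneg hε]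
    calc _ ≤ (1 / 2 : ℝ) * 1 := mul_le_mul (hb.trans hεB) hc1 (abs_nonneg _) (by norm_num)
      _ = _ := mul_one _
  rw [abs_le] at this
  exact ⟨by linarith, by linarith⟩

lemma abs_Gin_le {p₁ p₂ ε ρ θ : ℝ} (hρ : ρ ≤ 0) (hε : 0 ≤ ε) (hεB : ε * bnd p₁ p₂ ≤ 1 / 2) :
    |Gin p₁ p₂ ε ρ θ| ≤ 2 * bnd p₁ p₂ := by
  have h := sin_sq_add_cos_sq θ
  have hr := exp_le_one_iff.2 hρ
  have hd := den_mem (p₁ := p₁) (p₂ := p₂) h (exp_pos ρ).le hr hε hεB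
  have hb := abs_phi_mul_le (p₁ := p₁) (p₂ := p₂) h (exp_pos ρ).le hr
  have hd0 : 0 < 1 + ε * phi p₁ p₂ √(1 - exp ρ * cos θ) * sin θ * cos θ := by linarith [hd.1]
  rw [Gin, abs_div, abs_of_pos hd0, div_le_iff₀ hd0, sq, ← mul_assoc, abs_mul]
  calc _ ≤ bnd p₁ p₂ * 1 := mul_le_mul hb (abs_sin_le_one θ) (abs_nonneg _) (bnd_pos _ _).le
    _ ≤ _ := by nlinarith [hd.1, bnd_pos p₁ p₂]

lemma contDiffAt_Gin {p₁ p₂ ε ρ θ : ℝ} (h : 0 < 1 - exp ρ * cos θ)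
    (hd : 1 + ε * phi p₁ p₂ √(1 - exp ρ * cos θ) * sin θ * cos θ ≠ 0) :
    ContDiffAt ℝ 3 (unc (Gin p₁ p₂)) (ε, ρ, θ) := by
  have h1 : ContDiffAt ℝ 3 (fun q : ℝ × ℝ × ℝ => √(1 - exp q.2.1 * cos q.2.2)) (ε, ρ, θ) :=
    ContDiffAt.sqrt (by fun_prop) h.ne'
  have h2 : ContDiffAt ℝ 3 (fun q : ℝ × ℝ × ℝ => phi p₁ p₂ √(1 - exp q.2.1 * cos q.2.2))
      (ε, ρ, θ) := ((contDiffAt_const.div h1 (sqrt_pos.2 h).ne').add contDiffAt_const).sub h1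
  exact ContDiffAt.div (by fun_prop) (by fun_prop) hd

/-- Periodic orbits inside the right loop are graphs over the angle. -/
lemma exists_graph_inside {ε p₁ p₂ : ℝ} {x y : ℝ → ℝ} (h : IsPeriodicOrbit ε p₁ p₂ x y)
    (hε : 0 < ε) (hεB : ε / √2 * bnd p₁ p₂ ≤ 1 / 2) (hH : ∀ t, H (x t) (y t) < 0)
    (hx : ∀ t, 0 < x t) :
    ∃ ρ, IsSol (Gin p₁ p₂) (Iio 0) (ε / √2) ρ ∧ ∀ θ, ∃ t,
      (x t, y t) = (√(1 - exp (ρ θ) * cos θ), exp (ρ θ) * sin θ / √2) := by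
  obtain ⟨T, hT, hper⟩ := h.2.2.1
  have h2 : √2 ^ 2 = 2 := sq_sqrt (by norm_num)
  have h2pos : 0 < √2 := by positivity
  set ε' := ε / √2 with hε'
  have hε'0 : 0 < ε' := by positivity
  have hεe : ε = √2 * ε' := by rw [hε']; field_simp
  set R : ℝ → ℝ := fun t => log (1 + 4 * H (x t) (y t)) / 2 with hR
  set S : ℝ → ℝ := fun t => √2 * y t * exp (-R t) with hS
  set C : ℝ → ℝ := fun t => (1 - x t ^ 2) * exp (-R t) with hC
  set f : ℝ → ℝ := fun t => p₁ + p₂ * x t - x t ^ 2 with hf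
  set ω : ℝ → ℝ := fun t => √2 * x t + ε * f t * S t * C t with hω
  have hr2 : ∀ t, 1 + 4 * H (x t) (y t) = 2 * y t ^ 2 + (1 - x t ^ 2) ^ 2 := fun t => by
    unfold H; ring
  have hr2pos : ∀ t, 0 < 1 + 4 * H (x t) (y t) := fun t => by
    refine lt_of_le_of_ne (by rw [hr2]; positivity) fun h0 => h.field_ne_zero t ?_
    rw [hr2] at h0
    have hy : y t = 0 := by nlinarith [sq_nonneg (y t), sq_nonneg (1 - x t ^ 2)]
    have hx1 : 1 - x t ^ 2 = 0 := by nlinarith [sq_nonneg (y t), sq_nonneg (1 - x t ^ 2)]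
    refine Prod.ext ?_ ?_
    · exact hy
    · simp only [field, hy, Prod.snd_zero]
      linear_combination x t * hx1
  have hexp : ∀ t, exp (R t) ^ 2 = 2 * y t ^ 2 + (1 - x t ^ 2) ^ 2 := fun t => by
    rw [← exp_nat_mul, hR]
    simp only [Nat.cast_ofNat]
    rw [mul_div_cancel₀ _ two_ne_zero, exp_log (hr2pos t), hr2]
  have hee : ∀ t, exp (R t) * exp (-R t) = 1 := fun t => by rw [← exp_add, add_neg_cancel, exp_zero]
  have hR0 : ∀ t, R t < 0 := fun t => by
    have := log_neg (hr2pos t) (by linarith [hH t])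
    simp only [hR]
    linarith
  have hSC : ∀ t, S t ^ 2 + C t ^ 2 = 1 := fun t => by
    simp only [hS, hC]
    linear_combination y t ^ 2 * exp (-R t) ^ 2 * h2 - exp (-R t) ^ 2 * hexp t +
      (exp (R t) * exp (-R t) + 1) * hee t
  have hRC : ∀ t, exp (R t) * C t = 1 - x t ^ 2 := fun t => by
    simp only [hC]; linear_combination (1 - x t ^ 2) * hee t
  have hxa : ∀ t, √(1 - exp (R t) * C t) = x t := fun t => by
    rw [hRC, sub_sub_cancel, sqrt_sq (hx t).le]
  have hden : ∀ t, 1 + ε' * phi p₁ p₂ (x t) * S t * C t ∈ Icc (1 / 2) (3 / 2) := fun t => by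
    rw [← hxa]
    exact den_mem (hSC t) (exp_pos _).le (exp_le_one_iff.2 (hR0 t).le) hε'0.le hεB
  have hφ : ∀ t, f t = x t * phi p₁ p₂ (x t) := fun t => by
    simp only [hf, phi]
    field_simp [(hx t).ne']
  have hωe : ∀ t, ω t = √2 * x t * (1 + ε' * phi p₁ p₂ (x t) * S t * C t) := fun t => by
    simp only [hω, hφ]; rw [hεe]; ring
  have hHd : ∀ t, HasDerivAt (fun t => 1 + 4 * H (x t) (y t)) (4 * (ε * f t * y t ^ 2)) t :=
    fun t => by
    have := ((((((h.2.1 t).pow 2).div_const 2).sub (((h.1 t).pow 2).div_const 2)).add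
      (((h.1 t).pow 4).div_const 4)).const_mul 4).const_add 1
    refine this.congr_deriv ?_
    simp only [hf]
    norm_num
    ring
  have hRd : ∀ t, HasDerivAt R (ε * f t * S t ^ 2) t := fun t => by
    refine (((hHd t).log (hr2pos t).ne').div_const 2).congr_deriv ?_
    rw [div_div, div_eq_iff (by linarith [hr2pos t])]
    have hr := hr2 t
    have he := hexp t
    rw [← hr] at he
    rw [← he]
    simp only [hS]
    linear_combination -2 * ε * f t * y t ^ 2 * exp (-R t) ^ 2 * exp (R t) ^ 2 * h2 -
      4 * ε * f t * y t ^ 2 * (exp (R t) * exp (-R t) + 1) * hee t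
  have hEd : ∀ t, HasDerivAt (fun t => exp (-R t)) (exp (-R t) * -(ε * f t * S t ^ 2)) t :=
    fun t => (hRd t).neg.exp
  have hSd : ∀ t, HasDerivAt S (ω t * C t) t := fun t => by
    refine (((h.2.1 t).const_mul √2).mul (hEd t)).congr_deriv ?_
    have := hSC t
    simp only [hω]
    simp only [hS, hC, hf] at this ⊢
    linear_combination -√2 * y t * exp (-R t) * ε * (p₁ + p₂ * x t - x t ^ 2) * this
  have hCd : ∀ t, HasDerivAt C (-(ω t * S t)) t := fun t => by
    refine ((((h.1 t).pow 2).const_sub 1).mul (hEd t)).congr_deriv ?_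
    simp only [hω]
    simp only [hS, hC, hf]
    norm_num
    linear_combination exp (-R t) * x t * y t * h2
  have hcont : Continuous ω := by
    have hRc : Continuous R := continuous_iff_continuousAt.2 fun t => (hRd t).continuousAt
    have := h.continuous.1
    have := h.continuous.2
    simp only [hω, hS, hC, hf]
    fun_prop
  have hωpos : ∀ t, 0 < ω t := fun t => by
    rw [hωe]
    have := (hden t).1
    have := hx t
    positivity
  obtain ⟨ρ, hρ, hρd, hρz⟩ := exists_polar_graph (z := fun t => (x t, y t)) (S := S) (C := C)
    (R := R) (ω := ω) (Ψ := fun ρ s c => (√(1 - exp ρ * c), exp ρ * s / √2))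
    (g := fun ρ s c => ε' * (phi p₁ p₂ √(1 - exp ρ * c) * s ^ 2 /
      (1 + ε' * phi p₁ p₂ √(1 - exp ρ * c) * s * c))) hT hSd hCd hSC hcont hωpos
    (fun t => (hRd t).congr_deriv (by
      have := hden t
      rw [hxa, hωe, hφ, hεe]
      have : 1 + ε' * phi p₁ p₂ (x t) * S t * C t ≠ 0 := by linarith [this.1]
      field_simp))
    (fun t => by
      simp only [hxa]
      refine Prod.ext rfl ?_
      simp only [hS]
      rw [eq_div_iff h2pos.ne']
      linear_combination -√2 * y t * hee t)
    (fun s t hst => by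
      have h1 : x s = x t := congrArg Prod.fst hst
      have h2 : y s = y t := congrArg Prod.snd hst
      have hRe : R s = R t := by simp only [hR, h1, h2]
      have hSe : S s = S t := by simp only [hS, h2, hRe]
      have hCe : C s = C t := by simp only [hC, h1, hRe]
      exact ⟨hRe, hSe, hCe, by simp only [hω, hf, h1, hSe, hCe]⟩)
    (fun t => Prod.ext (hper t).1 (hper t).2) (fun s t hst => h.eq_shift h hst)
  refine ⟨ρ, ⟨hρ, hρd, fun θ => ?_⟩, fun θ => ?_⟩
  · obtain ⟨t, -, ht⟩ := hρz θ
    rw [← ht]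
    exact hR0 t
  · obtain ⟨t, ht, -⟩ := hρz θ
    exact ⟨t, ht⟩

lemma exists_sign_of_continuous {q : ℝ → ℝ} (hq : Continuous q) (h0 : q 0 ≠ 0) :
    ∃ η > 0, ∃ σ : ℝ, ∀ t ∈ Ioo 0 η, 0 < σ * q t := by
  have h : ∀ᶠ t in 𝓝 (0:ℝ), 0 < q 0 * q t :=
    (continuous_const.mul hq).continuousAt.eventually (lt_mem_nhds (mul_self_pos.2 h0))
  obtain ⟨η, hη, hb⟩ := Metric.eventually_nhds_iff.1 h
  refine ⟨η, hη, q 0, fun t ht => hb ?_⟩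
  rw [Real.dist_eq, sub_zero, abs_of_pos ht.1]
  exact ht.2

lemma exists_sign_of_cubic (a₀ a₁ a₂ : ℝ) :
    ∃ η > 0, ∃ σ : ℝ, ∀ t ∈ Ioo 0 η, 0 < σ * (a₀ + a₁ * t + a₂ * t ^ 2 + t ^ 3) := by
  by_cases h₀ : a₀ = 0
  · by_cases h₁ : a₁ = 0
    · by_cases h₂ : a₂ = 0
      · refine ⟨1, one_pos, 1, fun t ht => ?_⟩
        rw [h₀, h₁, h₂]
        have := pow_pos ht.1 3
        linarith
      · obtain ⟨η, hη, σ, h⟩ := exists_sign_of_continuous (q := fun t => a₂ + t) (by fun_prop)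
          (by simpa using h₂)
        refine ⟨η, hη, σ, fun t ht => ?_⟩
        have := mul_pos (h t ht) (pow_pos ht.1 2)
        rw [h₀, h₁]
        linarith
    · obtain ⟨η, hη, σ, h⟩ := exists_sign_of_continuous (q := fun t => a₁ + a₂ * t + t ^ 2)
        (by fun_prop) (by simpa using h₁)
      refine ⟨η, hη, σ, fun t ht => ?_⟩
      have := mul_pos (h t ht) ht.1
      rw [h₀]
      linarith
  · exact exists_sign_of_continuous (by fun_prop) (by simpa using h₀)

lemma exists_sign_phi_add (p₁ p₂ : ℝ) : ∃ δ > 0, δ < 1 ∧ ∃ σ : ℝ, ∀ w ∈ Ioo 0 δ,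
    0 < σ * (phi p₁ p₂ √(1 + w) + phi p₁ p₂ √(1 - w)) := by
  obtain ⟨η, hη, σ, h⟩ := exists_sign_of_cubic (4 * p₁ + 4 * p₂ - 4) (10 - 8 * p₂ - 2 * p₁)
    (2 * p₂ - 6)
  refine ⟨min η (1 / 2), by positivity, (min_le_right _ _).trans_lt (by norm_num), σ,
    fun w hw => ?_⟩
  have hw1 : w < 1 / 2 := hw.2.trans_le (min_le_right _ _)
  have hwη : w < η := hw.2.trans_le (min_le_left _ _)
  set a := √(1 + w) with ha
  set b := √(1 - w) with hb
  have ha2 : a ^ 2 = 1 + w := sq_sqrt (by linarith [hw.1])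
  have hb2 : b ^ 2 = 1 - w := sq_sqrt (by linarith)
  have ha1 : 1 < a := by rw [ha]; exact lt_sqrt_of_sq_lt (by linarith [hw.1])
  have hb0 : 0 < b := sqrt_pos.2 (by linarith)
  have hbw : 1 - w ≤ b := by nlinarith [hw.1]
  have hab : a + b < 2 := by nlinarith [hw.1, sq_nonneg (a - b)]
  have key := h (2 - (a + b)) ⟨by linarith, by linarith⟩
  have hpos : 0 < 2 * (a * b) := by positivity
  have e : (phi p₁ p₂ a + phi p₁ p₂ b) * (2 * (a * b)) =
      4 * p₁ + 4 * p₂ - 4 + (10 - 8 * p₂ - 2 * p₁) * (2 - (a + b)) +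
      (2 * p₂ - 6) * (2 - (a + b)) ^ 2 + (2 - (a + b)) ^ 3 := by
    unfold phi
    field_simp
    linear_combination (a + b - 2 * p₂) * (ha2 + hb2)
  rw [← e, ← mul_assoc] at key
  exact pos_of_mul_pos_left key hpos.le

/-- Periodic solutions inside a loop cannot stay close to the centre. -/
lemma exists_log_le {p₁ p₂ δ σ : ℝ} (hδ : 0 < δ) (hδ1 : δ < 1)
    (hσ : ∀ w ∈ Ioo 0 δ, 0 < σ * (phi p₁ p₂ √(1 + w) + phi p₁ p₂ √(1 - w)))
    {ε : ℝ} (hε : 0 < ε) (hεB : ε * bnd p₁ p₂ ≤ 1 / 2) {ρ : ℝ → ℝ}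
    (hρ : IsSol (Gin p₁ p₂) (Iio 0) ε ρ) : ∃ θ, log δ ≤ ρ θ := by
  by_contra! hlt
  have hρc := hρ.continuous
  set r : ℝ → ℝ := fun θ => exp (ρ θ) with hr
  set R : ℝ → ℝ := fun θ => exp (ρ (π - θ)) with hR
  have hrpos : ∀ θ, 0 < r θ := fun θ => exp_pos _
  have hrδ : ∀ θ, r θ < δ := fun θ => (lt_log_iff_exp_lt hδ).1 (hlt θ)
  have hRpos : ∀ θ, 0 < R θ := fun θ => exp_pos _
  have hRδ : ∀ θ, R θ < δ := fun θ => (lt_log_iff_exp_lt hδ).1 (hlt _)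
  have hpos : ∀ {u : ℝ} (θ : ℝ), 0 < u → u < δ → 0 < 1 - u * cos θ ∧ 0 < 1 + u * cos θ :=
    fun {u} θ h0 h1 => by
      constructor <;> nlinarith [neg_one_le_cos θ, cos_le_one θ]
  set a : ℝ → ℝ := fun θ => √(1 - r θ * cos θ) with ha
  set A : ℝ → ℝ := fun θ => √(1 - R θ * cos θ) with hA
  set b : ℝ → ℝ := fun θ => √(1 + R θ * cos θ) with hb
  have ha0 : ∀ θ, 0 < a θ := fun θ => sqrt_pos.2 (hpos θ (hrpos θ) (hrδ θ)).1
  have hA0 : ∀ θ, 0 < A θ := fun θ => sqrt_pos.2 (hpos θ (hRpos θ) (hRδ θ)).1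
  have hb0 : ∀ θ, 0 < b θ := fun θ => sqrt_pos.2 (hpos θ (hRpos θ) (hRδ θ)).2
  have ha2 : ∀ θ, a θ ^ 2 = 1 - r θ * cos θ := fun θ => sq_sqrt (hpos θ (hrpos θ) (hrδ θ)).1.le
  have hA2 : ∀ θ, A θ ^ 2 = 1 - R θ * cos θ := fun θ => sq_sqrt (hpos θ (hRpos θ) (hRδ θ)).1.le
  set D : ℝ → ℝ := fun θ => 1 + ε * phi p₁ p₂ (a θ) * sin θ * cos θ with hD
  set E : ℝ → ℝ := fun θ => 1 + ε * phi p₁ p₂ (b θ) * sin θ * -cos θ with hE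
  have hD0 : ∀ θ, 0 < D θ := fun θ => by
    have := (den_mem (p₁ := p₁) (p₂ := p₂) (sin_sq_add_cos_sq θ) (hrpos θ).le
      ((hrδ θ).le.trans hδ1.le) hε.le hεB).1
    exact lt_of_lt_of_le (by norm_num) this
  have hE0 : ∀ θ, 0 < E θ := fun θ => by
    have := (den_mem (p₁ := p₁) (p₂ := p₂) (s := sin θ) (c := -cos θ)
      (by rw [neg_sq]; exact sin_sq_add_cos_sq θ) (hRpos θ).le
      ((hRδ θ).le.trans hδ1.le) hε.le hεB).1
    rw [show 1 - R θ * -cos θ = 1 + R θ * cos θ by ring] at this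
    exact lt_of_lt_of_le (by norm_num) this
  have hrd : ∀ θ, HasDerivAt r (r θ * (ε * (phi p₁ p₂ (a θ) * sin θ ^ 2 / D θ))) θ :=
    fun θ => (hρ.deriv θ).exp
  have hRd : ∀ θ, HasDerivAt R (R θ * -(ε * (phi p₁ p₂ (b θ) * sin θ ^ 2 / E θ))) θ := fun θ => by
    have := ((hρ.deriv (π - θ)).comp_const_sub π θ).exp
    simp only [Gin, cos_pi_sub, sin_pi_sub, mul_neg (exp _) (cos θ), sub_neg_eq_add] at this
    exact this
  set P : ℝ → ℝ := fun θ => ε * sin θ ^ 2 * (phi p₁ p₂ (a θ) / D θ + R θ * cos θ *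
    ((p₁ / (a θ * A θ) + 1) / (a θ + A θ)) / (D θ * E θ)) with hP
  set Q : ℝ → ℝ := fun θ => ε * sin θ ^ 2 * R θ * (phi p₁ p₂ (A θ) + phi p₁ p₂ (b θ)) /
    (D θ * E θ) with hQ
  have hd : ∀ θ, HasDerivAt (fun θ => r θ - R θ) (P θ * (r θ - R θ) + Q θ) θ := fun θ => by
    refine ((hrd θ).sub (hRd θ)).congr_deriv ?_
    have h1 := (ha0 θ).ne'
    have h2 := (hA0 θ).ne'
    have h4 := (hD0 θ).ne'
    have h5 := (hE0 θ).ne'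
    have h6 : a θ + A θ ≠ 0 := (add_pos (ha0 θ) (hA0 θ)).ne'
    have e1 : phi p₁ p₂ (a θ) - phi p₁ p₂ (A θ) =
        cos θ * (r θ - R θ) * ((p₁ / (a θ * A θ) + 1) / (a θ + A θ)) := by
      unfold phi
      field_simp
      linear_combination (-(p₁ + a θ * A θ)) * (ha2 θ - hA2 θ)
    have e2 : phi p₁ p₂ (a θ) / D θ + phi p₁ p₂ (b θ) / E θ =
        (phi p₁ p₂ (a θ) + phi p₁ p₂ (b θ)) / (D θ * E θ) := by
      rw [div_add_div _ _ h4 h5]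
      congr 1
      simp only [hD, hE]
      ring
    have e3 : P θ * (r θ - R θ) + Q θ = ε * sin θ ^ 2 * (phi p₁ p₂ (a θ) / D θ * (r θ - R θ) +
        R θ * ((phi p₁ p₂ (a θ) + phi p₁ p₂ (b θ)) / (D θ * E θ))) := by
      rw [show phi p₁ p₂ (a θ) + phi p₁ p₂ (b θ) = (phi p₁ p₂ (A θ) + phi p₁ p₂ (b θ)) +
        cos θ * (r θ - R θ) * ((p₁ / (a θ * A θ) + 1) / (a θ + A θ)) by rw [← e1]; ring]
      simp only [hP, hQ]
      ring
    rw [e3, ← e2]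
    ring
  have hrc : Continuous r := by fun_prop
  have hRc : Continuous R := by fun_prop
  have hac : Continuous a := by fun_prop
  have hAc : Continuous A := by fun_prop
  have hbc : Continuous b := by fun_prop
  have hφc : ∀ {g : ℝ → ℝ}, Continuous g → (∀ θ, 0 < g θ) →
      Continuous fun θ => phi p₁ p₂ (g θ) := fun hg h0 =>
    ((continuous_const.div hg fun θ => (h0 θ).ne').add continuous_const).sub hg
  have hφa := hφc hac ha0
  have hφA := hφc hAc hA0
  have hφb := hφc hbc hb0
  have hDc : Continuous D := by fun_prop
  have hEc : Continuous E := by fun_prop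
  have hDE : ∀ θ, D θ * E θ ≠ 0 := fun θ => (mul_pos (hD0 θ) (hE0 θ)).ne'
  have hQc : Continuous Q := Continuous.div (by fun_prop) (by fun_prop) hDE
  have hPc : Continuous P := by
    refine Continuous.mul (by fun_prop) (Continuous.add (hφa.div hDc fun θ => (hD0 θ).ne')
      (Continuous.div (Continuous.mul (by fun_prop) (Continuous.div (Continuous.add
        (Continuous.div (by fun_prop) (by fun_prop) fun θ => (mul_pos (ha0 θ) (hA0 θ)).ne')
        continuous_const) (by fun_prop) fun θ => (add_pos (ha0 θ) (hA0 θ)).ne')) (by fun_prop)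
        hDE))
  set I : ℝ → ℝ := fun θ => exp (-∫ u in (0:ℝ)..θ, P u) with hI
  have hId : ∀ θ, HasDerivAt I (I θ * -P θ) θ := fun θ =>
    (hPc.integral_hasStrictDerivAt 0 θ).hasDerivAt.neg.exp
  have hIc : Continuous I := continuous_iff_continuousAt.2 fun θ => (hId θ).continuousAt
  have hu : ∀ θ, HasDerivAt (fun θ => (r θ - R θ) * I θ) (Q θ * I θ) θ := fun θ =>
    ((hd θ).mul (hId θ)).congr_deriv (by ring)
  have hint : ∫ θ in (π / 2)..(3 * π / 2), Q θ * I θ = 0 := by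
    rw [intervalIntegral.integral_eq_sub_of_hasDerivAt (fun θ _ => hu θ)
      ((hQc.mul hIc).intervalIntegrable _ _)]
    have h1 : r (π / 2) = R (π / 2) := by
      simp only [hr, hR]
      congr 2
      ring
    have h2 : r (3 * π / 2) = R (3 * π / 2) := by
      simp only [hr, hR]
      rw [← hρ.per (π - 3 * π / 2)]
      congr 2
      ring
    rw [h1, h2]
    ring
  have hpi := pi_pos
  have hsign : ∀ θ ∈ Ioo (π / 2) (3 * π / 2), sin θ ≠ 0 → 0 < σ * (Q θ * I θ) := fun θ hθ hs => by
    have hc : cos θ < 0 := cos_neg_of_pi_div_two_lt_of_lt hθ.1 (by linarith [hθ.2])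
    have hw := hσ (-(R θ * cos θ)) ⟨by nlinarith [hRpos θ], by
      nlinarith [hRδ θ, hRpos θ, neg_one_le_cos θ]⟩
    rw [← sub_eq_add_neg, sub_neg_eq_add] at hw
    have hs2 : 0 < sin θ ^ 2 := by positivity
    have e : σ * (Q θ * I θ) = ε * sin θ ^ 2 * R θ * (σ * (phi p₁ p₂ (A θ) + phi p₁ p₂ (b θ))) /
        (D θ * E θ) * I θ := by
      simp only [hQ]; ring
    rw [e]
    have := hRpos θ
    have := hD0 θ
    have := hE0 θ
    have : 0 < I θ := exp_pos _
    have hw' : 0 < σ * (phi p₁ p₂ (A θ) + phi p₁ p₂ (b θ)) := hw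
    positivity
  have hnonneg : ∀ θ ∈ Ioc (π / 2) (3 * π / 2), 0 ≤ σ * (Q θ * I θ) := fun θ hθ => by
    rcases hθ.2.eq_or_lt with rfl | hlt
    · refine ge_of_tendsto (x := 𝓝[<] (3 * π / 2)) (f := fun θ => σ * (Q θ * I θ))
        ((continuous_const.mul (hQc.mul hIc)).continuousAt.continuousWithinAt) ?_
      filter_upwards [Ioo_mem_nhdsLT (show π < 3 * π / 2 by linarith)] with θ hθ
      refine (hsign θ ⟨by linarith [hθ.1], hθ.2⟩ ?_).le
      have : sin (θ - π) ≠ 0 := (sin_pos_of_pos_of_lt_pi (by linarith [hθ.1])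
        (by linarith [hθ.2])).ne'
      rwa [sin_sub_pi, neg_ne_zero] at this
    · by_cases hs : sin θ = 0
      · simp only [hQ, hs]
        simp
      · exact (hsign θ ⟨hθ.1, hlt⟩ hs).le
  have hipos := intervalIntegral.integral_pos (f := fun θ => σ * (Q θ * I θ))
    (show π / 2 < 3 * π / 2 by linarith) (by fun_prop) hnonneg
    ⟨3 * π / 4, ⟨by linarith, by linarith⟩, hsign _ ⟨by linarith, by linarith⟩
      (sin_pos_of_pos_of_lt_pi (by linarith) (by linarith)).ne'⟩
  rw [intervalIntegral.integral_const_mul, hint, mul_zero] at hipos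
  exact hipos.false

lemma exists_lower_bound (p₁ p₂ : ℝ) : ∃ k < 0, ∀ ε, 0 < ε → ε * bnd p₁ p₂ ≤ 1 / 2 →
    ∀ ρ, IsSol (Gin p₁ p₂) (Iio 0) ε ρ → ∀ θ, k ≤ ρ θ := by
  obtain ⟨δ, hδ, hδ1, σ, hσ⟩ := exists_sign_phi_add p₁ p₂
  refine ⟨log δ - 2 * π, by linarith [log_neg hδ hδ1, pi_pos], fun ε hε hεB ρ hρ θ => ?_⟩
  obtain ⟨θ₀, hθ₀⟩ := exists_log_le hδ hδ1 hσ hε hεB hρ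
  obtain ⟨θ', hθ', he⟩ := Periodic.exists_mem_Ico (f := ρ) hρ.per two_pi_pos θ θ₀
  rw [he]
  have h2 := Convex.norm_image_sub_le_of_norm_hasDerivWithin_le (f := ρ) (C := 1)
    (s := univ) (x := θ₀) (y := θ') (fun t _ => (hρ.deriv t).hasDerivWithinAt)
    (fun t _ => by
      rw [norm_mul, Real.norm_eq_abs, Real.norm_eq_abs, abs_of_pos hε]
      have := mul_le_mul_of_nonneg_left (abs_Gin_le (p₁ := p₁) (p₂ := p₂) (θ := t)
        (le_of_lt (hρ.mem t)) hε.le hεB) hε.le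
      linarith) convex_univ (mem_univ _) (mem_univ _)
  rw [Real.norm_eq_abs, Real.norm_eq_abs, one_mul, abs_of_nonneg (sub_nonneg.2 hθ'.1)] at h2
  linarith [(abs_le.1 h2).1, hθ'.2]

lemma integral_pos_of_add_shift {F : ℝ → ℝ} (hF : Continuous F) (hper : ∀ θ, F (θ + 2 * π) = F θ)
    (h0 : ∀ θ, 0 ≤ F θ + F (θ + π)) {c : ℝ} (hc : c ∈ Icc 0 (2 * π)) (h1 : 0 < F c + F (c + π)) :
    0 < ∫ θ in (0:ℝ)..2 * π, F θ := by
  have hF' : Continuous fun θ => F (θ + π) := by fun_prop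
  have h2 := intervalIntegral.integral_pos (f := fun θ => F θ + F (θ + π)) two_pi_pos
    (hF.add hF').continuousOn (fun θ _ => h0 θ) ⟨c, hc, h1⟩
  rw [intervalIntegral.integral_add (hF.intervalIntegrable _ _) (hF'.intervalIntegrable _ _),
    intervalIntegral.integral_comp_add_right] at h2
  have h3 := Function.Periodic.intervalIntegral_add_eq (f := F) hper (0 + π) 0
  rw [zero_add (2 * π), show 0 + π + 2 * π = 2 * π + π by ring] at h3
  rw [h3] at h2
  linarith

lemma one_sub_exp_mul_cos_pos {ρ θ : ℝ} (hρ : ρ < 0) : 0 < 1 - exp ρ * cos θ := by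
  have := exp_lt_one_iff.2 hρ
  nlinarith [exp_pos ρ, cos_le_one θ, neg_one_le_cos θ]

lemma one_sub_cos_pos {θ : ℝ} (h : cos θ ≠ 1) : 0 < 1 - exp 0 * cos θ := by
  rw [exp_zero, one_mul]
  exact sub_pos.2 (lt_of_le_of_ne (cos_le_one θ) h)

section

variable {p₁ p₂ ρ θ : ℝ}

lemma contDiffAt_Gin_zero (h : 0 < 1 - exp ρ * cos θ) :
    ContDiffAt ℝ 3 (unc (Gin p₁ p₂)) (0, ρ, θ) :=
  contDiffAt_Gin h (by simp)

lemma hasDerivAt_sqrt_one_sub (h : 0 < 1 - exp ρ * cos θ) :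
    HasDerivAt (fun r => √(1 - exp r * cos θ))
      (-(exp ρ * cos θ) / (2 * √(1 - exp ρ * cos θ))) ρ :=
  (((Real.hasDerivAt_exp ρ).mul_const _).const_sub 1).sqrt h.ne'

lemma pd_Gin (h : 0 < 1 - exp ρ * cos θ) : pd (Gin p₁ p₂) 0 ρ θ =
    sin θ ^ 2 * (exp ρ * cos θ / 2 *
      (p₁ / √(1 - exp ρ * cos θ) ^ 3 + 1 / √(1 - exp ρ * cos θ))) := by
  have ha := sqrt_pos.2 h
  have h1 := hasDerivAt_pd (by norm_num) (contDiffAt_Gin_zero (p₁ := p₁) (p₂ := p₂) h)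
  have h2 := ((((hasDerivAt_const ρ p₁).div (hasDerivAt_sqrt_one_sub h) ha.ne').add_const
    p₂).sub (hasDerivAt_sqrt_one_sub h)).mul_const (sin θ ^ 2)
  have h3 : (fun r => Gin p₁ p₂ 0 r θ) = fun r => (p₁ / √(1 - exp r * cos θ) + p₂ -
      √(1 - exp r * cos θ)) * sin θ ^ 2 := by
    funext r; simp [Gin, phi]
  rw [h3] at h1
  refine (h1.unique h2).trans ?_
  field_simp
  ring

lemma pd_pd_Gin (h : 0 < 1 - exp ρ * cos θ) : pd (pd (Gin p₁ p₂)) 0 ρ θ =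
    sin θ ^ 2 * (exp ρ * cos θ / 2 *
      (p₁ / √(1 - exp ρ * cos θ) ^ 3 + 1 / √(1 - exp ρ * cos θ)) + (exp ρ * cos θ) ^ 2 / 4 *
      (3 * p₁ / √(1 - exp ρ * cos θ) ^ 5 + 1 / √(1 - exp ρ * cos θ) ^ 3)) := by
  have ha := sqrt_pos.2 h
  have h1 := hasDerivAt_pd (n := 2) (by norm_num) (contDiffAt_pd (by norm_num)
    (contDiffAt_Gin_zero (p₁ := p₁) (p₂ := p₂) h))
  have hs := hasDerivAt_sqrt_one_sub h
  have h2 := ((((Real.hasDerivAt_exp ρ).mul_const (cos θ)).div_const 2).mul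
    (((hasDerivAt_const ρ p₁).div (hs.pow 3) (pow_ne_zero 3 ha.ne')).add
      ((hasDerivAt_const ρ (1:ℝ)).div hs ha.ne'))).const_mul (sin θ ^ 2)
  have h3 : (fun r => pd (Gin p₁ p₂) 0 r θ) =ᶠ[𝓝 ρ] fun r => sin θ ^ 2 * (exp r * cos θ / 2 *
      (p₁ / √(1 - exp r * cos θ) ^ 3 + 1 / √(1 - exp r * cos θ))) := by
    have hc : Continuous fun r => 1 - exp r * cos θ := by fun_prop
    filter_upwards [hc.continuousAt.eventually (lt_mem_nhds h)] with r hr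
    exact pd_Gin hr
  refine ((h1.congr_of_eventuallyEq h3.symm).unique h2).trans ?_
  norm_num
  field_simp
  left
  ring

lemma continuous_pd_Gin (hρ : ρ < 0) : Continuous fun θ => pd (Gin p₁ p₂) 0 ρ θ :=
  continuous_iff_continuousAt.2 fun θ =>
    ContinuousAt.comp (g := unc (pd (Gin p₁ p₂))) (f := fun θ => ((0:ℝ), ρ, θ))
      (contDiffAt_pd (n := 2) (by norm_num)
        (contDiffAt_Gin_zero (one_sub_exp_mul_cos_pos hρ))).continuousAt (by fun_prop)

lemma continuous_pd_pd_Gin (hρ : ρ < 0) : Continuous fun θ => pd (pd (Gin p₁ p₂)) 0 ρ θ :=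
  continuous_iff_continuousAt.2 fun θ =>
    ContinuousAt.comp (g := unc (pd (pd (Gin p₁ p₂)))) (f := fun θ => ((0:ℝ), ρ, θ))
      (contDiffAt_pd (n := 1) (by norm_num) (contDiffAt_pd (n := 2) (by norm_num)
        (contDiffAt_Gin_zero (one_sub_exp_mul_cos_pos hρ)))).continuousAt (by fun_prop)

end

section

variable {a b u p : ℝ}

lemma mul_inv_sub_inv (ha : 0 < a) (hb : 0 < b) (h1 : a ^ 2 = 1 - u) (h2 : b ^ 2 = 1 + u) :
    u * (1 / a - 1 / b) = (1 - a * b) * (a + b) / (a * b) := by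
  rw [eq_div_iff (by positivity)]
  field_simp
  linear_combination b * h1 + a * h2

lemma mul_inv_cube_sub (ha : 0 < a) (hb : 0 < b) (h1 : a ^ 2 = 1 - u) (h2 : b ^ 2 = 1 + u) :
    u * (1 / a ^ 3 - 1 / b ^ 3) = (1 - a * b) * (a + b) * (2 + a * b) / (a * b) ^ 3 := by
  have e1 : u * (b - a) = (1 - a * b) * (a + b) := by linear_combination b * h1 + a * h2
  have e2 : b ^ 2 + a * b + a ^ 2 = 2 + a * b := by linear_combination h1 + h2
  rw [← e1, ← e2]
  field_simp
  ring

lemma inv_cube_add (ha : 0 < a) (hb : 0 < b) (h1 : a ^ 2 = 1 - u) (h2 : b ^ 2 = 1 + u) :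
    1 / a ^ 3 + 1 / b ^ 3 = (a + b) * (2 - a * b) / (a * b) ^ 3 := by
  have e2 : b ^ 2 - a * b + a ^ 2 = 2 - a * b := by linear_combination h1 + h2
  rw [← e2]
  field_simp
  ring

lemma inv_fifth_add (ha : 0 < a) (hb : 0 < b) (h1 : a ^ 2 = 1 - u) (h2 : b ^ 2 = 1 + u) :
    1 / a ^ 5 + 1 / b ^ 5 = (a + b) * (4 - 2 * (a * b) - (a * b) ^ 2) / (a * b) ^ 5 := by
  have e2 : (2:ℝ) = a ^ 2 + b ^ 2 := by linear_combination -h1 - h2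
  rw [show (4:ℝ) = 2 * 2 by norm_num, e2]
  field_simp
  ring

lemma mul_lt_one_of_sq_eq (h1 : a ^ 2 = 1 - u) (h2 : b ^ 2 = 1 + u)
    (hu : u ≠ 0) : a * b < 1 := by
  have h3 : (a * b) ^ 2 = 1 - u ^ 2 := by rw [mul_pow, h1, h2]; ring
  have := pow_pos (abs_pos.2 hu) 2
  rw [sq_abs] at this
  nlinarith

lemma pair_pos (ha : 0 < a) (hb : 0 < b) (h1 : a ^ 2 = 1 - u) (h2 : b ^ 2 = 1 + u) (hu : u ≠ 0)
    (hp : 0 ≤ p) : 0 < u / 2 * (p / a ^ 3 + 1 / a) + -u / 2 * (p / b ^ 3 + 1 / b) := by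
  have e : u / 2 * (p / a ^ 3 + 1 / a) + -u / 2 * (p / b ^ 3 + 1 / b) =
    (p * (u * (1 / a ^ 3 - 1 / b ^ 3)) + u * (1 / a - 1 / b)) / 2 := by ring
  rw [e, mul_inv_sub_inv ha hb h1 h2, mul_inv_cube_sub ha hb h1 h2]
  have := sub_pos.2 (mul_lt_one_of_sq_eq h1 h2 hu)
  positivity

lemma pair_neg (ha : 0 < a) (hb : 0 < b) (h1 : a ^ 2 = 1 - u) (h2 : b ^ 2 = 1 + u) (hu : u ≠ 0)
    (hp : p < 0) :
    0 < ((p - 1) / (2 * p) * (u / 2 * (p / a ^ 3 + 1 / a)) -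
        (u / 2 * (p / a ^ 3 + 1 / a) + u ^ 2 / 4 * (3 * p / a ^ 5 + 1 / a ^ 3))) +
      ((p - 1) / (2 * p) * (-u / 2 * (p / b ^ 3 + 1 / b)) -
        (-u / 2 * (p / b ^ 3 + 1 / b) + u ^ 2 / 4 * (3 * p / b ^ 5 + 1 / b ^ 3))) := by
  set P := a * b with hP
  have hP0 : 0 < P := mul_pos ha hb
  have hP1 := sub_pos.2 (mul_lt_one_of_sq_eq h1 h2 hu)
  rw [← hP] at hP1
  have hp0 := hp.ne
  have hu2 : u ^ 2 = 1 - P ^ 2 := by rw [hP, mul_pow, h1, h2]; ring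
  have e1 := mul_inv_sub_inv ha hb h1 h2
  have e2 := mul_inv_cube_sub ha hb h1 h2
  have e3 := inv_cube_add ha hb h1 h2
  have e4 := inv_fifth_add ha hb h1 h2
  rw [← hP] at e1 e2 e3 e4
  have e : ((p - 1) / (2 * p) * (u / 2 * (p / a ^ 3 + 1 / a)) -
        (u / 2 * (p / a ^ 3 + 1 / a) + u ^ 2 / 4 * (3 * p / a ^ 5 + 1 / a ^ 3))) +
      ((p - 1) / (2 * p) * (-u / 2 * (p / b ^ 3 + 1 / b)) -
        (-u / 2 * (p / b ^ 3 + 1 / b) + u ^ 2 / 4 * (3 * p / b ^ 5 + 1 / b ^ 3))) =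
      -(((p + 1) / 2 * (p * (u * (1 / a ^ 3 - 1 / b ^ 3)) + u * (1 / a - 1 / b)) +
        u ^ 2 / 4 * (6 * p ^ 2 * (1 / a ^ 5 + 1 / b ^ 5) + 2 * p * (1 / a ^ 3 + 1 / b ^ 3))) /
        (2 * p)) := by
    field_simp
    ring
  rw [e, e1, e2, e3, e4, hu2, ← div_neg]
  refine div_pos ?_ (by linarith)
  have e5 : (p + 1) / 2 * (p * ((1 - P) * (a + b) * (2 + P) / P ^ 3) +
      (1 - P) * (a + b) / P) + (1 - P ^ 2) / 4 * (6 * p ^ 2 *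
      ((a + b) * (4 - 2 * P - P ^ 2) / P ^ 5) + 2 * p * ((a + b) * (2 - P) / P ^ 3)) =
      (1 - P) * (a + b) / (2 * P ^ 5) *
      ((P ^ 2 + (2 + P) * p) ^ 2 + 2 * p ^ 2 * (4 + P) * ((1 - P) * (1 + P))) := by
    field_simp
    ring
  rw [e5]
  have := pow_pos (neg_pos.2 hp) 2
  rw [neg_sq] at this
  positivity

end

section

variable {p₁ p₂ ρ : ℝ}

lemma sqrt_one_add_facts (hρ : ρ < 0) (θ : ℝ) :
    0 < √(1 - exp ρ * cos θ) ∧ 0 < √(1 + exp ρ * cos θ) ∧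
    √(1 - exp ρ * cos θ) ^ 2 = 1 - exp ρ * cos θ ∧
    √(1 + exp ρ * cos θ) ^ 2 = 1 + exp ρ * cos θ := by
  have h1 := one_sub_exp_mul_cos_pos (θ := θ) hρ
  have h2 := one_sub_exp_mul_cos_pos (θ := θ + π) hρ
  rw [cos_add_pi, mul_neg, sub_neg_eq_add] at h2
  exact ⟨sqrt_pos.2 h1, sqrt_pos.2 h2, sq_sqrt h1.le, sq_sqrt h2.le⟩

lemma pi_div_four_mem : π / 4 ∈ Icc 0 (2 * π) := ⟨by positivity, by linarith [pi_pos]⟩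

lemma sin_sq_pi_div_four_pos : 0 < sin (π / 4) ^ 2 := by
  rw [sin_pi_div_four]; positivity

lemma exp_mul_cos_pi_div_four_ne : exp ρ * cos (π / 4) ≠ 0 := by
  rw [cos_pi_div_four]; positivity

lemma integral_pd_Gin_pos (hp : 0 ≤ p₁) (hρ : ρ < 0) :
    0 < ∫ θ in (0:ℝ)..2 * π, pd (Gin p₁ p₂) 0 ρ θ := by
  have hf : ∀ θ, pd (Gin p₁ p₂) 0 ρ θ = _ := fun θ => pd_Gin (one_sub_exp_mul_cos_pos hρ)
  have hsum : ∀ θ, pd (Gin p₁ p₂) 0 ρ θ + pd (Gin p₁ p₂) 0 ρ (θ + π) =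
      sin θ ^ 2 * (exp ρ * cos θ / 2 *
      (p₁ / √(1 - exp ρ * cos θ) ^ 3 + 1 / √(1 - exp ρ * cos θ)) + -(exp ρ * cos θ) / 2 *
      (p₁ / √(1 + exp ρ * cos θ) ^ 3 + 1 / √(1 + exp ρ * cos θ))) := fun θ => by
    rw [hf θ, hf (θ + π), cos_add_pi, sin_add_pi, mul_neg, sub_neg_eq_add]
    ring
  have hpair : ∀ θ, exp ρ * cos θ ≠ 0 → _ := fun θ h =>
    pair_pos (sqrt_one_add_facts hρ θ).1 (sqrt_one_add_facts hρ θ).2.1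
      (sqrt_one_add_facts hρ θ).2.2.1 (sqrt_one_add_facts hρ θ).2.2.2 h hp
  refine integral_pos_of_add_shift (continuous_pd_Gin hρ)
    (fun θ => by rw [hf, hf θ, cos_add_two_pi, sin_add_two_pi]) (fun θ => ?_) pi_div_four_mem ?_
  · rw [hsum]
    by_cases h : exp ρ * cos θ = 0
    · rw [h]; simp
    · exact mul_nonneg (sq_nonneg _) (hpair θ h).le
  · rw [hsum]
    exact mul_pos sin_sq_pi_div_four_pos (hpair _ exp_mul_cos_pi_div_four_ne)

lemma integral_pd_pd_Gin_lt (hp : p₁ < 0) (hρ : ρ < 0) :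
    ∫ θ in (0:ℝ)..2 * π, pd (pd (Gin p₁ p₂)) 0 ρ θ <
      (p₁ - 1) / (2 * p₁) * ∫ θ in (0:ℝ)..2 * π, pd (Gin p₁ p₂) 0 ρ θ := by
  have hf : ∀ θ, pd (Gin p₁ p₂) 0 ρ θ = _ := fun θ => pd_Gin (one_sub_exp_mul_cos_pos hρ)
  have hf2 : ∀ θ, pd (pd (Gin p₁ p₂)) 0 ρ θ = _ := fun θ => pd_pd_Gin (one_sub_exp_mul_cos_pos hρ)
  have hc1 : Continuous fun θ => (p₁ - 1) / (2 * p₁) * pd (Gin p₁ p₂) 0 ρ θ :=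
    continuous_const.mul (continuous_pd_Gin hρ)
  have hc2 := continuous_pd_pd_Gin (p₁ := p₁) (p₂ := p₂) hρ
  rw [← sub_pos, ← intervalIntegral.integral_const_mul, ← intervalIntegral.integral_sub
    (hc1.intervalIntegrable _ _) (hc2.intervalIntegrable _ _)]
  set F : ℝ → ℝ := fun θ => (p₁ - 1) / (2 * p₁) * pd (Gin p₁ p₂) 0 ρ θ -
    pd (pd (Gin p₁ p₂)) 0 ρ θ with hF
  have hsum : ∀ θ, F θ + F (θ + π) = sin θ ^ 2 * (((p₁ - 1) / (2 * p₁) * (exp ρ * cos θ / 2 *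
      (p₁ / √(1 - exp ρ * cos θ) ^ 3 + 1 / √(1 - exp ρ * cos θ))) - (exp ρ * cos θ / 2 *
      (p₁ / √(1 - exp ρ * cos θ) ^ 3 + 1 / √(1 - exp ρ * cos θ)) + (exp ρ * cos θ) ^ 2 / 4 *
      (3 * p₁ / √(1 - exp ρ * cos θ) ^ 5 + 1 / √(1 - exp ρ * cos θ) ^ 3))) +
      ((p₁ - 1) / (2 * p₁) * (-(exp ρ * cos θ) / 2 *
      (p₁ / √(1 + exp ρ * cos θ) ^ 3 + 1 / √(1 + exp ρ * cos θ))) - (-(exp ρ * cos θ) / 2 *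
      (p₁ / √(1 + exp ρ * cos θ) ^ 3 + 1 / √(1 + exp ρ * cos θ)) + (exp ρ * cos θ) ^ 2 / 4 *
      (3 * p₁ / √(1 + exp ρ * cos θ) ^ 5 + 1 / √(1 + exp ρ * cos θ) ^ 3)))) := fun θ => by
    simp only [hF]
    rw [hf θ, hf2 θ, hf (θ + π), hf2 (θ + π), cos_add_pi, sin_add_pi, mul_neg, sub_neg_eq_add]
    ring
  have hpair : ∀ θ, exp ρ * cos θ ≠ 0 → _ := fun θ h =>
    pair_neg (sqrt_one_add_facts hρ θ).1 (sqrt_one_add_facts hρ θ).2.1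
      (sqrt_one_add_facts hρ θ).2.2.1 (sqrt_one_add_facts hρ θ).2.2.2 h hp
  refine integral_pos_of_add_shift (hc1.sub hc2)
    (fun θ => by
      rw [hf, hf θ, hf2, hf2 θ, cos_add_two_pi, sin_add_two_pi]) (fun θ => ?_) pi_div_four_mem ?_
  · rw [hsum]
    by_cases h : exp ρ * cos θ = 0
    · rw [h]; simp
    · exact mul_nonneg (sq_nonneg _) (hpair θ h).le
  · rw [hsum]
    exact mul_pos sin_sq_pi_div_four_pos (hpair _ exp_mul_cos_pi_div_four_ne)

end

lemma ae_cos_ne_one : ∀ᵐ θ : ℝ, cos θ ≠ 1 := by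
  have : (range fun n : ℤ => (n : ℝ) * (2 * π)).Countable := countable_range _
  filter_upwards [this.ae_notMem volume] with θ hθ h
  obtain ⟨n, hn⟩ := (cos_eq_one_iff θ).1 h
  exact hθ ⟨n, hn⟩

lemma averaging_Gin (p₁ p₂ k : ℝ) :
    Averaging (Gin p₁ p₂) (1 / (2 * bnd p₁ p₂)) 0 (Iio 0) (Icc k 0) where
  pos := by have := bnd_pos p₁ p₂; positivity
  isOpen := isOpen_Iio
  ordConnected := ordConnected_Iio
  isCompact := isCompact_Icc
  ordConnected' := ordConnected_Icc
  subset := fun ρ hρ => by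
    rcases hρ.2.eq_or_lt with h | h
    · exact Or.inl h
    · exact Or.inr h
  Ioo_subset := fun u _ v hv ρ hρ => hρ.2.trans_le hv.2
  smooth := fun ε hε ρ hρ θ => contDiffAt_Gin (one_sub_exp_mul_cos_pos hρ) (by
    have := (den_mem (p₁ := p₁) (p₂ := p₂) (sin_sq_add_cos_sq θ) (exp_pos ρ).le
      (exp_le_one_iff.2 (le_of_lt hρ)) hε.1 (by
        have := mul_le_mul_of_nonneg_right hε.2 (bnd_pos p₁ p₂).le
        refine this.trans (le_of_eq ?_)
        field_simp [(bnd_pos p₁ p₂).ne'])).1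
    exact (lt_of_lt_of_le (by norm_num) this).ne')
  smooth_end := by
    filter_upwards [ae_cos_ne_one] with θ hθ
    exact contDiffAt_Gin_zero (one_sub_cos_pos hθ)
  bounded := ⟨2 * bnd p₁ p₂, fun ε hε ρ hρ θ => abs_Gin_le hρ.2 hε.1 (by
    have := mul_le_mul_of_nonneg_right hε.2 (bnd_pos p₁ p₂).le
    refine this.trans (le_of_eq ?_)
    field_simp [(bnd_pos p₁ p₂).ne'])⟩

lemma exp_slope_mem {u v : ℝ} (hv : v < 0) (huv : u < v) :
    (exp v - exp u) / (v - u) ∈ Icc 0 1 := by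
  have h := sub_pos.2 huv
  refine ⟨div_nonneg (sub_nonneg.2 (exp_le_exp.2 huv.le)) h.le, (div_le_one h).2 ?_⟩
  have h1 := add_one_le_exp (u - v)
  have h2 : exp u = exp v * exp (u - v) := by rw [← exp_add]; ring_nf
  have h3 := exp_lt_one_iff.2 hv
  nlinarith [exp_pos v]

/-- The difference quotient of `phi p₁ p₂ a * sin θ ^ 2` with respect to `a ^ 2`, up to sign. -/
noncomputable def slopeIn (p₁ a b θ : ℝ) : ℝ :=
  cos θ * sin θ ^ 2 * ((p₁ / (a * b) + 1) / (a + b))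

lemma dq_Gin_eq {p₁ p₂ ε u v θ : ℝ} (hu : u < 0) (hv : v < 0) (huv : u < v) (hε : 0 ≤ ε)
    (hεB : ε * bnd p₁ p₂ ≤ 1 / 2) : ∃ J ∈ Icc (0:ℝ) 4, dq (Gin p₁ p₂) ε u v θ =
      J * slopeIn p₁ √(1 - exp u * cos θ) √(1 - exp v * cos θ) θ := by
  have hu1 := one_sub_exp_mul_cos_pos (θ := θ) hu
  have hv1 := one_sub_exp_mul_cos_pos (θ := θ) hv
  have hDu := (den_mem (p₁ := p₁) (p₂ := p₂) (sin_sq_add_cos_sq θ) (exp_pos u).le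
    (exp_le_one_iff.2 hu.le) hε hεB).1
  have hDv := (den_mem (p₁ := p₁) (p₂ := p₂) (sin_sq_add_cos_sq θ) (exp_pos v).le
    (exp_le_one_iff.2 hv.le) hε hεB).1
  have ha := sqrt_pos.2 hu1
  have hb := sqrt_pos.2 hv1
  have ha2 := sq_sqrt hu1.le
  have hb2 := sq_sqrt hv1.le
  unfold dq Gin slopeIn
  set a := √(1 - exp u * cos θ)
  set b := √(1 - exp v * cos θ)
  set A := 1 + ε * phi p₁ p₂ a * sin θ * cos θ with hA
  set B := 1 + ε * phi p₁ p₂ b * sin θ * cos θ with hB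
  have hA0 : 0 < A := by linarith
  have hB0 : 0 < B := by linarith
  have hJ := exp_slope_mem hv huv
  refine ⟨(exp v - exp u) / (v - u) / (A * B), ⟨?_, ?_⟩, ?_⟩
  · exact div_nonneg hJ.1 (by positivity)
  · rw [div_le_iff₀ (by positivity)]
    nlinarith [hJ.2]
  · have e1 : phi p₁ p₂ b * sin θ ^ 2 / B - phi p₁ p₂ a * sin θ ^ 2 / A =
        sin θ ^ 2 * (phi p₁ p₂ b - phi p₁ p₂ a) / (A * B) := by
      rw [div_sub_div _ _ hB0.ne' hA0.ne', mul_comm B A]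
      congr 1
      simp only [hA, hB]
      ring
    have e2 : phi p₁ p₂ b - phi p₁ p₂ a =
        cos θ * (exp v - exp u) * ((p₁ / (a * b) + 1) / (a + b)) := by
      unfold phi
      field_simp
      linear_combination (p₁ + a * b) * (ha2 - hb2)
    rw [e1, e2]
    ring

section

variable {p₁ a b θ : ℝ}

lemma neg_le_slopeIn {σ : ℝ} (hσ : σ * p₁ = |p₁|) (hσ1 : |σ| ≤ 1) (ha : 0 < a) (hb : 0 < b)
    (hsa : |sin θ| ≤ 2 * a) (hsb : |sin θ| ≤ 2 * b) (hc : cos θ ≤ 0 → 1 ≤ a ∧ 1 ≤ b) :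
    -(2 + |p₁|) ≤ σ * slopeIn p₁ a b θ := by
  have hs0 := abs_nonneg (sin θ)
  have hs1 := abs_sin_le_one θ
  have hs2 : sin θ ^ 2 ≤ 1 := sin_sq_le_one θ
  have hσ' := abs_le.1 hσ1
  have e : σ * slopeIn p₁ a b θ = cos θ * (sin θ ^ 2 * (|p₁| / (a * b) + σ) / (a + b)) := by
    rw [← hσ, slopeIn]; ring
  rw [e]
  rcases le_or_gt (cos θ) 0 with h | h
  · obtain ⟨ha1, hb1⟩ := hc h
    have h1 : sin θ ^ 2 * (|p₁| / (a * b) + σ) / (a + b) ≤ 2 + |p₁| := by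
      have h2 : |p₁| / (a * b) ≤ |p₁| := div_le_self (abs_nonneg _) (by nlinarith)
      have h3 : sin θ ^ 2 * (|p₁| / (a * b) + σ) ≤ 2 + |p₁| := by
        rcases le_total 0 (|p₁| / (a * b) + σ) with h4 | h4
        · nlinarith [sq_nonneg (sin θ)]
        · nlinarith [sq_nonneg (sin θ), abs_nonneg p₁]
      rw [div_le_iff₀ (by positivity)]
      nlinarith [abs_nonneg p₁]
    rcases le_total 0 (sin θ ^ 2 * (|p₁| / (a * b) + σ) / (a + b)) with h4 | h4
    · nlinarith [neg_one_le_cos θ]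
    · nlinarith [abs_nonneg p₁]
  · have h1 : -1 ≤ sin θ ^ 2 * (|p₁| / (a * b) + σ) / (a + b) := by
      rw [le_div_iff₀ (by positivity)]
      have h2 : 0 ≤ |p₁| / (a * b) := by positivity
      have h3 : sin θ ^ 2 ≤ a + b := by
        rw [← sq_abs]; nlinarith
      nlinarith [sq_nonneg (sin θ)]
    nlinarith [cos_le_one θ, abs_nonneg p₁]

lemma abs_slopeIn_le {m : ℝ} (hm : 0 < m) (ha : m ≤ a) (hb : m ≤ b) :
    |slopeIn p₁ a b θ| ≤ (|p₁| / (m * m) + 1) / (m + m) := by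
  have ha0 := hm.trans_le ha
  have hb0 := hm.trans_le hb
  rw [slopeIn, abs_mul, abs_mul, abs_div, abs_of_pos (add_pos ha0 hb0), abs_of_nonneg
    (sq_nonneg (sin θ))]
  have h1 : |p₁ / (a * b) + 1| ≤ |p₁| / (m * m) + 1 := by
    refine (abs_add_le _ _).trans ?_
    rw [abs_div, abs_one, abs_of_pos (mul_pos ha0 hb0)]
    gcongr
  have h2 : |cos θ| * sin θ ^ 2 ≤ 1 :=
    mul_le_one₀ (abs_cos_le_one θ) (sq_nonneg _) (sin_sq_le_one θ)
  have h3 : |p₁ / (a * b) + 1| / (a + b) ≤ (|p₁| / (m * m) + 1) / (m + m) := by gcongr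
  calc _ ≤ 1 * ((|p₁| / (m * m) + 1) / (m + m)) :=
        mul_le_mul h2 h3 (by positivity) zero_le_one
    _ = _ := one_mul _

lemma abs_slopeIn_zero_le (ha : 0 < a) (hb : 0 < b)
    (hsa : |sin θ| ≤ 2 * a) (hsb : |sin θ| ≤ 2 * b) : |slopeIn 0 a b θ| ≤ 1 := by
  rw [slopeIn, zero_div, zero_add, mul_assoc, abs_mul, mul_one_div, abs_div,
    abs_of_pos (add_pos ha hb), abs_of_nonneg (sq_nonneg (sin θ))]
  refine mul_le_one₀ (abs_cos_le_one θ) (by positivity) ((div_le_one (add_pos ha hb)).2 ?_)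
  rw [← sq_abs]
  nlinarith [abs_sin_le_one θ, abs_nonneg (sin θ)]

end

lemma le_sqrt_one_sub {u θ : ℝ} (hc : cos θ ≤ 0) : 1 ≤ √(1 - exp u * cos θ) := by
  rw [one_le_sqrt]
  nlinarith [exp_pos u]

lemma dq_Gin_bounds {p₁ p₂ σ ε u v θ : ℝ} (hσ : σ * p₁ = |p₁|) (hσ1 : |σ| ≤ 1)
    (hu : u < 0) (hv : v < 0) (huv : u < v) (hε : 0 ≤ ε) (hεB : ε * bnd p₁ p₂ ≤ 1 / 2) :
    -(8 + 4 * |p₁|) ≤ σ * dq (Gin p₁ p₂) ε u v θ ∧ (p₁ = 0 → |dq (Gin p₁ p₂) ε u v θ| ≤ 4) ∧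
    ∀ m > 0, m ≤ √(1 - exp u * cos θ) → m ≤ √(1 - exp v * cos θ) →
      |dq (Gin p₁ p₂) ε u v θ| ≤ 4 * ((|p₁| / (m * m) + 1) / (m + m)) := by
  obtain ⟨J, hJ, he⟩ := dq_Gin_eq (p₁ := p₁) (p₂ := p₂) (θ := θ) hu hv huv hε hεB
  have ha := sqrt_pos.2 (one_sub_exp_mul_cos_pos (θ := θ) hu)
  have hb := sqrt_pos.2 (one_sub_exp_mul_cos_pos (θ := θ) hv)
  have hsa := abs_sin_le_sqrt (sin_sq_add_cos_sq θ) (exp_pos u).le (exp_le_one_iff.2 hu.le)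
  have hsb := abs_sin_le_sqrt (sin_sq_add_cos_sq θ) (exp_pos v).le (exp_le_one_iff.2 hv.le)
  rw [he]
  refine ⟨?_, ?_, fun m hm h1 h2 => ?_⟩
  · have := neg_le_slopeIn hσ hσ1 ha hb hsa hsb fun h => ⟨le_sqrt_one_sub h, le_sqrt_one_sub h⟩
    have := mul_le_mul_of_nonneg_left this hJ.1
    have : J * (2 + |p₁|) ≤ 4 * (2 + |p₁|) := mul_le_mul_of_nonneg_right hJ.2 (by positivity)
    linarith
  · rintro rfl
    rw [abs_mul, abs_of_nonneg hJ.1]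
    have := abs_slopeIn_zero_le ha hb hsa hsb
    nlinarith [hJ.1, hJ.2]
  · rw [abs_mul, abs_of_nonneg hJ.1]
    exact mul_le_mul hJ.2 (abs_slopeIn_le hm h1 h2) (abs_nonneg _) (by norm_num)

lemma le_pd_Gin_zero {p₁ p₂ σ θ : ℝ} (hσ : σ * p₁ = |p₁|) (hσ1 : |σ| ≤ 1) (h0 : 0 < θ)
    (h1 : θ ≤ 1) : 3 / 8 * |p₁| * θ⁻¹ - 1 ≤ σ * pd (Gin p₁ p₂) 0 0 θ := by
  have hc := one_sub_sq_div_two_le_cos (x := θ)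
  have hc1 : cos θ < 1 := by
    rw [← cos_zero]
    exact cos_lt_cos_of_nonneg_of_le_pi_div_two le_rfl (by linarith [pi_gt_three]) h0
  rw [pd_Gin (one_sub_cos_pos hc1.ne), exp_zero, one_mul]
  have ha2 := sq_sqrt (sub_pos.2 hc1).le
  have ha := sqrt_pos.2 (sub_pos.2 hc1)
  set a := √(1 - cos θ)
  have hs : sin θ ^ 2 = a ^ 2 * (1 + cos θ) := by rw [ha2, sin_sq]; ring
  have haθ : a ≤ θ := by nlinarith
  have hc2 : 1 / 2 ≤ cos θ := by nlinarith
  have ha1 : a ≤ 1 := by linarith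
  have e : σ * (sin θ ^ 2 * (cos θ / 2 * (p₁ / a ^ 3 + 1 / a))) =
      cos θ * (1 + cos θ) / 2 * (|p₁| * a⁻¹) + σ * a * (cos θ * (1 + cos θ) / 2) := by
    rw [hs, ← hσ]
    field_simp
  rw [e]
  have h2 : 3 / 8 ≤ cos θ * (1 + cos θ) / 2 := by nlinarith
  have h3 : cos θ * (1 + cos θ) / 2 ≤ 1 := by nlinarith
  have h4 : θ⁻¹ ≤ a⁻¹ := inv_anti₀ ha haθ
  have h5 : 3 / 8 * (|p₁| * θ⁻¹) ≤ cos θ * (1 + cos θ) / 2 * (|p₁| * a⁻¹) :=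
    mul_le_mul h2 (mul_le_mul_of_nonneg_left h4 (abs_nonneg _)) (by positivity) (by linarith)
  have h6 : |σ * a| ≤ 1 := by
    rw [abs_mul, abs_of_pos ha]; exact mul_le_one₀ hσ1 ha.le ha1
  have h7 := (abs_le.1 h6).1
  nlinarith

lemma intervalIntegrable_pd_Gin_zero {p₁ p₂ η : ℝ} (hη : 0 < η) (hη1 : η ≤ 1) :
    IntervalIntegrable (fun θ => pd (Gin p₁ p₂) 0 0 θ) volume η 1 := by
  refine ContinuousOn.intervalIntegrable_of_Icc hη1 fun θ hθ => ?_
  have hc1 : cos θ < 1 := by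
    rw [← cos_zero]
    exact cos_lt_cos_of_nonneg_of_le_pi_div_two le_rfl (by linarith [pi_gt_three, hθ.2])
      (hη.trans_le hθ.1)
  exact (ContinuousAt.comp (g := unc (pd (Gin p₁ p₂))) (f := fun θ => ((0:ℝ), (0:ℝ), θ))
    (contDiffAt_pd (n := 2) (by norm_num)
      (contDiffAt_Gin_zero (one_sub_cos_pos hc1.ne))).continuousAt
      (by fun_prop)).continuousWithinAt

lemma integral_pd_Gin_zero_pos (p₂ : ℝ) : 0 < ∫ θ in (0:ℝ)..2 * π, pd (Gin 0 p₂) 0 0 θ := by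
  have hae : ∀ᵐ θ : ℝ, θ ∈ uIoc 0 (2 * π) →
      pd (Gin 0 p₂) 0 0 θ = cos θ * (1 + cos θ) / 2 * √(1 - cos θ) := by
    filter_upwards [ae_cos_ne_one] with θ hθ _
    have h := one_sub_cos_pos hθ
    rw [pd_Gin h]
    rw [exp_zero, one_mul] at h ⊢
    have ha := sqrt_pos.2 h
    have ha2 := sq_sqrt h.le
    have hs : sin θ ^ 2 = √(1 - cos θ) ^ 2 * (1 + cos θ) := by rw [ha2, sin_sq]; ring
    rw [hs]
    field_simp
    ring
  rw [intervalIntegral.integral_congr_ae hae]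
  have hsum : ∀ θ, cos θ * (1 + cos θ) / 2 * √(1 - cos θ) +
      cos (θ + π) * (1 + cos (θ + π)) / 2 * √(1 - cos (θ + π)) =
      √(1 + cos θ) * √(1 - cos θ) / 2 * (cos θ * (√(1 + cos θ) - √(1 - cos θ))) := fun θ => by
    have h1 := sq_sqrt (show 0 ≤ 1 + cos θ by linarith [neg_one_le_cos θ])
    have h2 := sq_sqrt (show 0 ≤ 1 - cos θ by linarith [cos_le_one θ])
    rw [cos_add_pi, sub_neg_eq_add]
    linear_combination (-cos θ * √(1 - cos θ) / 2) * h1 + cos θ * √(1 + cos θ) / 2 * h2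
  refine integral_pos_of_add_shift (by fun_prop) (fun θ => by rw [cos_add_two_pi])
    (fun θ => ?_) pi_div_four_mem ?_
  · rw [hsum]
    refine mul_nonneg (by positivity) ?_
    rcases le_total 0 (cos θ) with h | h
    · exact mul_nonneg h (sub_nonneg.2 (sqrt_le_sqrt (by linarith)))
    · exact mul_nonneg_of_nonpos_of_nonpos h (sub_nonpos.2 (sqrt_le_sqrt (by linarith)))
  · rw [hsum]
    have h0 : 0 < cos (π / 4) := by rw [cos_pi_div_four]; positivity
    have h1 : cos (π / 4) < 1 := by
      have := sin_sq_add_cos_sq (π / 4)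
      nlinarith [sin_sq_pi_div_four_pos]
    have h2 : √(1 - cos (π / 4)) < √(1 + cos (π / 4)) :=
      sqrt_lt_sqrt (by linarith) (by linarith)
    have h3 := sqrt_pos.2 (show 0 < 1 - cos (π / 4) by linarith)
    exact mul_pos (by positivity) (mul_pos h0 (sub_pos.2 h2))

lemma endCondition_Gin (p₁ p₂ k : ℝ) :
    EndCondition (Gin p₁ p₂) (1 / (2 * bnd p₁ p₂)) 0 (Icc k 0 ∩ Iio 0) := by
  have hB := bnd_pos p₁ p₂
  have hεB : ∀ ε ∈ Ioo 0 (1 / (2 * bnd p₁ p₂)), ε * bnd p₁ p₂ ≤ 1 / 2 := fun ε hε => by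
    have := (lt_div_iff₀ (by positivity)).1 hε.2
    linarith
  have hpi := pi_gt_three
  have hpi' := pi_lt_four
  rcases eq_or_ne p₁ 0 with hp | hp
  · refine ⟨1, 8 + 4 * |p₁|, 0, 2 * π, 4, le_rfl, two_pi_pos.le, le_rfl,
      fun ε hε u hu v hv huv => ?_, ?_⟩
    · have hb := fun θ => dq_Gin_bounds (p₁ := p₁) (p₂ := p₂) (σ := 1) (θ := θ) (by simp [hp])
        (by simp) hu.2 hv.2 huv hε.1.le (hεB ε hε)
      exact ⟨fun θ _ => (hb θ).1, fun θ _ => (hb θ).2.1 hp⟩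
    · have := integral_pd_Gin_zero_pos p₂
      rw [hp]
      linarith
  · have hp0 := abs_pos.2 hp
    set σ : ℝ := |p₁| / p₁ with hσd
    have hσ : σ * p₁ = |p₁| := div_mul_cancel₀ _ hp
    have hσ1 : |σ| ≤ 1 := by rw [hσd, abs_div, abs_abs, div_self hp0.ne']
    set C := 8 + 4 * |p₁| with hC
    set L := (8 * C + 2) * 8 / (3 * |p₁|) with hL
    have hL0 : 0 < L := by positivity
    have hη : exp (-L) ≤ 1 := exp_le_one_iff.2 (by linarith)
    have hcη : cos (exp (-L)) < 1 := by
      rw [← cos_zero]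
      exact cos_lt_cos_of_nonneg_of_le_pi_div_two le_rfl (by linarith) (exp_pos _)
    set m := √(1 - cos (exp (-L))) with hm
    have hm0 : 0 < m := sqrt_pos.2 (sub_pos.2 hcη)
    refine ⟨σ, C, exp (-L), 1, 4 * ((|p₁| / (m * m) + 1) / (m + m)), (exp_pos _).le, hη,
      by linarith,
      fun ε hε u hu v hv huv => ?_, ?_⟩
    · have hb := fun θ => dq_Gin_bounds (p₁ := p₁) (p₂ := p₂) (θ := θ) hσ hσ1 hu.2 hv.2 huv
        hε.1.le (hεB ε hε)
      refine ⟨fun θ _ => (hb θ).1, fun θ hθ => (hb θ).2.2 m hm0 ?_ ?_⟩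
      all_goals
        refine sqrt_le_sqrt ?_
        have h1 : cos θ ≤ cos (exp (-L)) :=
          cos_le_cos_of_nonneg_of_le_pi (exp_pos _).le (by linarith [hθ.2]) hθ.1
        have h2 : 0 ≤ cos θ := cos_nonneg_of_neg_pi_div_two_le_of_le
          (by linarith [hθ.1, exp_pos (-L)]) (by linarith [hθ.2])
      · nlinarith [exp_lt_one_iff.2 hu.2, exp_pos u]
      · nlinarith [exp_lt_one_iff.2 hv.2, exp_pos v]
    · have h1 : ∫ θ in exp (-L)..1, (3 / 8 * |p₁| * θ⁻¹ - 1) ≤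
          ∫ θ in exp (-L)..1, σ * pd (Gin p₁ p₂) 0 0 θ := by
        refine intervalIntegral.integral_mono_on hη ?_
          ((intervalIntegrable_pd_Gin_zero (exp_pos _) hη).const_mul _) fun θ hθ =>
          le_pd_Gin_zero hσ hσ1 ((exp_pos _).trans_le hθ.1) hθ.2
        refine ContinuousOn.intervalIntegrable_of_Icc hη fun θ hθ => ?_
        have := ((exp_pos _).trans_le hθ.1).ne'
        exact ContinuousAt.continuousWithinAt (by fun_prop (disch := assumption))
      have hii : IntervalIntegrable (fun θ : ℝ => 3 / 8 * |p₁| * θ⁻¹) volume (exp (-L)) 1 := by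
        refine ContinuousOn.intervalIntegrable_of_Icc hη fun θ hθ => ?_
        have := ((exp_pos _).trans_le hθ.1).ne'
        exact ContinuousAt.continuousWithinAt (by fun_prop (disch := assumption))
      rw [intervalIntegral.integral_sub hii intervalIntegrable_const,
        intervalIntegral.integral_const_mul, integral_inv_of_pos (exp_pos _) one_pos,
        one_div, ← exp_neg, neg_neg, log_exp, intervalIntegral.integral_const_mul,
        intervalIntegral.integral_const, smul_eq_mul] at h1
      refine lt_of_lt_of_le ?_ h1
      have h2 : 3 / 8 * |p₁| * L = 8 * C + 2 := by rw [hL]; field_simp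
      rw [h2]
      have hC0 : 0 < C := by positivity
      nlinarith [exp_pos (-L)]

/-- Inside the right loop, small perturbations have no three ordered periodic solutions. -/
lemma exists_not_three_inside (p₁ p₂ : ℝ) : ∃ ε₁ > 0, ε₁ * bnd p₁ p₂ ≤ 1 / 2 ∧
    ∀ ε ∈ Ioo 0 ε₁, ∀ ρ₁ ρ₂ ρ₃,
      IsSol (Gin p₁ p₂) (Iio 0) ε ρ₁ → IsSol (Gin p₁ p₂) (Iio 0) ε ρ₂ →
      IsSol (Gin p₁ p₂) (Iio 0) ε ρ₃ → (∀ θ, ρ₁ θ < ρ₂ θ) → (∀ θ, ρ₂ θ < ρ₃ θ) → False := by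
  obtain ⟨k, hk, hlow⟩ := exists_lower_bound p₁ p₂
  have hB := bnd_pos p₁ p₂
  obtain ⟨ε₁, hε₁, h⟩ := (averaging_Gin p₁ p₂ k).exists_forall_not_three
    (endCondition_Gin p₁ p₂ k) (by
      rcases le_or_gt 0 p₁ with hp | hp
      · exact Or.inl fun ℓ hℓ => (integral_pd_Gin_pos hp hℓ).ne'
      · exact Or.inr ⟨_, fun ℓ hℓ => integral_pd_pd_Gin_lt hp hℓ⟩)
  have hm : min ε₁ (1 / (2 * bnd p₁ p₂)) * bnd p₁ p₂ ≤ 1 / 2 := by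
    refine (mul_le_mul_of_nonneg_right (min_le_right _ _) hB.le).trans (le_of_eq ?_)
    field_simp
  refine ⟨min ε₁ (1 / (2 * bnd p₁ p₂)), by positivity, hm,
    fun ε hε ρ₁ ρ₂ ρ₃ h₁ h₂ h₃ => ?_⟩
  have hεB : ε * bnd p₁ p₂ ≤ 1 / 2 :=
    (mul_le_mul_of_nonneg_right hε.2.le hB.le).trans hm
  have hS : ∀ ρ, IsSol (Gin p₁ p₂) (Iio 0) ε ρ → IsSol (Gin p₁ p₂) (Icc k 0 ∩ Iio 0) ε ρ :=
    fun ρ hρ => ⟨hρ.per, hρ.deriv, fun θ => ⟨⟨hlow ε hε.1 hεB ρ hρ θ, le_of_lt (hρ.mem θ)⟩,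
      hρ.mem θ⟩⟩
  exact h ε ⟨hε.1, hε.2.trans_le (min_le_left _ _)⟩ ρ₁ ρ₂ ρ₃ (hS _ h₁) (hS _ h₂) (hS _ h₃)

lemma exists_forall_le_of_periodic {V : ℝ → ℝ} {T : ℝ} (hT : 0 < T) (hV : Continuous V)
    (hper : ∀ t, V (t + T) = V t) : ∃ t₀, ∀ t, V t ≤ V t₀ := by
  obtain ⟨t₀, -, h⟩ := isCompact_Icc.exists_isMaxOn (nonempty_Icc.2 hT.le) hV.continuousOn
  refine ⟨t₀, fun t => ?_⟩
  obtain ⟨s, hs, he⟩ := Periodic.exists_mem_Ico₀ (f := V) hper hT t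
  rw [he]
  exact h (Ico_subset_Icc_self hs)

section

variable {A F p₁ p₂ ε x y a : ℝ}

lemma damping_sub_le (hA : A = (|p₁| + p₂ ^ 2 + 2) ^ 2) :
    p₁ + p₂ * x - x ^ 2 - (A * (1 / (1 + x ^ 2)) - 1) ≤ -((1 + x ^ 2) / 4) := by
  have hX : 0 < 1 + x ^ 2 := by positivity
  have h1 : |p₁| + p₂ ^ 2 + 2 ≤ (1 + x ^ 2) / 2 + A * (1 / (1 + x ^ 2)) := by
    have e : (1 + x ^ 2) / 2 + A * (1 / (1 + x ^ 2)) = ((1 + x ^ 2) ^ 2 / 2 + A) / (1 + x ^ 2) := by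
      field_simp
    rw [e, le_div_iff₀ hX, hA]
    nlinarith [sq_nonneg ((1 + x ^ 2) - (|p₁| + p₂ ^ 2 + 2)), sq_nonneg (|p₁| + p₂ ^ 2 + 2)]
  nlinarith [le_abs_self p₁, sq_nonneg (p₂ - x / 2)]

lemma sq_sub_le (ha : |a| ≤ 2) : (A * a - x) ^ 2 ≤ (2 + 8 * A ^ 2) * (1 + x ^ 2) := by
  have h : a ^ 2 ≤ 4 := by rw [← sq_abs]; nlinarith [abs_nonneg a]
  have := mul_le_mul_of_nonneg_left h (sq_nonneg A)
  nlinarith [sq_nonneg (A * a + x), mul_nonneg (sq_nonneg A) (sq_nonneg x)]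

lemma damping_sq_le (hF : F = |p₁| + |p₂| + 1) :
    (p₁ + p₂ * x - x ^ 2) ^ 2 ≤ F ^ 2 * (1 + x ^ 2) ^ 2 := by
  rw [← mul_pow, ← sq_abs]
  refine pow_le_pow_left₀ (abs_nonneg _) ?_ 2
  rw [abs_le]
  have h1 := abs_le.1 (le_refl |p₁|)
  have h2 : |p₂ * x| ≤ |p₂| * (1 + x ^ 2) := by
    rw [abs_mul]
    refine mul_le_mul_of_nonneg_left ?_ (abs_nonneg _)
    rw [← sq_abs]
    nlinarith [sq_nonneg (|x| - 1)]
  have h3 := abs_le.1 h2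
  rw [hF]
  constructor <;> nlinarith [abs_nonneg p₁, abs_nonneg p₂, sq_nonneg x,
    mul_nonneg (abs_nonneg p₁) (sq_nonneg x)]

lemma restoring_le (hA : 0 ≤ A) (ha : |a| ≤ 2) : -((A * a - x) * (x - x ^ 3)) ≤
    -x ^ 4 + x ^ 2 + (x ^ 4 / 4 + 4 * A ^ 2 * x ^ 2) + (A ^ 2 + x ^ 2) := by
  have ha' := abs_le.1 ha
  have h1 : |A * a * x| ≤ 2 * A * |x| := by
    rw [abs_mul, abs_mul, abs_of_nonneg hA]
    nlinarith [mul_le_mul_of_nonneg_left ha (mul_nonneg hA (abs_nonneg x))]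
  have h2 := abs_le.1 h1
  have h3 : x ^ 2 * (A * a * x) ≤ x ^ 2 * (2 * A * |x|) :=
    mul_le_mul_of_nonneg_left h2.2 (sq_nonneg x)
  have h4 : x ^ 2 * (2 * A * |x|) ≤ x ^ 4 / 4 + 4 * A ^ 2 * x ^ 2 := by
    have : |x| ^ 2 = x ^ 2 := sq_abs x
    nlinarith [sq_nonneg (x ^ 2 / 2 - 2 * A * |x|)]
  have h5 : 2 * A * |x| ≤ A ^ 2 + x ^ 2 := by
    rw [← sq_abs x]; nlinarith [sq_nonneg (A - |x|)]
  nlinarith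

lemma cross_term_le {X ψ g : ℝ} (hX : 0 < X) (h : ε ^ 2 * (2 * (ψ ^ 2 * g ^ 2)) ≤ X ^ 3 / 16) :
    -(ε * (ψ * g * y)) ≤ X * y ^ 2 / 8 + X ^ 2 / 16 := by
  refine le_of_mul_le_mul_right ?_ hX
  have h1 := sq_nonneg (X * y + 4 * ε * (ψ * g))
  linear_combination h1 / 8 + h

lemma cross_sq_le {X ψ g b : ℝ} (hX : 0 < X) (hb : 0 ≤ b) (hψ : ψ ^ 2 ≤ b * X)
    (hg : g ^ 2 ≤ F ^ 2 * X ^ 2) (hεF : ε ^ 2 * (2 * b * F ^ 2) ≤ 1 / 16) :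
    ε ^ 2 * (2 * (ψ ^ 2 * g ^ 2)) ≤ X ^ 3 / 16 := by
  have h1 : ψ ^ 2 * g ^ 2 ≤ (b * X) * (F ^ 2 * X ^ 2) :=
    mul_le_mul hψ hg (sq_nonneg _) (by positivity)
  have h2 := mul_le_mul_of_nonneg_left h1 (sq_nonneg ε)
  have h3 := mul_le_mul_of_nonneg_right hεF (pow_pos hX 3).le
  linear_combination 2 * h2 + h3

lemma lyapunov_deriv_le (hA : A = (|p₁| + p₂ ^ 2 + 2) ^ 2) (hF : F = |p₁| + |p₂| + 1)
    (ha : |a| ≤ 2) (hεF : ε ^ 2 * (2 * (2 + 8 * A ^ 2) * F ^ 2) ≤ 1 / 16)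
    (h0 : 0 ≤ (p₁ + p₂ * x - x ^ 2 - (A * (1 / (1 + x ^ 2)) - 1)) * y ^ 2 -
      (A * a - x) * (x - x ^ 3) - ε * ((A * a - x) * (p₁ + p₂ * x - x ^ 2) * y)) :
    y ^ 2 / 8 + x ^ 4 / 4 ≤ (2 + 4 * A ^ 2) ^ 2 + A ^ 2 + 1 := by
  have hA0 : 0 ≤ A := by rw [hA]; positivity
  have h1 := mul_le_mul_of_nonneg_right (damping_sub_le (x := x) hA) (sq_nonneg y)
  have h2 := restoring_le (x := x) hA0 ha
  have hX : 0 < 1 + x ^ 2 := by positivity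
  have h3 := cross_term_le (y := y) hX
    (cross_sq_le hX (by positivity) (sq_sub_le ha) (damping_sq_le hF) hεF)
  have h5 : (1 + x ^ 2) ^ 2 / 16 ≤ (1 + x ^ 4) / 8 := by
    linear_combination sq_nonneg (x ^ 2 - 1) / 16
  have h6 := sq_nonneg (x ^ 2 / 2 - (2 + 4 * A ^ 2))
  have h7 := mul_nonneg (sq_nonneg x) (sq_nonneg y)
  linear_combination h0 + h1 + h2 + h3 + h5 + h6 + h7 / 8 +
    sq_nonneg (x ^ 2) / 8

lemma energy_sub_le {E u V : ℝ} (hbox : y ^ 2 / 8 + x ^ 4 / 4 ≤ E)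
    (hu : u ^ 2 ≤ (2 + 8 * A ^ 2) * (1 + x ^ 2))
    (hV : V ≤ H x y + |u| * |y|) : V ≤ 9 * E + (1 + 4 * A ^ 2) * (2 + 4 * E) := by
  have h1 := two_mul_le_add_sq |u| |y|
  rw [sq_abs, sq_abs] at h1
  have h4 : x ^ 2 ≤ 1 + x ^ 4 := by
    linear_combination sq_nonneg (x ^ 2 - 1) / 2 + sq_nonneg (x ^ 2) / 2
  have h5 : (1 + 4 * A ^ 2) * (1 + x ^ 2) ≤ (1 + 4 * A ^ 2) * (2 + 4 * E) :=
    mul_le_mul_of_nonneg_left (by linarith [sq_nonneg y]) (by positivity)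
  have h6 : 0 ≤ x ^ 4 := by positivity
  unfold H at hV
  linarith [sq_nonneg x, sq_nonneg y]

lemma energy_le_of_sub_le {u V₀ : ℝ} (hu : u ^ 2 ≤ (2 + 8 * A ^ 2) * (1 + x ^ 2))
    (hV : H x y ≤ V₀ + |u| * |y|) :
    H x y ≤ 2 * (V₀ + (2 + 8 * A ^ 2) + 2 * (3 + 8 * A ^ 2) ^ 2) := by
  have h1 := two_mul_le_add_sq (2 * |u|) |y|
  rw [mul_pow, sq_abs, sq_abs] at h1
  have h2 := sq_nonneg (x ^ 2 - 4 * (3 + 8 * A ^ 2))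
  have h5 : y ^ 2 / 4 + x ^ 4 / 8 ≤ V₀ + (2 + 8 * A ^ 2) + 2 * (3 + 8 * A ^ 2) ^ 2 := by
    unfold H at hV
    linear_combination hV + h1 / 4 + hu + h2 / 8 + sq_nonneg x / 2
  unfold H
  linarith [sq_nonneg x]

lemma abs_arctan_le_two (x : ℝ) : |arctan x| ≤ 2 := by
  rw [abs_le]
  constructor <;> linarith [neg_pi_div_two_lt_arctan x, arctan_lt_pi_div_two x, pi_lt_four]

end

/-- Periodic orbits of small perturbations stay in a fixed energy range. -/
lemma exists_energy_bound (p₁ p₂ : ℝ) : ∃ M > 0, ∃ ε₀ > 0, ∀ ε ∈ Ioo 0 ε₀, ∀ x y,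
    IsPeriodicOrbit ε p₁ p₂ x y → ∀ t, H (x t) (y t) ≤ M := by
  obtain ⟨A, hA⟩ : ∃ A, A = (|p₁| + p₂ ^ 2 + 2) ^ 2 := ⟨_, rfl⟩
  obtain ⟨F, hF⟩ : ∃ F, F = |p₁| + |p₂| + 1 := ⟨_, rfl⟩
  obtain ⟨E, hE⟩ : ∃ E, E = (2 + 4 * A ^ 2) ^ 2 + A ^ 2 + 1 := ⟨_, rfl⟩
  obtain ⟨B, hB⟩ : ∃ B, B = 2 * (2 + 8 * A ^ 2) * F ^ 2 := ⟨_, rfl⟩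
  have hF0 : 0 < F := by rw [hF]; positivity
  have hB0 : 0 < B := by rw [hB]; positivity
  have hE0 : 0 < E := by rw [hE]; positivity
  refine ⟨2 * (9 * E + (1 + 4 * A ^ 2) * (2 + 4 * E) + (2 + 8 * A ^ 2) + 2 * (3 + 8 * A ^ 2) ^ 2),
    by positivity, min 1 (1 / (16 * B)), by positivity, fun ε hε x y h => ?_⟩
  have hε1 : ε < 1 := hε.2.trans_le (min_le_left _ _)
  have hεB : ε ^ 2 * B ≤ 1 / 16 := by
    have h1 := (lt_div_iff₀ (by positivity)).1 (hε.2.trans_le (min_le_right _ _))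
    have h2 := mul_le_mul_of_nonneg_right hε1.le (mul_pos hε.1 hB0).le
    linarith
  rw [hB] at hεB
  obtain ⟨T, hT, hper⟩ := h.2.2.1
  set V : ℝ → ℝ := fun t => H (x t) (y t) - ε * ((A * arctan (x t) - x t) * y t) with hV
  have hVd : ∀ t, HasDerivAt V (ε * ((p₁ + p₂ * x t - x t ^ 2 -
      (A * (1 / (1 + x t ^ 2)) - 1)) * y t ^ 2 - (A * arctan (x t) - x t) * (x t - x t ^ 3) -
      ε * ((A * arctan (x t) - x t) * (p₁ + p₂ * x t - x t ^ 2) * y t))) t := fun t => by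
    have h1 := (((h.2.1 t).pow 2).div_const 2).sub (((h.1 t).pow 2).div_const 2)
    have h2 := h1.add (((h.1 t).pow 4).div_const 4)
    have h3 := (((((h.1 t).arctan.const_mul A).sub (h.1 t)).mul (h.2.1 t)).const_mul ε)
    refine (h2.sub h3).congr_deriv ?_
    norm_num
    ring
  obtain ⟨t₀, ht₀⟩ := exists_forall_le_of_periodic hT
    (continuous_iff_continuousAt.2 fun t => (hVd t).continuousAt) fun t => by
      simp only [hV, (hper t).1, (hper t).2]
  have hmax : IsLocalMax V t₀ := Eventually.of_forall ht₀
  have hd := hmax.hasDerivAt_eq_zero (hVd t₀)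
  have hd' := (mul_eq_zero.1 hd).resolve_left hε.1.ne'
  have hbox := lyapunov_deriv_le hA hF (abs_arctan_le_two (x t₀)) hεB hd'.ge
  rw [← hE] at hbox
  have hψy : ∀ t, |ε * ((A * arctan (x t) - x t) * y t)| ≤
      |A * arctan (x t) - x t| * |y t| := fun t => by
    rw [abs_mul, abs_mul, abs_of_pos hε.1]
    exact mul_le_of_le_one_left (by positivity) hε1.le
  have hsq := fun t => sq_sub_le (A := A) (x := x t) (abs_arctan_le_two (x t))
  have hVt₀ := energy_sub_le hbox (hsq t₀) (V := V t₀) (by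
    simp only [hV]
    linarith [(abs_le.1 (hψy t₀)).1])
  intro t
  refine energy_le_of_sub_le (hsq t) ?_
  have h4 := (ht₀ t).trans hVt₀
  simp only [hV] at h4
  linarith [(abs_le.1 (hψy t)).2]

/-- The radius in terms of the energy. -/
noncomputable def rr (h : ℝ) : ℝ := √(1 + 4 * h)

/-- The angular speed outside the loops, up to the factor `√2`. -/
noncomputable def qq (r s : ℝ) : ℝ := √(r - 1 + (1 + r) * s ^ 2)

/-- The damping coefficient in polar type coordinates outside the loops. -/
noncomputable def fo (p₁ p₂ r s : ℝ) : ℝ := p₁ + p₂ * √(1 + r) * s - (1 + r) * s ^ 2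

/-- The relative perturbation of the angular speed. -/
noncomputable def ko (p₁ p₂ r s c : ℝ) : ℝ := fo p₁ p₂ r s * s * c * qq r s / r

/-- The scaled equation for the energy outside the loops. -/
noncomputable def Gout (p₁ p₂ ε h θ : ℝ) : ℝ :=
  (1 + rr h) * cos θ ^ 2 * qq (rr h) (sin θ) * fo p₁ p₂ (rr h) (sin θ) /
    (1 - ε * ko p₁ p₂ (rr h) (sin θ) (cos θ))

/-- A bound for `ko`. -/
def bndo (p₁ p₂ M : ℝ) : ℝ := 2 * (|p₁| + (|p₂| + 1) * (2 + 2 * M))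

lemma one_le_rr {h : ℝ} (hh : 0 ≤ h) : 1 ≤ rr h := by
  rw [rr, one_le_sqrt]; linarith

lemma one_lt_rr {h : ℝ} (hh : 0 < h) : 1 < rr h := by
  rw [rr, lt_sqrt zero_le_one]; linarith

lemma rr_le {h : ℝ} (hh : 0 ≤ h) : rr h ≤ 1 + 2 * h := by
  rw [rr, sqrt_le_left (by linarith)]
  nlinarith

lemma qq_le {r s : ℝ} (hr : 1 ≤ r) (hs : s ^ 2 ≤ 1) : qq r s ≤ 2 * r := by
  rw [qq, sqrt_le_left (by linarith)]
  nlinarith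

section

variable {p₁ p₂ r s c M ε : ℝ}

lemma abs_fo_le (hr : 1 ≤ r) (hrM : r ≤ 1 + 2 * M) (hs : s ^ 2 ≤ 1) :
    |fo p₁ p₂ r s| ≤ |p₁| + (|p₂| + 1) * (2 + 2 * M) := by
  have hs' : |s| ≤ 1 := (sq_le_one_iff_abs_le_one _).1 hs
  have hZ : √(1 + r) ≤ 2 + 2 * M := by
    rw [sqrt_le_left (by linarith)]
    nlinarith
  have h1 : |p₂ * √(1 + r) * s| ≤ |p₂| * (2 + 2 * M) := by
    rw [abs_mul, abs_mul, abs_of_nonneg (sqrt_nonneg _), mul_assoc]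
    refine mul_le_mul_of_nonneg_left ?_ (abs_nonneg _)
    exact (mul_le_of_le_one_right (sqrt_nonneg _) hs').trans hZ
  have h2 : |(1 + r) * s ^ 2| ≤ 2 + 2 * M := by
    rw [abs_of_nonneg (by positivity)]
    nlinarith
  unfold fo
  have := abs_sub (p₁ + p₂ * √(1 + r) * s) ((1 + r) * s ^ 2)
  have := abs_add_le p₁ (p₂ * √(1 + r) * s)
  linarith

lemma bndo_pos (hM : 0 ≤ M) : 0 < bndo p₁ p₂ M := by unfold bndo; positivity

lemma abs_ko_le (hsc : s ^ 2 + c ^ 2 = 1) (hr : 1 ≤ r) (hrM : r ≤ 1 + 2 * M) :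
    |ko p₁ p₂ r s c| ≤ bndo p₁ p₂ M := by
  have hs : s ^ 2 ≤ 1 := by nlinarith [sq_nonneg c]
  have hc : |c| ≤ 1 := (sq_le_one_iff_abs_le_one _).1 (by nlinarith [sq_nonneg s])
  have hs' : |s| ≤ 1 := (sq_le_one_iff_abs_le_one _).1 hs
  have hr0 : 0 < r := by linarith
  have hq : qq r s / r ≤ 2 := (div_le_iff₀ hr0).2 (qq_le hr hs)
  have hq0 : 0 ≤ qq r s / r := div_nonneg (sqrt_nonneg _) hr0.le
  have e : ko p₁ p₂ r s c = fo p₁ p₂ r s * (s * c) * (qq r s / r) := by unfold ko; ring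
  rw [e, abs_mul, abs_mul, abs_of_nonneg hq0, bndo, mul_comm 2]
  have hsc1 : |s * c| ≤ 1 := by
    rw [abs_mul]; exact mul_le_one₀ hs' (abs_nonneg _) hc
  refine mul_le_mul ?_ hq hq0 ((abs_nonneg _).trans (abs_fo_le (p₁ := p₁) (p₂ := p₂) hr hrM hs))
  exact (mul_le_of_le_one_right (abs_nonneg _) hsc1).trans (abs_fo_le hr hrM hs)

lemma deno_mem (hsc : s ^ 2 + c ^ 2 = 1) (hr : 1 ≤ r) (hrM : r ≤ 1 + 2 * M) (hε : 0 ≤ ε)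
    (hεB : ε * bndo p₁ p₂ M ≤ 1 / 2) : 1 - ε * ko p₁ p₂ r s c ∈ Icc (1 / 2) (3 / 2) := by
  have hb := mul_le_mul_of_nonneg_left (abs_ko_le (p₁ := p₁) (p₂ := p₂) hsc hr hrM) hε
  have : |ε * ko p₁ p₂ r s c| ≤ 1 / 2 := by
    rw [abs_mul, abs_of_nonneg hε]; exact hb.trans hεB
  rw [abs_le] at this
  exact ⟨by linarith, by linarith⟩

end

lemma contDiffAt_Gout {p₁ p₂ ε h θ : ℝ} (hh : 0 ≤ h)
    (hq : 0 < rr h - 1 + (1 + rr h) * sin θ ^ 2)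
    (hd : 1 - ε * ko p₁ p₂ (rr h) (sin θ) (cos θ) ≠ 0) :
    ContDiffAt ℝ 3 (unc (Gout p₁ p₂)) (ε, h, θ) := by
  have hr := one_le_rr hh
  have h1 : ContDiffAt ℝ 3 (fun q : ℝ × ℝ × ℝ => rr q.2.1) (ε, h, θ) :=
    ContDiffAt.sqrt (by fun_prop) (by linarith)
  have h2 : ContDiffAt ℝ 3 (fun q : ℝ × ℝ × ℝ => qq (rr q.2.1) (sin q.2.2)) (ε, h, θ) :=
    ContDiffAt.sqrt (by fun_prop) hq.ne'
  have h3 : ContDiffAt ℝ 3 (fun q : ℝ × ℝ × ℝ => √(1 + rr q.2.1)) (ε, h, θ) :=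
    ContDiffAt.sqrt (by fun_prop) (by linarith)
  have h4 : ContDiffAt ℝ 3 (fun q : ℝ × ℝ × ℝ => fo p₁ p₂ (rr q.2.1) (sin q.2.2)) (ε, h, θ) := by
    unfold fo; fun_prop
  have h5 : ContDiffAt ℝ 3 (fun q : ℝ × ℝ × ℝ => ko p₁ p₂ (rr q.2.1) (sin q.2.2) (cos q.2.2))
      (ε, h, θ) := by
    have : ContDiffAt ℝ 3 (fun q : ℝ × ℝ × ℝ => fo p₁ p₂ (rr q.2.1) (sin q.2.2) * sin q.2.2 *
      cos q.2.2 * qq (rr q.2.1) (sin q.2.2)) (ε, h, θ) := by fun_prop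
    exact this.div h1 (by linarith)
  exact ContDiffAt.div (by fun_prop) (by fun_prop) hd

lemma angular_aux {u q r S C f ε y x : ℝ} (hu : u ≠ 0) (hr : r ≠ 0) (hx : x = u * S)
    (hy : √2 * y = u * q * C) :
    (y * u - x * (√2 * ε * f * y ^ 2 / (r * u))) / u ^ 2 =
      q / √2 * (1 - ε * (f * S * C * q / r)) * C := by
  have h2 : √2 ^ 2 = 2 := sq_sqrt (by norm_num)
  have h3 : √2 ≠ 0 := by positivity
  have h4 : y = u * q * C / √2 := by rw [← hy]; field_simp
  rw [h4, hx]
  field_simp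

/-- Periodic orbits outside the loops are graphs over the angle. -/
lemma exists_graph_outside {ε p₁ p₂ M : ℝ} {x y : ℝ → ℝ} (h : IsPeriodicOrbit ε p₁ p₂ x y)
    (hε : 0 < ε) (hεB : ε / √2 * bndo p₁ p₂ M ≤ 1 / 2) (hH : ∀ t, 0 < H (x t) (y t))
    (hHM : ∀ t, H (x t) (y t) ≤ M) :
    ∃ ρ, IsSol (Gout p₁ p₂) (Ioc 0 M) (ε / √2) ρ ∧ ∀ θ, ∃ t,
      (x t, y t) = (√(1 + rr (ρ θ)) * sin θ,
        √(1 + rr (ρ θ)) * cos θ * qq (rr (ρ θ)) (sin θ) / √2) := by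
  obtain ⟨T, hT, hper⟩ := h.2.2.1
  have h2 : √2 ^ 2 = 2 := sq_sqrt (by norm_num)
  have h2pos : 0 < √2 := by positivity
  obtain ⟨ε', hε'⟩ : ∃ ε', ε' = ε / √2 := ⟨_, rfl⟩
  rw [← hε'] at hεB ⊢
  have hε'0 : 0 < ε' := by rw [hε']; positivity
  have hεe : ε = √2 * ε' := by rw [hε']; field_simp
  set R : ℝ → ℝ := fun t => H (x t) (y t) with hR
  set r : ℝ → ℝ := fun t => rr (R t) with hr
  set u : ℝ → ℝ := fun t => √(1 + r t) with hu
  set q : ℝ → ℝ := fun t => √(r t - 1 + x t ^ 2) with hq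
  set S : ℝ → ℝ := fun t => x t / u t with hS
  set C : ℝ → ℝ := fun t => √2 * y t / (u t * q t) with hC
  set f : ℝ → ℝ := fun t => p₁ + p₂ * x t - x t ^ 2 with hf
  set ω : ℝ → ℝ := fun t => q t / √2 * (1 - ε' * (f t * S t * C t * q t / r t)) with hω
  have hr1 : ∀ t, 1 < r t := fun t => one_lt_rr (hH t)
  have hr2 : ∀ t, r t ^ 2 = 1 + 4 * R t := fun t => sq_sqrt (by linarith [hH t])
  have hu0 : ∀ t, 0 < u t := fun t => sqrt_pos.2 (by linarith [hr1 t])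
  have hu2 : ∀ t, u t ^ 2 = 1 + r t := fun t => sq_sqrt (by linarith [hr1 t])
  have hq0' : ∀ t, 0 < r t - 1 + x t ^ 2 := fun t => by nlinarith [hr1 t, sq_nonneg (x t)]
  have hq0 : ∀ t, 0 < q t := fun t => sqrt_pos.2 (hq0' t)
  have hq2 : ∀ t, q t ^ 2 = r t - 1 + x t ^ 2 := fun t => sq_sqrt (hq0' t).le
  have hrd : ∀ t, 2 * y t ^ 2 = (1 + r t - x t ^ 2) * (r t - 1 + x t ^ 2) := fun t => by
    have := hr2 t
    simp only [hR, H] at this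
    linear_combination -this
  have hx : ∀ t, x t = u t * S t := fun t => by
    have := (hu0 t).ne'
    simp only [hS]; field_simp
  have hy : ∀ t, √2 * y t = u t * q t * C t := fun t => by
    have := (hu0 t).ne'
    have := (hq0 t).ne'
    simp only [hC]; field_simp
  have hSC : ∀ t, S t ^ 2 + C t ^ 2 = 1 := fun t => by
    have hp : (u t * q t) ^ 2 ≠ 0 := (pow_pos (mul_pos (hu0 t) (hq0 t)) 2).ne'
    refine mul_left_cancel₀ hp ?_
    have h3 : (u t * q t) ^ 2 * C t ^ 2 = 2 * y t ^ 2 := by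
      rw [← mul_pow, ← hy, mul_pow, h2]
    have h4 : (u t * q t) ^ 2 * S t ^ 2 = q t ^ 2 * x t ^ 2 := by rw [hx t]; ring
    rw [mul_add, h3, h4, hrd, mul_pow, hq2, hu2]
    ring
  have hqq : ∀ t, qq (r t) (S t) = q t := fun t => by
    simp only [qq, hq]
    rw [hx t, mul_pow, hu2]
  have hfo : ∀ t, fo p₁ p₂ (r t) (S t) = f t := fun t => by
    simp only [fo, hf]
    rw [hx t, mul_pow, hu2]
    change p₁ + p₂ * u t * S t - _ = _
    ring
  have hωe : ∀ t, ω t = q t / √2 * (1 - ε' * ko p₁ p₂ (r t) (S t) (C t)) := fun t => by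
    simp only [hω, ko, hqq, hfo]
  have hden : ∀ t, 1 - ε' * ko p₁ p₂ (r t) (S t) (C t) ∈ Icc (1 / 2) (3 / 2) := fun t =>
    deno_mem (hSC t) (hr1 t).le ((rr_le (hH t).le).trans (by linarith [hHM t])) hε'0.le hεB
  have hωpos : ∀ t, 0 < ω t := fun t => by
    rw [hωe]
    have := (hden t).1
    have := hq0 t
    have : 0 < 1 - ε' * ko p₁ p₂ (r t) (S t) (C t) := by linarith
    positivity
  have hRd : ∀ t, HasDerivAt R (ε * f t * y t ^ 2) t := fun t => by
    refine (((((h.2.1 t).pow 2).div_const 2).sub (((h.1 t).pow 2).div_const 2)).add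
      (((h.1 t).pow 4).div_const 4)).congr_deriv ?_
    simp only [hf]
    norm_num
    ring
  have hrd' : ∀ t, HasDerivAt r (2 * (ε * f t * y t ^ 2) / r t) t := fun t => by
    refine (((hRd t).const_mul 4).const_add 1).sqrt (by linarith [hH t]) |>.congr_deriv ?_
    change _ / (2 * r t) = _
    have := (hr1 t)
    field_simp
    ring
  have hud : ∀ t, HasDerivAt u (ε * f t * y t ^ 2 / (r t * u t)) t := fun t => by
    refine ((hrd' t).const_add 1).sqrt (by linarith [hr1 t]) |>.congr_deriv ?_
    change _ / (2 * u t) = _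
    have := (hr1 t)
    have := (hu0 t)
    field_simp
  have hSd : ∀ t, HasDerivAt S (ω t * C t) t := fun t => by
    refine ((h.1 t).div (hud t) (hu0 t).ne').congr_deriv ?_
    rw [hεe]
    exact angular_aux (hu0 t).ne' (by linarith [hr1 t]) (hx t) (hy t)
  have hCd : ∀ t, HasDerivAt C (-(ω t * S t)) t := fun t => by
    have hqd : DifferentiableAt ℝ q t :=
      (((hrd' t).differentiableAt.sub_const 1).add ((h.1 t).differentiableAt.pow 2)).sqrt
        (hq0' t).ne'
    have hpd := (hud t).mul hqd.hasDerivAt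
    have hCd := ((h.2.1 t).const_mul √2).div hpd (mul_pos (hu0 t) (hq0 t)).ne'
    refine hCd.congr_deriv ?_
    obtain ⟨d, hd⟩ : ∃ d, HasDerivAt C d t := ⟨_, hCd⟩
    rw [← hd.unique hCd]
    by_cases hy0 : y t = 0
    · have hc0 : C t = 0 := by simp only [hC, hy0, mul_zero, zero_div]
      have hx2 : x t ^ 2 = 1 + r t := by
        have := hrd t
        rw [hy0] at this
        have h3 := (mul_eq_zero.1 (by linarith : (1 + r t - x t ^ 2) * (r t - 1 + x t ^ 2) = 0))
        linarith [h3.resolve_right (hq0' t).ne']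
      have hqr : q t ^ 2 = 2 * r t := by rw [hq2]; linarith
      have h4 := hu0 t
      have h5 := hq0 t
      rw [hd.unique hCd]
      simp only [hω, hc0, hy0, hS]
      simp only [mul_zero, zero_mul, sub_zero, zero_div, mul_one, add_zero, Pi.mul_apply]
      field_simp
      linear_combination (x t - x t ^ 3) * h2 - 2 * x t * hx2 + x t * hqr
    · have hc0 : C t ≠ 0 := by
        simp only [hC]
        have := hu0 t
        have := hq0 t
        positivity
      have h1 : HasDerivAt (fun t => S t ^ 2 + C t ^ 2) 0 t := by
        simp only [hSC]
        exact hasDerivAt_const t 1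
      have h3 := h1.unique (((hSd t).pow 2).add (hd.pow 2))
      refine mul_left_cancel₀ hc0 ?_
      norm_num at h3
      linear_combination -h3 / 2
  have hcont : Continuous ω := by
    have hrc : Continuous r := continuous_iff_continuousAt.2 fun t => (hrd' t).continuousAt
    have hSc : Continuous S := continuous_iff_continuousAt.2 fun t => (hSd t).continuousAt
    have hCc : Continuous C := continuous_iff_continuousAt.2 fun t => (hCd t).continuousAt
    have := h.continuous.1
    have hqc : Continuous q := by simp only [hq]; fun_prop
    simp only [hω]
    refine (hqc.div_const _).mul (continuous_const.sub (continuous_const.mul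
      (Continuous.div ?_ hrc fun t => by linarith [hr1 t])))
    simp only [hf]
    fun_prop
  obtain ⟨ρ, hρ, hρd, hρz⟩ := exists_polar_graph (z := fun t => (x t, y t)) (S := S) (C := C)
    (R := R) (ω := ω) (Ψ := fun ρ s c => (√(1 + rr ρ) * s, √(1 + rr ρ) * c * qq (rr ρ) s / √2))
    (g := fun ρ s c => ε' * ((1 + rr ρ) * c ^ 2 * qq (rr ρ) s * fo p₁ p₂ (rr ρ) s /
      (1 - ε' * ko p₁ p₂ (rr ρ) s c))) hT hSd hCd hSC hcont hωpos
    (fun t => (hRd t).congr_deriv (by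
      have := hden t
      have h3 : 1 - ε' * ko p₁ p₂ (r t) (S t) (C t) ≠ 0 := by linarith [this.1]
      change _ = ω t * (ε' * ((1 + r t) * C t ^ 2 * qq (r t) (S t) * fo p₁ p₂ (r t) (S t) /
        (1 - ε' * ko p₁ p₂ (r t) (S t) (C t))))
      have h4 : y t = u t * q t * C t / √2 := by rw [← hy]; field_simp
      rw [hωe, hεe, hqq, hfo, h4, ← hu2]
      field_simp))
    (fun t => by
      have h4 : y t = u t * q t * C t / √2 := by rw [← hy]; field_simp
      change _ = (u t * S t, u t * C t * qq (r t) (S t) / √2)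
      rw [hqq, ← hx, h4]
      refine Prod.ext rfl ?_
      simp only
      ring)
    (fun s t hst => by
      have h1 : x s = x t := congrArg Prod.fst hst
      have h2 : y s = y t := congrArg Prod.snd hst
      have hRe : R s = R t := by simp only [hR, h1, h2]
      have hre : r s = r t := by simp only [hr, hRe]
      have hue : u s = u t := by simp only [hu, hre]
      have hqe : q s = q t := by simp only [hq, hre, h1]
      have hSe : S s = S t := by simp only [hS, h1, hue]
      have hCe : C s = C t := by simp only [hC, h2, hue, hqe]
      exact ⟨hRe, hSe, hCe, by simp only [hω, hf, h1, hSe, hCe, hqe, hre]⟩)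
    (fun t => Prod.ext (hper t).1 (hper t).2) (fun s t hst => h.eq_shift h hst)
  refine ⟨ρ, ⟨hρ, hρd, fun θ => ?_⟩, fun θ => ?_⟩
  · obtain ⟨t, -, ht⟩ := hρz θ
    rw [← ht]
    exact ⟨hH t, hHM t⟩
  · obtain ⟨t, ht, -⟩ := hρz θ
    exact ⟨t, ht⟩

lemma ae_sin_ne_zero : ∀ᵐ θ : ℝ, sin θ ≠ 0 := by
  have : (range fun n : ℤ => (n : ℝ) * π).Countable := countable_range _
  filter_upwards [this.ae_notMem volume] with θ hθ h
  obtain ⟨n, hn⟩ := sin_eq_zero_iff.1 h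
  exact hθ ⟨n, hn⟩

lemma rr_zero : rr 0 = 1 := by simp [rr]

lemma qq_arg_pos {r s : ℝ} (hr : 1 < r) : 0 < r - 1 + (1 + r) * s ^ 2 := by
  nlinarith [sq_nonneg s]

lemma abs_Gout_le {p₁ p₂ ε M h θ : ℝ} (hh : 0 ≤ h) (hM : h ≤ M) (hε : 0 ≤ ε)
    (hεB : ε * bndo p₁ p₂ M ≤ 1 / 2) :
    |Gout p₁ p₂ ε h θ| ≤ 2 * ((2 + 2 * M) * (2 * (1 + 2 * M)) *
      (|p₁| + (|p₂| + 1) * (2 + 2 * M))) := by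
  have hr := one_le_rr hh
  have hrM : rr h ≤ 1 + 2 * M := (rr_le hh).trans (by linarith)
  have hd := (deno_mem (p₁ := p₁) (p₂ := p₂) (sin_sq_add_cos_sq θ) hr hrM hε hεB).1
  have hd0 : 0 < 1 - ε * ko p₁ p₂ (rr h) (sin θ) (cos θ) := by linarith
  have hs := sin_sq_le_one θ
  have hc := cos_sq_le_one θ
  have hq := (qq_le hr hs).trans (mul_le_mul_of_nonneg_left hrM zero_le_two)
  have hq0 : 0 ≤ qq (rr h) (sin θ) := sqrt_nonneg _
  have hf := abs_fo_le (p₁ := p₁) (p₂ := p₂) hr hrM hs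
  have h1 : (1 + rr h) * cos θ ^ 2 ≤ 2 + 2 * M := by
    nlinarith [sq_nonneg (cos θ)]
  have h0 : 0 ≤ 2 + 2 * M := by linarith
  have h0' : 0 ≤ 1 + 2 * M := by linarith
  rw [Gout, abs_div, abs_of_pos hd0, div_le_iff₀ hd0, abs_mul, abs_mul, abs_of_nonneg hq0,
    abs_of_nonneg (by positivity : 0 ≤ (1 + rr h) * cos θ ^ 2)]
  have h2 : (1 + rr h) * cos θ ^ 2 * qq (rr h) (sin θ) * |fo p₁ p₂ (rr h) (sin θ)| ≤
      (2 + 2 * M) * (2 * (1 + 2 * M)) * (|p₁| + (|p₂| + 1) * (2 + 2 * M)) := by gcongr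
  have h3 : 0 ≤ (2 + 2 * M) * (2 * (1 + 2 * M)) * (|p₁| + (|p₂| + 1) * (2 + 2 * M)) := by
    positivity
  nlinarith

lemma averaging_Gout (p₁ p₂ : ℝ) {M : ℝ} (hM : 0 ≤ M) :
    Averaging (Gout p₁ p₂) (1 / (2 * bndo p₁ p₂ (M + 1))) 0 (Ioo 0 (M + 1)) (Icc 0 M) := by
  have hB : 0 < bndo p₁ p₂ (M + 1) := bndo_pos (by linarith)
  have hεB : ∀ ε ∈ Icc 0 (1 / (2 * bndo p₁ p₂ (M + 1))), ε * bndo p₁ p₂ (M + 1) ≤ 1 / 2 :=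
    fun ε hε => by
      have := mul_le_mul_of_nonneg_right hε.2 hB.le
      refine this.trans (le_of_eq ?_)
      field_simp
  exact
  { pos := by positivity
    isOpen := isOpen_Ioo
    ordConnected := ordConnected_Ioo
    isCompact := isCompact_Icc
    ordConnected' := ordConnected_Icc
    subset := fun ρ hρ => by
      rcases hρ.1.eq_or_lt with h | h
      · exact Or.inl h.symm
      · exact Or.inr ⟨h, by linarith [hρ.2]⟩
    Ioo_subset := fun u hu v hv ρ hρ => ⟨hu.1.trans_lt hρ.1, by linarith [hρ.2, hv.2]⟩
    smooth := fun ε hε ρ hρ θ => contDiffAt_Gout hρ.1.le (qq_arg_pos (one_lt_rr hρ.1)) (by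
      have := (deno_mem (p₁ := p₁) (p₂ := p₂) (sin_sq_add_cos_sq θ) (one_le_rr hρ.1.le)
        ((rr_le hρ.1.le).trans (by linarith [hρ.2])) hε.1 (hεB ε hε)).1
      exact (lt_of_lt_of_le (by norm_num) this).ne')
    smooth_end := by
      filter_upwards [ae_sin_ne_zero] with θ hθ
      refine contDiffAt_Gout le_rfl ?_ (by simp)
      rw [rr_zero]
      positivity
    bounded := ⟨_, fun ε hε ρ hρ θ => abs_Gout_le hρ.1 (by linarith [hρ.2]) hε.1 (hεB ε hε)⟩ }

lemma integral_eq_zero_of_odd {g : ℝ → ℝ} (h : ∀ θ, g (2 * π - θ) = -g θ) :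
    ∫ θ in (0:ℝ)..2 * π, g θ = 0 := by
  have h1 := intervalIntegral.integral_comp_sub_left g (a := 0) (b := 2 * π) (2 * π)
  simp only [h, sub_self, sub_zero, intervalIntegral.integral_neg] at h1
  linarith

lemma continuous_qq (r : ℝ) : Continuous fun θ => qq r (sin θ) := by
  unfold qq; fun_prop

lemma Gout_zero (p₁ p₂ h θ : ℝ) : Gout p₁ p₂ 0 h θ =
    (1 + rr h) * cos θ ^ 2 * qq (rr h) (sin θ) * (p₁ - (1 + rr h) * sin θ ^ 2) +
    p₂ * ((1 + rr h) * √(1 + rr h)) * (cos θ ^ 2 * qq (rr h) (sin θ) * sin θ) := by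
  rw [Gout, zero_mul, sub_zero, div_one, fo]
  ring

lemma qq_neg (r s : ℝ) : qq r (-s) = qq r s := by rw [qq, qq, neg_sq]

lemma integral_Gout_zero (p₁ p₂ h : ℝ) : ∫ θ in (0:ℝ)..2 * π, Gout p₁ p₂ 0 h θ =
    ∫ θ in (0:ℝ)..2 * π, (1 + rr h) * cos θ ^ 2 * qq (rr h) (sin θ) *
      (p₁ - (1 + rr h) * sin θ ^ 2) := by
  have hq := continuous_qq (rr h)
  simp only [Gout_zero]
  rw [intervalIntegral.integral_add (Continuous.intervalIntegrable (by fun_prop) _ _)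
    (Continuous.intervalIntegrable (by fun_prop) _ _),
    integral_eq_zero_of_odd (g := fun θ => p₂ * ((1 + rr h) * √(1 + rr h)) *
      (cos θ ^ 2 * qq (rr h) (sin θ) * sin θ)) fun θ => by
      simp only [sin_two_pi_sub, cos_two_pi_sub, qq_neg]
      ring, add_zero]

lemma integral_Gout_neg {p₁ p₂ h : ℝ} (hp : p₁ ≤ 1 / 2) (hh : 0 ≤ h) :
    ∫ θ in (0:ℝ)..2 * π, Gout p₁ p₂ 0 h θ < 0 := by
  rw [integral_Gout_zero]
  have hr := one_le_rr hh
  obtain ⟨r, hrr⟩ : ∃ r, r = rr h := ⟨_, rfl⟩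
  rw [← hrr] at hr ⊢
  have hq := continuous_qq r
  have hq0 : 0 ≤ √(r - 1 / 2) := sqrt_nonneg _
  have hle : ∀ θ, (1 + r) * cos θ ^ 2 * qq r (sin θ) * (p₁ - (1 + r) * sin θ ^ 2) ≤
      (1 + r) * √(r - 1 / 2) / 2 * cos θ ^ 2 -
        (1 + r) ^ 2 * √(r - 1 / 2) * (sin θ ^ 2 * cos θ ^ 2) := fun θ => by
    have h1 : qq r (sin θ) * (p₁ - (1 + r) * sin θ ^ 2) ≤
        qq r (sin θ) * (1 / 2 - (1 + r) * sin θ ^ 2) :=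
      mul_le_mul_of_nonneg_left (by linarith) (sqrt_nonneg _)
    have h2 : qq r (sin θ) * (1 / 2 - (1 + r) * sin θ ^ 2) ≤
        √(r - 1 / 2) * (1 / 2 - (1 + r) * sin θ ^ 2) := by
      rcases le_total ((1 + r) * sin θ ^ 2) (1 / 2) with h3 | h3
      · exact mul_le_mul_of_nonneg_right (sqrt_le_sqrt (by linarith)) (by linarith)
      · exact mul_le_mul_of_nonpos_right (sqrt_le_sqrt (by linarith)) (by linarith)
    have h3 := mul_le_mul_of_nonneg_left (h1.trans h2)
      (by positivity : 0 ≤ (1 + r) * cos θ ^ 2)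
    linarith
  have hlt := intervalIntegral.integral_lt_integral_of_continuousOn_of_le_of_exists_lt two_pi_pos
    (f := fun θ => (1 + r) * cos θ ^ 2 * qq r (sin θ) * (p₁ - (1 + r) * sin θ ^ 2))
    (g := fun θ => (1 + r) * √(r - 1 / 2) / 2 * cos θ ^ 2 -
        (1 + r) ^ 2 * √(r - 1 / 2) * (sin θ ^ 2 * cos θ ^ 2))
    (Continuous.continuousOn (by fun_prop)) (Continuous.continuousOn (by fun_prop))
    (fun θ _ => hle θ) ⟨0, ⟨le_rfl, two_pi_pos.le⟩, by
      have h1 : √(r - 1) < √(r - 1 / 2) := sqrt_lt_sqrt (by linarith) (by linarith)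
      have h2 : 0 ≤ √(r - 1) := sqrt_nonneg _
      have h3 : √(r - 1) * p₁ < √(r - 1 / 2) * (1 / 2) := by nlinarith
      simp only [qq, sin_zero, cos_zero]
      norm_num
      nlinarith⟩
  refine hlt.trans_le ?_
  rw [intervalIntegral.integral_sub (Continuous.intervalIntegrable (by fun_prop) _ _)
    (Continuous.intervalIntegrable (by fun_prop) _ _), intervalIntegral.integral_const_mul,
    intervalIntegral.integral_const_mul, integral_cos_sq, integral_sin_sq_mul_cos_sq]
  have h4 : sin (4 * (2 * π)) = 0 := by
    rw [show 4 * (2 * π) = (8 : ℕ) * π by push_cast; ring, sin_nat_mul_pi]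
  simp only [h4, sin_two_pi, sin_zero, mul_zero]
  have : 0 ≤ (1 + r) * √(r - 1 / 2) * (π * (r - 1)) :=
    mul_nonneg (by positivity) (mul_nonneg pi_pos.le (by linarith))
  linarith

section

variable {p₁ p₂ r s h : ℝ}

lemma hasDerivAt_rr (hh : 0 ≤ h) : HasDerivAt rr (2 / rr h) h := by
  refine (((hasDerivAt_id h).const_mul 4).const_add 1).sqrt
    (by simp only [id]; linarith) |>.congr_deriv ?_
  change _ / (2 * rr h) = _
  have := one_le_rr hh
  field_simp
  norm_num

lemma hasDerivAt_qq (hq : 0 < r - 1 + (1 + r) * s ^ 2) :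
    HasDerivAt (fun r => qq r s) ((1 + s ^ 2) / (2 * qq r s)) r := by
  have h1 : HasDerivAt (fun r => r - 1 + (1 + r) * s ^ 2) (1 + s ^ 2) r :=
    (((hasDerivAt_id r).sub_const 1).add
      (((hasDerivAt_id r).const_add 1).mul_const (s ^ 2))).congr_deriv (by ring)
  exact h1.sqrt hq.ne'

lemma hasDerivAt_qq_sin {θ : ℝ} (hq : 0 < r - 1 + (1 + r) * sin θ ^ 2) :
    HasDerivAt (fun θ => qq r (sin θ)) ((1 + r) * sin θ * cos θ / qq r (sin θ)) θ := by
  have h1 : HasDerivAt (fun θ => r - 1 + (1 + r) * sin θ ^ 2) (2 * ((1 + r) * sin θ * cos θ)) θ :=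
    ((((hasDerivAt_sin θ).pow 2).const_mul (1 + r)).const_add (r - 1)).congr_deriv
      (by norm_num; ring)
  refine (h1.sqrt hq.ne').congr_deriv ?_
  exact mul_div_mul_left _ _ two_ne_zero

/-- The integrand, up to derivatives in `θ` and odd terms, of the derivative of the averaged
equation. -/
noncomputable def Phi (p₁ : ℝ) (_ h θ : ℝ) : ℝ :=
  2 * (p₁ - (1 + rr h) * sin θ ^ 2) / qq (rr h) (sin θ)

lemma contDiffAt_Phi {θ : ℝ} (hh : 0 < h) : ContDiffAt ℝ 3 (unc (Phi p₁)) (0, h, θ) := by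
  have hr := one_lt_rr hh
  have h1 : ContDiffAt ℝ 3 (fun q : ℝ × ℝ × ℝ => rr q.2.1) (0, h, θ) :=
    ContDiffAt.sqrt (by fun_prop) (by linarith)
  have h2 : ContDiffAt ℝ 3 (fun q : ℝ × ℝ × ℝ => qq (rr q.2.1) (sin q.2.2)) (0, h, θ) :=
    ContDiffAt.sqrt (by fun_prop) (qq_arg_pos hr).ne'
  exact ContDiffAt.div (by fun_prop) h2 (sqrt_pos.2 (qq_arg_pos hr)).ne'

lemma pd_Phi_neg {θ : ℝ} (hp : 1 / 2 < p₁) (hh : 0 < h) : pd (Phi p₁) 0 h θ < 0 := by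
  have hr := one_lt_rr hh
  have hq : 0 < qq (rr h) (sin θ) := sqrt_pos.2 (qq_arg_pos hr)
  have hq2 : qq (rr h) (sin θ) ^ 2 = rr h - 1 + (1 + rr h) * sin θ ^ 2 :=
    sq_sqrt (qq_arg_pos hr).le
  have h1 := (((((hasDerivAt_id (rr h)).const_add 1).mul_const (sin θ ^ 2)).const_sub
    p₁).const_mul 2).div (hasDerivAt_qq (s := sin θ) (qq_arg_pos hr)) hq.ne'
  have h2 := h1.comp h (hasDerivAt_rr hh.le)
  rw [(hasDerivAt_pd three_ne_zero (contDiffAt_Phi hh)).unique h2]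
  refine mul_neg_of_neg_of_pos (div_neg_of_neg_of_pos ?_ (by positivity)) (by positivity)
  simp only [id]
  have h3 : 2 * (-(1 * sin θ ^ 2)) * qq (rr h) (sin θ) - 2 * (p₁ - (1 + rr h) * sin θ ^ 2) *
      ((1 + sin θ ^ 2) / (2 * qq (rr h) (sin θ))) = -(p₁ * (1 + sin θ ^ 2) +
        sin θ ^ 2 * (rr h - 3) + (1 + rr h) * sin θ ^ 4) / qq (rr h) (sin θ) := by
    field_simp
    linear_combination -2 * sin θ ^ 2 * hq2
  rw [h3]
  refine div_neg_of_neg_of_pos ?_ hq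
  have := mul_pos (sub_pos.2 hp) (by positivity : 0 < 1 + sin θ ^ 2)
  have := mul_nonneg (sub_pos.2 hr).le (by positivity : 0 ≤ sin θ ^ 2 + sin θ ^ 4)
  nlinarith [sq_nonneg (sin θ ^ 2 - 3 / 8)]

lemma pd_Gout_zero_even {θ : ℝ} (hh : 0 < h) : pd (Gout p₁ 0) 0 h θ =
    Phi p₁ 0 h θ + 1 / rr h * (-(2 * (1 + rr h) * sin θ ^ 2 * cos θ ^ 2 * qq (rr h) (sin θ)) +
      (p₁ - (1 + rr h) * sin θ ^ 2) * ((cos θ ^ 2 - sin θ ^ 2) * qq (rr h) (sin θ) +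
        sin θ * cos θ * ((1 + rr h) * sin θ * cos θ / qq (rr h) (sin θ)))) := by
  have hr := one_lt_rr hh
  have hq : 0 < qq (rr h) (sin θ) := sqrt_pos.2 (qq_arg_pos hr)
  have hq2 : qq (rr h) (sin θ) ^ 2 = rr h - 1 + (1 + rr h) * sin θ ^ 2 :=
    sq_sqrt (qq_arg_pos hr).le
  have hcs := sin_sq_add_cos_sq θ
  have h0 : ContDiffAt ℝ 3 (unc (Gout p₁ 0)) (0, h, θ) :=
    contDiffAt_Gout hh.le (qq_arg_pos hr) (by simp)
  have h1 := ((((hasDerivAt_id (rr h)).const_add 1).mul_const (cos θ ^ 2)).mul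
    (hasDerivAt_qq (s := sin θ) (qq_arg_pos hr))).mul
      ((((hasDerivAt_id (rr h)).const_add 1).mul_const (sin θ ^ 2)).const_sub p₁)
  have h2 := h1.comp h (hasDerivAt_rr hh.le)
  have h3 : HasDerivAt (fun h => Gout p₁ 0 0 h θ) _ h :=
    h2.congr_of_eventuallyEq (Eventually.of_forall fun g => by
      simp only [Gout_zero, zero_mul, add_zero, Function.comp_apply, Pi.mul_apply, id])
  rw [(hasDerivAt_pd three_ne_zero h0).unique h3, Phi]
  simp only [Pi.mul_apply, id]
  obtain ⟨q, hqe⟩ : ∃ q, q = qq (rr h) (sin θ) := ⟨_, rfl⟩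
  obtain ⟨r, hre⟩ : ∃ r, r = rr h := ⟨_, rfl⟩
  rw [← hqe] at hq hq2 ⊢
  rw [← hre] at hr hq2 ⊢
  have hc : cos θ ^ 2 = 1 - sin θ ^ 2 := by linarith
  have hr0 : 0 < r := by linarith
  field_simp
  rw [hc]
  linear_combination (p₁ - (1 + r) * sin θ ^ 2) * hq2

lemma integral_pd_Gout_zero (hh : 0 < h) : ∫ θ in (0:ℝ)..2 * π, pd (Gout p₁ p₂) 0 h θ =
    ∫ θ in (0:ℝ)..2 * π, Phi p₁ 0 h θ := by
  have hG : ∀ p₂, ∀ ρ ∈ Ioi (0 : ℝ), ∀ θ, ContDiffAt ℝ 1 (unc (Gout p₁ p₂)) (0, ρ, θ) :=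
    fun p₂ ρ hρ θ => (contDiffAt_Gout (le_of_lt hρ) (qq_arg_pos (one_lt_rr hρ)) (by simp)).of_le
      (by norm_num)
  have h1 := hasDerivAt_integral_pd isOpen_Ioi (hG p₂) hh
  have h2 := hasDerivAt_integral_pd isOpen_Ioi (hG 0) hh
  simp only [integral_Gout_zero] at h1 h2
  rw [h1.unique h2]
  simp only [pd_Gout_zero_even hh]
  have hr := one_lt_rr hh
  have hq := continuous_qq (rr h)
  have hq0 : ∀ θ, qq (rr h) (sin θ) ≠ 0 := fun θ => (sqrt_pos.2 (qq_arg_pos hr)).ne'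
  have hc : Continuous fun θ => -(2 * (1 + rr h) * sin θ ^ 2 * cos θ ^ 2 * qq (rr h) (sin θ)) +
      (p₁ - (1 + rr h) * sin θ ^ 2) * ((cos θ ^ 2 - sin θ ^ 2) * qq (rr h) (sin θ) +
        sin θ * cos θ * ((1 + rr h) * sin θ * cos θ / qq (rr h) (sin θ))) := by
    have : Continuous fun θ => (1 + rr h) * sin θ * cos θ / qq (rr h) (sin θ) :=
      Continuous.div (by fun_prop) hq hq0
    fun_prop
  have hPc : Continuous fun θ => Phi p₁ 0 h θ := Continuous.div (by fun_prop) hq hq0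
  rw [intervalIntegral.integral_add (hPc.intervalIntegrable _ _)
    ((hc.const_mul _).intervalIntegrable _ _), intervalIntegral.integral_const_mul,
    integral_deriv_eq_zero (f := fun θ => (p₁ - (1 + rr h) * sin θ ^ 2) *
      (sin θ * cos θ * qq (rr h) (sin θ))) ?_ ?_ hc, mul_zero, add_zero]
  · intro θ
    simp only [sin_add_two_pi, cos_add_two_pi]
  · intro θ
    refine (((((hasDerivAt_sin θ).pow 2).const_mul (1 + rr h)).const_sub p₁).mul
      (((hasDerivAt_sin θ).mul (hasDerivAt_cos θ)).mul
        (hasDerivAt_qq_sin (qq_arg_pos hr)))).congr_deriv ?_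
    simp only [Pi.mul_apply, Pi.pow_apply]
    norm_num
    ring

lemma integral_pd_pd_Gout_neg (hp : 1 / 2 < p₁) (hh : 0 < h) :
    ∫ θ in (0:ℝ)..2 * π, pd (pd (Gout p₁ p₂)) 0 h θ < 0 := by
  have hG : ∀ ρ ∈ Ioi (0 : ℝ), ∀ θ, ContDiffAt ℝ 1 (unc (pd (Gout p₁ p₂))) (0, ρ, θ) :=
    fun ρ hρ θ => contDiffAt_pd (m := 3) (by norm_num)
      (contDiffAt_Gout (le_of_lt hρ) (qq_arg_pos (one_lt_rr hρ)) (by simp))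
  have hP : ∀ ρ ∈ Ioi (0 : ℝ), ∀ θ, ContDiffAt ℝ 1 (unc (Phi p₁)) (0, ρ, θ) :=
    fun ρ hρ θ => (contDiffAt_Phi hρ).of_le (by norm_num)
  have h1 := hasDerivAt_integral_pd isOpen_Ioi hG hh
  have h2 := hasDerivAt_integral_pd isOpen_Ioi hP hh
  have h3 : (fun ρ => ∫ θ in (0:ℝ)..2 * π, pd (Gout p₁ p₂) 0 ρ θ) =ᶠ[𝓝 h]
      fun ρ => ∫ θ in (0:ℝ)..2 * π, Phi p₁ 0 ρ θ := by
    filter_upwards [isOpen_Ioi.mem_nhds hh] with ρ hρ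
    exact integral_pd_Gout_zero hρ
  rw [(h1.congr_of_eventuallyEq h3.symm).unique h2]
  have hc : Continuous fun θ => pd (Phi p₁) 0 h θ := continuous_iff_continuousAt.2 fun θ =>
    ContinuousAt.comp (g := unc (pd (Phi p₁))) (f := fun θ => ((0 : ℝ), h, θ))
      (contDiffAt_pd (m := 3) (n := 1) (by norm_num) (contDiffAt_Phi hh)).continuousAt
      (by fun_prop)
  have := intervalIntegral.intervalIntegral_pos_of_pos
    (hc.neg.intervalIntegrable (μ := volume) 0 (2 * π))
    (fun θ => neg_pos.2 (pd_Phi_neg hp hh)) two_pi_pos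
  simp only [Pi.neg_apply, intervalIntegral.integral_neg] at this
  linarith

end

/-- Bounded and Lipschitz in the first variable on `[1, R]`, uniformly in the second one. -/
def UnifLipschitz (R : ℝ) (F : ℝ → ℝ → ℝ) : Prop :=
  ∃ L, ∀ r ∈ Icc 1 R, ∀ θ, |F r θ| ≤ L ∧ ∀ r' ∈ Icc 1 R, |F r' θ - F r θ| ≤ L * |r' - r|

section

variable {R : ℝ} {F F' : ℝ → ℝ → ℝ}

lemma UnifLipschitz.add (hF : UnifLipschitz R F) (hF' : UnifLipschitz R F') :
    UnifLipschitz R fun r θ => F r θ + F' r θ := by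
  obtain ⟨L, hL⟩ := hF
  obtain ⟨L', hL'⟩ := hF'
  refine ⟨L + L', fun r hr θ => ⟨?_, fun r' hr' => ?_⟩⟩
  · exact (abs_add_le _ _).trans (add_le_add (hL r hr θ).1 (hL' r hr θ).1)
  · have e : F r' θ + F' r' θ - (F r θ + F' r θ) = (F r' θ - F r θ) + (F' r' θ - F' r θ) := by ring
    rw [e, add_mul]
    exact (abs_add_le _ _).trans (add_le_add ((hL r hr θ).2 r' hr') ((hL' r hr θ).2 r' hr'))

lemma UnifLipschitz.mul (hF : UnifLipschitz R F) (hF' : UnifLipschitz R F') :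
    UnifLipschitz R fun r θ => F r θ * F' r θ := by
  obtain ⟨L, hL⟩ := hF
  obtain ⟨L', hL'⟩ := hF'
  refine ⟨|L * L'| + |2 * (L * L')|, fun r hr θ => ⟨?_, fun r' hr' => ?_⟩⟩
  · have h0 := (abs_nonneg _).trans (hL r hr θ).1
    rw [abs_mul]
    exact (mul_le_mul (hL r hr θ).1 (hL' r hr θ).1 (abs_nonneg _) h0).trans
      ((le_abs_self _).trans (le_add_of_nonneg_right (abs_nonneg _)))
  · have h0 := (abs_nonneg _).trans (hL r hr θ).1
    have h0' := (abs_nonneg _).trans (hL' r hr θ).1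
    have e : F r' θ * F' r' θ - F r θ * F' r θ =
        (F r' θ - F r θ) * F' r' θ + F r θ * (F' r' θ - F' r θ) := by ring
    have h1 : |(F r' θ - F r θ) * F' r' θ| ≤ (L * |r' - r|) * L' := by
      rw [abs_mul]
      exact mul_le_mul ((hL r hr θ).2 r' hr') (hL' r' hr' θ).1 (abs_nonneg _) (by positivity)
    have h2 : |F r θ * (F' r' θ - F' r θ)| ≤ L * (L' * |r' - r|) := by
      rw [abs_mul]
      exact mul_le_mul (hL r hr θ).1 ((hL' r hr θ).2 r' hr') (abs_nonneg _) h0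
    have h3 := mul_le_mul_of_nonneg_right (le_abs_self (2 * (L * L'))) (abs_nonneg (r' - r))
    have h4 := mul_nonneg (abs_nonneg (L * L')) (abs_nonneg (r' - r))
    rw [e]
    refine (abs_add_le _ _).trans ?_
    linarith

lemma unifLipschitz_of_angle {g : ℝ → ℝ} {B : ℝ} (hg : ∀ θ, |g θ| ≤ B) :
    UnifLipschitz R fun _ θ => g θ :=
  ⟨B, fun r _ θ => ⟨hg θ, fun r' _ => by
    rw [sub_self, abs_zero]
    exact mul_nonneg ((abs_nonneg _).trans (hg θ)) (abs_nonneg _)⟩⟩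

lemma unifLipschitz_of_le {g : ℝ → ℝ → ℝ} {B : ℝ} (hB : ∀ r ∈ Icc 1 R, ∀ θ, |g r θ| ≤ B)
    (hg : ∀ r ∈ Icc 1 R, ∀ r' ∈ Icc 1 R, ∀ θ, |g r' θ - g r θ| ≤ |r' - r|) :
    UnifLipschitz R g :=
  ⟨max B 1, fun r hr θ => ⟨(hB r hr θ).trans (le_max_left _ _), fun r' hr' =>
    (hg r hr r' hr' θ).trans (le_mul_of_one_le_left (abs_nonneg _) (le_max_right _ _))⟩⟩

lemma unifLipschitz_id : UnifLipschitz R fun r _ => r :=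
  unifLipschitz_of_le (B := R)
    (fun r hr _ => by rw [abs_of_nonneg (by linarith [hr.1])]; exact hr.2)
    fun _ _ _ _ _ => le_rfl

lemma abs_sqrt_sub_sqrt_le {a b m : ℝ} (hm : 0 < m) (ha : m ^ 2 ≤ a) (hb : m ^ 2 ≤ b) :
    |√a - √b| ≤ |a - b| / (2 * m) := by
  have hm2 : 0 < m ^ 2 := by positivity
  have ha' : m ≤ √a := le_sqrt_of_sq_le ha
  have hb' : m ≤ √b := le_sqrt_of_sq_le hb
  have e : a - b = (√a - √b) * (√a + √b) := by
    linear_combination -sq_sqrt (hm2.le.trans ha) + sq_sqrt (hm2.le.trans hb)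
  rw [le_div_iff₀ (by positivity), e, abs_mul, abs_of_pos (by linarith : 0 < √a + √b)]
  exact mul_le_mul_of_nonneg_left (by linarith) (abs_nonneg _)

lemma unifLipschitz_sqrt : UnifLipschitz R fun r _ => √(1 + r) := by
  refine unifLipschitz_of_le (B := √(1 + R)) (fun r hr _ => ?_) fun r hr r' hr' _ => ?_
  · rw [abs_of_nonneg (sqrt_nonneg _)]
    exact sqrt_le_sqrt (by linarith [hr.2])
  · refine (abs_sqrt_sub_sqrt_le one_pos (by linarith [hr'.1]) (by linarith [hr.1])).trans ?_
    rw [add_sub_add_left_eq_sub]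
    linarith [abs_nonneg (r' - r)]

lemma unifLipschitz_inv : UnifLipschitz R fun r _ => r⁻¹ := by
  refine unifLipschitz_of_le (B := 1) (fun r hr _ => ?_) fun r hr r' hr' _ => ?_
  · rw [abs_of_nonneg (inv_nonneg.2 (by linarith [hr.1]))]
    exact inv_le_one_of_one_le₀ hr.1
  · have h1 : 0 < r := by linarith [hr.1]
    have h2 : 0 < r' := by linarith [hr'.1]
    rw [inv_sub_inv h2.ne' h1.ne', abs_div, abs_of_pos (mul_pos h2 h1), abs_sub_comm]
    exact div_le_self (abs_nonneg _) (one_le_mul_of_one_le_of_one_le hr'.1 hr.1)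

lemma unifLipschitz_qq : UnifLipschitz R fun r θ => sin θ * qq r (sin θ) := by
  refine unifLipschitz_of_le (B := 2 * R) (fun r hr θ => ?_) fun r hr r' hr' θ => ?_
  · rw [abs_mul]
    have h0 : 0 ≤ qq r (sin θ) := sqrt_nonneg _
    have h1 := qq_le hr.1 (sin_sq_le_one θ)
    rw [abs_of_nonneg h0]
    exact (mul_le_of_le_one_left h0 (abs_sin_le_one θ)).trans (by linarith [hr.2])
  · rcases eq_or_ne (sin θ) 0 with h | h
    · simp [h]
    have hs := abs_pos.2 h
    have hs2 := sq_abs (sin θ)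
    have h1 := abs_sqrt_sub_sqrt_le (a := r' - 1 + (1 + r') * sin θ ^ 2)
      (b := r - 1 + (1 + r) * sin θ ^ 2) hs (by nlinarith [hr'.1]) (by nlinarith [hr.1])
    have e : r' - 1 + (1 + r') * sin θ ^ 2 - (r - 1 + (1 + r) * sin θ ^ 2) =
        (r' - r) * (1 + sin θ ^ 2) := by ring
    rw [e, abs_mul, abs_of_pos (by positivity : 0 < 1 + sin θ ^ 2), le_div_iff₀ (by positivity)]
      at h1
    rw [← mul_sub, abs_mul]
    have h2 := mul_le_mul_of_nonneg_left (sin_sq_le_one θ) (abs_nonneg (r' - r))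
    change |sin θ| * |√(r' - 1 + (1 + r') * sin θ ^ 2) - √(r - 1 + (1 + r) * sin θ ^ 2)| ≤ _
    linarith

lemma unifLipschitz_sin : UnifLipschitz R fun _ θ => sin θ := unifLipschitz_of_angle abs_sin_le_one

lemma unifLipschitz_cos : UnifLipschitz R fun _ θ => cos θ := unifLipschitz_of_angle abs_cos_le_one

lemma unifLipschitz_const (a : ℝ) : UnifLipschitz R fun _ _ => a :=
  unifLipschitz_of_angle fun _ => le_rfl

lemma unifLipschitz_fo (p₁ p₂ : ℝ) : UnifLipschitz R fun r θ => fo p₁ p₂ r (sin θ) := by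
  have h1 := (unifLipschitz_const (R := R) p₁).add
    (((unifLipschitz_const p₂).mul unifLipschitz_sqrt).mul unifLipschitz_sin)
  have h2 := h1.add ((unifLipschitz_const (-1)).mul
    (((unifLipschitz_const 1).add unifLipschitz_id).mul (unifLipschitz_sin.mul unifLipschitz_sin)))
  convert h2 using 3
  unfold fo
  ring

lemma unifLipschitz_ko (p₁ p₂ : ℝ) : UnifLipschitz R fun r θ => ko p₁ p₂ r (sin θ) (cos θ) := by
  have h1 := (((unifLipschitz_fo (R := R) p₁ p₂).mul unifLipschitz_cos).mul
    unifLipschitz_qq).mul unifLipschitz_inv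
  convert h1 using 3
  unfold ko
  ring

lemma unifLipschitz_rest (p₂ : ℝ) : UnifLipschitz R fun r θ =>
    (p₂ * √(1 + r) + -1 * ((1 + r) * sin θ)) * ((1 + r) * (cos θ * cos θ)) *
      (sin θ * qq r (sin θ)) :=
  have hZ := (unifLipschitz_const (R := R) 1).add unifLipschitz_id
  ((((unifLipschitz_const p₂).mul unifLipschitz_sqrt).add
    ((unifLipschitz_const (-1)).mul (hZ.mul unifLipschitz_sin))).mul
    (hZ.mul (unifLipschitz_cos.mul unifLipschitz_cos))).mul unifLipschitz_qq

end

lemma qq_mono {r r' s : ℝ} (h : r ≤ r') : qq r s ≤ qq r' s :=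
  sqrt_le_sqrt (by nlinarith [sq_nonneg s])

lemma rr_mono {u v : ℝ} (h : u ≤ v) : rr u ≤ rr v := sqrt_le_sqrt (by linarith)

lemma abs_rr_sub_le {u v : ℝ} (hu : 0 ≤ u) (hv : 0 ≤ v) : |rr v - rr u| ≤ 2 * |v - u| := by
  refine (abs_sqrt_sub_sqrt_le one_pos (by linarith) (by linarith)).trans (le_of_eq ?_)
  rw [show 1 + 4 * v - (1 + 4 * u) = 4 * (v - u) by ring, abs_mul]
  norm_num
  ring

lemma exists_neg_le_Gout_zero_sub {p₁ : ℝ} (p₂ : ℝ) (hp : 0 ≤ p₁) (M : ℝ) :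
    ∃ C, 0 ≤ C ∧ ∀ u ∈ Icc 0 M, ∀ v ∈ Icc 0 M, u ≤ v → ∀ θ,
      -(C * (v - u)) ≤ Gout p₁ p₂ 0 v θ - Gout p₁ p₂ 0 u θ := by
  obtain ⟨L, hL⟩ := unifLipschitz_rest (R := 1 + 2 * M) p₂
  refine ⟨2 * |L|, by positivity, fun u hu v hv huv θ => ?_⟩
  have hm := rr_mono huv
  have hr := one_le_rr hu.1
  have h1 := ((hL (rr u) ⟨hr, (rr_le hu.1).trans (by linarith [hu.2])⟩ θ).2 (rr v)
    ⟨one_le_rr hv.1, (rr_le hv.1).trans (by linarith [hv.2])⟩)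
  have h2 := mul_le_mul (le_abs_self L) (abs_rr_sub_le hu.1 hv.1) (abs_nonneg _) (abs_nonneg L)
  rw [abs_of_nonneg (sub_nonneg.2 huv)] at h2
  have h3 := (abs_le.1 (h1.trans h2)).1
  have h4 : (1 + rr u) * cos θ ^ 2 * qq (rr u) (sin θ) ≤
      (1 + rr v) * cos θ ^ 2 * qq (rr v) (sin θ) :=
    mul_le_mul (mul_le_mul_of_nonneg_right (by linarith) (sq_nonneg _)) (qq_mono hm)
      (sqrt_nonneg _) (mul_nonneg (by linarith) (sq_nonneg _))
  have h5 := mul_le_mul_of_nonneg_left h4 hp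
  rw [Gout_zero, Gout_zero]
  linarith

lemma exists_neg_le_dq_Gout {p₁ : ℝ} (p₂ : ℝ) (hp : 0 ≤ p₁) {M : ℝ} (hM : 0 ≤ M) :
    ∃ C, 0 ≤ C ∧ ∀ ε, 0 ≤ ε → ε * bndo p₁ p₂ M ≤ 1 / 2 → ∀ u ∈ Icc 0 M, ∀ v ∈ Icc 0 M, u < v →
      ∀ θ, -C ≤ dq (Gout p₁ p₂) ε u v θ := by
  obtain ⟨C, hC0, hC⟩ := exists_neg_le_Gout_zero_sub p₂ hp M
  obtain ⟨L, hL⟩ := unifLipschitz_ko (R := 1 + 2 * M) p₁ p₂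
  have hB := bndo_pos (p₁ := p₁) (p₂ := p₂) hM
  set B := 2 * ((2 + 2 * M) * (2 * (1 + 2 * M)) * (|p₁| + (|p₂| + 1) * (2 + 2 * M))) with hBd
  have hB0 : 0 ≤ B := by positivity
  refine ⟨2 * C + B * (4 * (1 / (2 * bndo p₁ p₂ M) * (|L| * 2))), by positivity,
    fun ε hε hεB u hu v hv huv θ => ?_⟩
  have hru := one_le_rr hu.1
  have hrv := one_le_rr hv.1
  have hruM : rr u ≤ 1 + 2 * M := (rr_le hu.1).trans (by linarith [hu.2])
  have hrvM : rr v ≤ 1 + 2 * M := (rr_le hv.1).trans (by linarith [hv.2])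
  have hN := hC u hu v hv huv.le θ
  have hNu := abs_Gout_le (p₁ := p₁) (p₂ := p₂) (θ := θ) hu.1 hu.2 le_rfl (by simp)
  have hDu := (deno_mem (p₁ := p₁) (p₂ := p₂) (sin_sq_add_cos_sq θ) hru hruM hε hεB).1
  have hDv := (deno_mem (p₁ := p₁) (p₂ := p₂) (sin_sq_add_cos_sq θ) hrv hrvM hε hεB).1
  have hk := ((hL (rr u) ⟨hru, hruM⟩ θ).2 (rr v) ⟨hrv, hrvM⟩).trans
    (mul_le_mul (le_abs_self L) (abs_rr_sub_le hu.1 hv.1) (abs_nonneg _) (abs_nonneg L))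
  have hG : ∀ h, Gout p₁ p₂ ε h θ =
      Gout p₁ p₂ 0 h θ / (1 - ε * ko p₁ p₂ (rr h) (sin θ) (cos θ)) := fun h => by
    simp only [Gout, zero_mul, sub_zero, div_one]
  have huv' := sub_pos.2 huv
  rw [abs_of_pos huv'] at hk
  beta_reduce at hk
  rw [dq, le_div_iff₀ huv', hG, hG]
  generalize Gout p₁ p₂ 0 u θ = Nu at *
  generalize Gout p₁ p₂ 0 v θ = Nv at *
  generalize ko p₁ p₂ (rr u) (sin θ) (cos θ) = ku at *
  generalize ko p₁ p₂ (rr v) (sin θ) (cos θ) = kv at *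
  have hε' : ε ≤ 1 / (2 * bndo p₁ p₂ M) := by
    rw [le_div_iff₀ (by positivity)]; linarith
  have hDu0 : 0 < 1 - ε * ku := by linarith
  have hDv0 : 0 < 1 - ε * kv := by linarith
  have e : Nv / (1 - ε * kv) - Nu / (1 - ε * ku) =
      (Nv - Nu) / (1 - ε * kv) + Nu * (ε * (kv - ku) / ((1 - ε * kv) * (1 - ε * ku))) := by
    field_simp
    ring
  have h1 : -(2 * C * (v - u)) ≤ (Nv - Nu) / (1 - ε * kv) := by
    rw [le_div_iff₀ hDv0]
    have := mul_nonneg hC0 huv'.le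
    nlinarith
  have h2 : |ε * (kv - ku) / ((1 - ε * kv) * (1 - ε * ku))| ≤
      4 * (1 / (2 * bndo p₁ p₂ M) * (|L| * (2 * (v - u)))) := by
    rw [abs_div, abs_of_pos (mul_pos hDv0 hDu0), div_le_iff₀ (mul_pos hDv0 hDu0), abs_mul,
      abs_of_nonneg hε]
    have h3 : ε * |kv - ku| ≤ 1 / (2 * bndo p₁ p₂ M) * (|L| * (2 * (v - u))) :=
      mul_le_mul hε' hk (abs_nonneg _) (by positivity)
    have h4 : 0 ≤ 1 / (2 * bndo p₁ p₂ M) * (|L| * (2 * (v - u))) := by positivity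
    have h5 : 1 / 4 ≤ (1 - ε * kv) * (1 - ε * ku) := by nlinarith
    nlinarith
  have h3 := mul_le_mul hNu h2 (abs_nonneg _) hB0
  rw [← abs_mul] at h3
  rw [e]
  linarith [(abs_le.1 h3).1]

section

variable {p₁ p₂ : ℝ}

lemma bndo_mono {M N : ℝ} (h : M ≤ N) : bndo p₁ p₂ M ≤ bndo p₁ p₂ N := by
  unfold bndo
  have := abs_nonneg p₂
  nlinarith

lemma qq_arg_pos_of_sin {r s : ℝ} (hr : 1 ≤ r) (hs : 0 < s) : 0 < r - 1 + (1 + r) * s ^ 2 := by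
  have := mul_pos (show 0 < 1 + r by linarith) (pow_pos hs 2)
  linarith

lemma contDiffAt_Gout_zero {θ : ℝ} (hs : 0 < sin θ) :
    ContDiffAt ℝ 3 (unc (Gout p₁ p₂)) (0, 0, θ) :=
  contDiffAt_Gout le_rfl (qq_arg_pos_of_sin (one_le_rr le_rfl) hs) (by simp)

lemma exists_le_pd_Gout_zero (hp : 0 ≤ p₁) (p₂ : ℝ) : ∃ C, 0 ≤ C ∧ ∀ θ ∈ Ioc (0:ℝ) 1,
    p₁ / 4 * θ⁻¹ - C ≤ pd (Gout p₁ p₂) 0 0 θ := by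
  obtain ⟨C, hC⟩ := isCompact_Icc.exists_bound_of_continuousOn (s := Icc (0:ℝ) 1)
    (f := fun θ => 2 * cos θ ^ 2 * (√2 * sin θ * (p₁ + √2 * p₂ * sin θ - 2 * sin θ ^ 2) +
      (1 + sin θ ^ 2) * (p₂ - √2 * sin θ) +
      2 * (√2 * sin θ) * (p₂ * sin θ / (2 * √2) - sin θ ^ 2))) (by fun_prop)
  have hC0 : 0 ≤ C := (norm_nonneg _).trans (hC 0 ⟨le_rfl, zero_le_one⟩)
  refine ⟨C, hC0, fun θ hθ => ?_⟩
  have hs : 0 < sin θ := sin_pos_of_pos_of_lt_pi hθ.1 (by linarith [pi_gt_three, hθ.2])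
  have h2 : 0 < √2 := by positivity
  have h22 := sq_sqrt (zero_le_two (α := ℝ))
  have hc : 1 / 2 ≤ cos θ := by
    have := one_sub_sq_div_two_le_cos (x := θ)
    nlinarith [hθ.1, hθ.2]
  have hsθ : sin θ ≤ θ := sin_le hθ.1.le
  have hq : qq 1 (sin θ) = √2 * sin θ := by
    rw [qq, show (1:ℝ) - 1 + (1 + 1) * sin θ ^ 2 = (√2 * sin θ) ^ 2 by rw [mul_pow, h22]; ring,
      sqrt_sq (by positivity)]
  have hd := (((((hasDerivAt_id (1:ℝ)).const_add 1).mul_const (cos θ ^ 2)).mul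
    (hasDerivAt_qq (s := sin θ) (qq_arg_pos_of_sin le_rfl hs))).mul
    ((((((hasDerivAt_id (1:ℝ)).const_add 1).sqrt (by norm_num)).const_mul p₂).mul_const
      (sin θ)).const_add p₁ |>.sub
      (((hasDerivAt_id (1:ℝ)).const_add 1).mul_const (sin θ ^ 2))))
  have hd' := HasDerivAt.comp_of_eq (0:ℝ) hd (hasDerivAt_rr le_rfl) rr_zero.symm
  have hpd : HasDerivAt (fun h => Gout p₁ p₂ 0 h θ) _ 0 :=
    hd'.congr_of_eventuallyEq (Eventually.of_forall fun h => by
      simp only [Gout, fo, zero_mul, sub_zero, div_one]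
      rfl)
  rw [(hasDerivAt_pd three_ne_zero (contDiffAt_Gout_zero hs)).unique hpd]
  have h0 := (abs_le.1 (hC θ ⟨hθ.1.le, hθ.2⟩)).1
  have h1 : p₁ / 4 * θ⁻¹ ≤ 2 * cos θ ^ 2 * (1 + sin θ ^ 2) * p₁ / (√2 * sin θ) := by
    rw [← div_eq_mul_inv, div_le_div_iff₀ hθ.1 (by positivity)]
    have h3 : √2 ≤ 2 := by rw [sqrt_le_left] <;> norm_num
    have h4 : √2 * sin θ ≤ 2 * θ := mul_le_mul h3 hsθ hs.le zero_le_two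
    have h5 : 1 / 2 ≤ 2 * cos θ ^ 2 * (1 + sin θ ^ 2) := by nlinarith [sq_nonneg (cos θ * sin θ)]
    have h6 := mul_le_mul_of_nonneg_left h4 hp
    have h7 := mul_le_mul_of_nonneg_left h5 (mul_nonneg hp hθ.1.le)
    linarith
  refine (sub_le_sub h1 (neg_le.1 h0)).trans (le_of_eq ?_)
  simp only [id, rr_zero, Pi.mul_apply, Pi.sub_apply, hq, one_add_one_eq_two]
  have h23 : √2 ^ 3 = 2 * √2 := by rw [pow_succ, h22]
  field_simp
  ring_nf
  simp only [h22, h23]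
  ring

lemma intervalIntegrable_pd_Gout_zero {η : ℝ} (hη : 0 < η) (hη1 : η ≤ 1) :
    IntervalIntegrable (fun θ => pd (Gout p₁ p₂) 0 0 θ) volume η 1 := by
  refine ContinuousOn.intervalIntegrable_of_Icc hη1 fun θ hθ => ?_
  have hs : 0 < sin θ :=
    sin_pos_of_pos_of_lt_pi (hη.trans_le hθ.1) (by linarith [pi_gt_three, hθ.2])
  exact (ContinuousAt.comp (g := unc (pd (Gout p₁ p₂))) (f := fun θ => ((0:ℝ), (0:ℝ), θ))
    (contDiffAt_pd (n := 2) (by norm_num) (contDiffAt_Gout_zero hs)).continuousAt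
    (by fun_prop)).continuousWithinAt

lemma exists_abs_pd_Gout_le (p₁ p₂ : ℝ) {M η : ℝ} (hM : 0 ≤ M) (hη : 0 < η) : ∃ B,
    ∀ ε ∈ Icc 0 (1 / (2 * bndo p₁ p₂ M)), ∀ h ∈ Icc 0 M, ∀ θ ∈ Icc η 1,
      |pd (Gout p₁ p₂) ε h θ| ≤ B := by
  have hB := bndo_pos (p₁ := p₁) (p₂ := p₂) hM
  obtain ⟨B, h⟩ := (isCompact_Icc.prod (isCompact_Icc.prod isCompact_Icc)
    ).exists_bound_of_continuousOn (s := Icc 0 (1 / (2 * bndo p₁ p₂ M)) ×ˢ Icc 0 M ×ˢ Icc η 1)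
    (f := unc (pd (Gout p₁ p₂))) (fun q hq => by
      obtain ⟨hε, hh, hθ⟩ := hq
      have hs : 0 < sin q.2.2 :=
        sin_pos_of_pos_of_lt_pi (hη.trans_le hθ.1) (by linarith [pi_gt_three, hθ.2])
      have hεB : q.1 * bndo p₁ p₂ M ≤ 1 / 2 := by
        have := (le_div_iff₀ (by positivity)).1 hε.2
        linarith
      have hd := (deno_mem (p₁ := p₁) (p₂ := p₂) (sin_sq_add_cos_sq q.2.2) (one_le_rr hh.1)
        ((rr_le hh.1).trans (by linarith [hh.2])) hε.1 hεB).1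
      exact (contDiffAt_pd (n := 2) (by norm_num) (contDiffAt_Gout hh.1
        (qq_arg_pos_of_sin (one_le_rr hh.1) hs)
        (by linarith : (0:ℝ) < _).ne')).continuousAt.continuousWithinAt)
  exact ⟨B, fun ε hε u hu θ hθ => h (ε, u, θ) ⟨hε, hu, hθ⟩⟩

lemma endCondition_Gout (hp : 0 < p₁) (p₂ : ℝ) {M : ℝ} (hM : 0 ≤ M) :
    EndCondition (Gout p₁ p₂) (1 / (2 * bndo p₁ p₂ (M + 1))) 0 (Icc 0 M ∩ Ioo 0 (M + 1)) := by
  have hB := bndo_pos (p₁ := p₁) (p₂ := p₂) hM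
  have hBB : bndo p₁ p₂ M ≤ bndo p₁ p₂ (M + 1) := bndo_mono (by linarith)
  have hε₀ : 1 / (2 * bndo p₁ p₂ (M + 1)) ≤ 1 / (2 * bndo p₁ p₂ M) :=
    one_div_le_one_div_of_le (by positivity) (by linarith)
  have hpi := pi_gt_three
  have hpi' := pi_lt_four
  obtain ⟨C, hC0, hC⟩ := exists_neg_le_dq_Gout p₂ hp.le hM
  obtain ⟨D, hD0, hD⟩ := exists_le_pd_Gout_zero hp.le p₂
  obtain ⟨L, hL⟩ : ∃ L, p₁ / 4 * L = 8 * C + D + 1 :=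
    ⟨(8 * C + D + 1) / (p₁ / 4), by field_simp⟩
  have hL0 : 0 < L := by
    by_contra! h
    nlinarith
  have hη : exp (-L) ≤ 1 := exp_le_one_iff.2 (by linarith)
  obtain ⟨B, hb⟩ := exists_abs_pd_Gout_le p₁ p₂ hM (exp_pos (-L))
  refine ⟨1, C, exp (-L), 1, B, (exp_pos _).le, hη, by linarith,
    fun ε hε u hu v hv huv => ?_, ?_⟩
  · have hε' : ε ∈ Icc 0 (1 / (2 * bndo p₁ p₂ M)) := ⟨hε.1.le, hε.2.le.trans hε₀⟩
    refine ⟨fun θ _ => ?_, fun θ hθ => ?_⟩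
    · rw [one_mul]
      refine hC ε hε.1.le ?_ u hu.1 v hv.1 huv θ
      have := (le_div_iff₀ (by positivity)).1 hε'.2
      linarith
    · obtain ⟨ξ, hξ, h⟩ := (averaging_Gout p₁ p₂ hM).exists_dq_eq ⟨hε.1.le, hε.2.le⟩ hu.2 hv.2
        huv θ
      rw [h]
      exact hb ε hε' ξ ⟨hu.1.1.trans hξ.1.le, hξ.2.le.trans hv.1.2⟩ θ hθ
  · have hii : IntervalIntegrable (fun θ : ℝ => p₁ / 4 * θ⁻¹) volume (exp (-L)) 1 := by
      refine ContinuousOn.intervalIntegrable_of_Icc hη fun θ hθ => ?_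
      have := ((exp_pos _).trans_le hθ.1).ne'
      exact ContinuousAt.continuousWithinAt (by fun_prop (disch := assumption))
    have h1 : ∫ θ in exp (-L)..1, (p₁ / 4 * θ⁻¹ - D) ≤
        ∫ θ in exp (-L)..1, pd (Gout p₁ p₂) 0 0 θ :=
      intervalIntegral.integral_mono_on hη (hii.sub intervalIntegrable_const)
        (intervalIntegrable_pd_Gout_zero (exp_pos _) hη) fun θ hθ =>
          hD θ ⟨(exp_pos _).trans_le hθ.1, hθ.2⟩
    rw [intervalIntegral.integral_sub hii intervalIntegrable_const,
      intervalIntegral.integral_const_mul, integral_inv_of_pos (exp_pos _) one_pos,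
      one_div, ← exp_neg, neg_neg, log_exp, intervalIntegral.integral_const, smul_eq_mul, hL] at h1
    rw [one_mul]
    refine lt_of_lt_of_le ?_ h1
    nlinarith [exp_pos (-L)]

/-- Outside the loops, small perturbations have no three ordered periodic solutions. -/
lemma exists_not_three_outside (p₁ p₂ : ℝ) {M : ℝ} (hM : 0 ≤ M) : ∃ ε₁ > 0,
    ∀ ε ∈ Ioo 0 ε₁, ∀ ρ₁ ρ₂ ρ₃,
      IsSol (Gout p₁ p₂) (Ioc 0 M) ε ρ₁ → IsSol (Gout p₁ p₂) (Ioc 0 M) ε ρ₂ →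
      IsSol (Gout p₁ p₂) (Ioc 0 M) ε ρ₃ → (∀ θ, ρ₁ θ < ρ₂ θ) → (∀ θ, ρ₂ θ < ρ₃ θ) → False := by
  have hS : ∀ ε ρ, IsSol (Gout p₁ p₂) (Ioc 0 M) ε ρ →
      IsSol (Gout p₁ p₂) (Icc 0 M ∩ Ioo 0 (M + 1)) ε ρ := fun ε ρ h =>
    ⟨h.per, h.deriv, fun θ => ⟨⟨(h.mem θ).1.le, (h.mem θ).2⟩, (h.mem θ).1,
      (h.mem θ).2.trans_lt (lt_add_one M)⟩⟩
  rcases le_or_gt p₁ (1 / 2) with hp | hp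
  · obtain ⟨ε₁, hε₁, h⟩ := (averaging_Gout p₁ p₂ hM).exists_forall_not_isSol
      fun ℓ hℓ => (integral_Gout_neg hp hℓ.1).ne
    exact ⟨ε₁, hε₁, fun ε hε ρ₁ _ _ h₁ _ _ _ _ => h ε hε ρ₁ (hS _ _ h₁)⟩
  · obtain ⟨ε₁, hε₁, h⟩ := (averaging_Gout p₁ p₂ hM).exists_forall_not_three
      (endCondition_Gout (by linarith) p₂ hM)
      (Or.inr ⟨0, fun ℓ hℓ => by
        rw [zero_mul]; exact integral_pd_pd_Gout_neg hp hℓ.1⟩)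
    exact ⟨ε₁, hε₁, fun ε hε ρ₁ ρ₂ ρ₃ h₁ h₂ h₃ => h ε hε ρ₁ ρ₂ ρ₃ (hS _ _ h₁) (hS _ _ h₂)
      (hS _ _ h₃)⟩

end

/-- Continuous functions without a common value are ordered. -/
lemma forall_lt_or_forall_gt {f g : ℝ → ℝ} (hf : Continuous f) (hg : Continuous g)
    (hne : ∀ θ, f θ ≠ g θ) : (∀ θ, f θ < g θ) ∨ ∀ θ, g θ < f θ := by
  by_contra! h
  obtain ⟨⟨a, ha⟩, b, hb⟩ := h
  obtain ⟨c, hc⟩ := mem_range_of_exists_le_of_exists_ge (c := 0) (hf.sub hg)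
    ⟨b, sub_nonpos.2 hb⟩ ⟨a, sub_nonneg.2 ha⟩
  exact hne c (sub_eq_zero.1 hc)

/-- A family of disjoint sets containing graphs, no three of which are ordered, has at most two
members. -/
lemma encard_le_two_of_graphs {S : Set (Set (ℝ × ℝ))} {P : (ℝ → ℝ) → Prop}
    (Ψ : ℝ → ℝ → ℝ × ℝ) (hP : ∀ ρ, P ρ → Continuous ρ)
    (hS : ∀ Γ ∈ S, ∀ Γ' ∈ S, ∀ p ∈ Γ, p ∈ Γ' → Γ = Γ')
    (hΨ : ∀ Γ ∈ S, ∃ ρ, P ρ ∧ ∀ θ, Ψ (ρ θ) θ ∈ Γ)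
    (hno : ∀ ρ₁ ρ₂ ρ₃, P ρ₁ → P ρ₂ → P ρ₃ → (∀ θ, ρ₁ θ < ρ₂ θ) → (∀ θ, ρ₂ θ < ρ₃ θ) → False) :
    S.encard ≤ 2 := by
  by_contra! h
  obtain ⟨T, hTS, hT⟩ := exists_subset_encard_eq (k := 3) (Order.add_one_le_of_lt h)
  obtain ⟨Γ₁, Γ₂, Γ₃, h₁₂, h₁₃, h₂₃, rfl⟩ := encard_eq_three.1 hT
  have hm₁ : Γ₁ ∈ S := hTS (by simp)
  have hm₂ : Γ₂ ∈ S := hTS (by simp)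
  have hm₃ : Γ₃ ∈ S := hTS (by simp)
  obtain ⟨ρ₁, hρ₁, hg₁⟩ := hΨ Γ₁ hm₁
  obtain ⟨ρ₂, hρ₂, hg₂⟩ := hΨ Γ₂ hm₂
  obtain ⟨ρ₃, hρ₃, hg₃⟩ := hΨ Γ₃ hm₃
  have c₁₂ := forall_lt_or_forall_gt (hP _ hρ₁) (hP _ hρ₂) fun θ e =>
    h₁₂ (hS _ hm₁ _ hm₂ _ (hg₁ θ) (e ▸ hg₂ θ))
  have c₁₃ := forall_lt_or_forall_gt (hP _ hρ₁) (hP _ hρ₃) fun θ e =>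
    h₁₃ (hS _ hm₁ _ hm₃ _ (hg₁ θ) (e ▸ hg₃ θ))
  have c₂₃ := forall_lt_or_forall_gt (hP _ hρ₂) (hP _ hρ₃) fun θ e =>
    h₂₃ (hS _ hm₂ _ hm₃ _ (hg₂ θ) (e ▸ hg₃ θ))
  rcases c₁₂ with a | a
  · rcases c₂₃ with b | b
    · exact hno _ _ _ hρ₁ hρ₂ hρ₃ a b
    · rcases c₁₃ with c | c
      · exact hno _ _ _ hρ₁ hρ₃ hρ₂ c b
      · exact hno _ _ _ hρ₃ hρ₁ hρ₂ c a
  · rcases c₂₃ with b | b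
    · rcases c₁₃ with c | c
      · exact hno _ _ _ hρ₂ hρ₁ hρ₃ a c
      · exact hno _ _ _ hρ₂ hρ₃ hρ₁ b c
    · exact hno _ _ _ hρ₃ hρ₂ hρ₁ b a

/-- The images of periodic solutions contained in `G`. -/
def orbitsIn (ε p₁ p₂ : ℝ) (G : Set (ℝ × ℝ)) : Set (Set (ℝ × ℝ)) :=
  {Γ | (∃ x y : ℝ → ℝ, IsPeriodicOrbit ε p₁ p₂ x y ∧ Γ = range fun t => (x t, y t)) ∧ Γ ⊆ G}

lemma eq_of_mem_orbitsIn {ε p₁ p₂ : ℝ} {G : Set (ℝ × ℝ)} : ∀ Γ ∈ orbitsIn ε p₁ p₂ G,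
    ∀ Γ' ∈ orbitsIn ε p₁ p₂ G, ∀ p ∈ Γ, p ∈ Γ' → Γ = Γ' := by
  rintro _ ⟨⟨x, y, h, rfl⟩, -⟩ _ ⟨⟨x', y', h', rfl⟩, -⟩ _ ⟨s, rfl⟩ ⟨t, ht⟩
  exact h.range_eq h' ht.symm

lemma div_sqrt_two_le {ε : ℝ} (hε : 0 ≤ ε) : ε / √2 ≤ ε :=
  div_le_self hε (one_le_sqrt.2 one_le_two)

lemma exists_encard_right_le_two (p₁ p₂ : ℝ) : ∃ ε₀ > (0:ℝ), ∀ ε, 0 < ε → ε < ε₀ →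
    (orbitsIn ε p₁ p₂ {p | H p.1 p.2 < 0 ∧ 0 < p.1}).encard ≤ 2 := by
  obtain ⟨ε₁, hε₁, hB, hno⟩ := exists_not_three_inside p₁ p₂
  refine ⟨ε₁, hε₁, fun ε hε hεε => ?_⟩
  have hε' : ε / √2 < ε₁ := (div_sqrt_two_le hε.le).trans_lt hεε
  refine encard_le_two_of_graphs (P := IsSol (Gin p₁ p₂) (Iio 0) (ε / √2))
    (fun ρ θ => (√(1 - exp ρ * cos θ), exp ρ * sin θ / √2)) (fun ρ h => h.continuous)
    eq_of_mem_orbitsIn ?_ (hno _ ⟨by positivity, hε'⟩)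
  rintro _ ⟨⟨x, y, h, rfl⟩, hG⟩
  obtain ⟨ρ, hρ, hg⟩ := exists_graph_inside h hε
    ((mul_le_mul_of_nonneg_right hε'.le (bnd_pos p₁ p₂).le).trans hB)
    (fun t => (hG ⟨t, rfl⟩).1) fun t => (hG ⟨t, rfl⟩).2
  exact ⟨ρ, hρ, hg⟩

lemma exists_encard_outside_le_two (p₁ p₂ : ℝ) : ∃ ε₀ > (0:ℝ), ∀ ε, 0 < ε → ε < ε₀ →
    (orbitsIn ε p₁ p₂ {p | 0 < H p.1 p.2}).encard ≤ 2 := by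
  obtain ⟨M, hM, ε₂, hε₂, hE⟩ := exists_energy_bound p₁ p₂
  obtain ⟨ε₁, hε₁, hno⟩ := exists_not_three_outside p₁ p₂ hM.le
  have hB := bndo_pos (p₁ := p₁) (p₂ := p₂) hM.le
  refine ⟨min (min ε₁ ε₂) (1 / (2 * bndo p₁ p₂ M)), by positivity, fun ε hε hεε => ?_⟩
  rw [lt_min_iff, lt_min_iff] at hεε
  have hε' := div_sqrt_two_le hε.le
  refine encard_le_two_of_graphs (P := IsSol (Gout p₁ p₂) (Ioc 0 M) (ε / √2))
    (fun ρ θ => (√(1 + rr ρ) * sin θ, √(1 + rr ρ) * cos θ * qq (rr ρ) (sin θ) / √2))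
    (fun ρ h => h.continuous) eq_of_mem_orbitsIn ?_
    (hno _ ⟨by positivity, hε'.trans_lt hεε.1.1⟩)
  rintro _ ⟨⟨x, y, h, rfl⟩, hG⟩
  have hεB : ε / √2 * bndo p₁ p₂ M ≤ 1 / 2 := by
    have h1 := (lt_div_iff₀ (by positivity)).1 hεε.2
    have h2 := mul_le_mul_of_nonneg_right hε' hB.le
    linarith
  obtain ⟨ρ, hρ, hg⟩ := exists_graph_outside h hε hεB (fun t => hG ⟨t, rfl⟩)
    (hE ε ⟨hε, hεε.1.2⟩ x y h)
  exact ⟨ρ, hρ, hg⟩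

lemma _root_.IsPeriodicOrbit.neg {ε p₁ p₂ : ℝ} {x y : ℝ → ℝ} (h : IsPeriodicOrbit ε p₁ p₂ x y) :
    IsPeriodicOrbit ε p₁ (-p₂) (-x) (-y) := by
  obtain ⟨hx, hy, ⟨T, hT, hper⟩, t₁, t₂, hne⟩ := h
  refine ⟨fun t => (hx t).neg, fun t => (hy t).neg.congr_deriv ?_, ⟨T, hT, fun t => ?_⟩, t₁, t₂,
    fun e => hne ?_⟩
  · simp only [Pi.neg_apply]
    ring
  · simp only [Pi.neg_apply, (hper t).1, (hper t).2, and_self]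
  · simpa using e

lemma encard_left_le (ε p₁ p₂ : ℝ) :
    (orbitsIn ε p₁ p₂ {p | H p.1 p.2 < 0 ∧ p.1 < 0}).encard ≤
      (orbitsIn ε p₁ (-p₂) {p | H p.1 p.2 < 0 ∧ 0 < p.1}).encard := by
  have hinj : Injective (fun Γ : Set (ℝ × ℝ) => Neg.neg '' Γ) := neg_injective.image_injective
  rw [← hinj.encard_image]
  refine encard_le_encard ?_
  rintro _ ⟨_, ⟨⟨x, y, h, rfl⟩, hG⟩, rfl⟩
  refine ⟨⟨-x, -y, h.neg, (range_comp _ _).symm⟩, ?_⟩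
  rintro _ ⟨_, ⟨t, rfl⟩, rfl⟩
  have ht := hG ⟨t, rfl⟩
  refine ⟨?_, neg_pos.2 ht.2⟩
  have h1 : H (-x t) (-y t) = H (x t) (y t) := by
    simp only [H]
    ring
  exact h1 ▸ ht.1

end DuffingVanDerPol

theorem at_most_two_limit_cycles_per_domain (p₁ p₂ : ℝ) :
    ∃ ε₀ > (0:ℝ), ∀ ε : ℝ, 0 < ε → ε < ε₀ →
      ∀ G ∈ ({ {p : ℝ × ℝ | H p.1 p.2 < 0 ∧ 0 < p.1},
               {p : ℝ × ℝ | H p.1 p.2 < 0 ∧ p.1 < 0},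
               {p : ℝ × ℝ | 0 < H p.1 p.2} } : Set (Set (ℝ × ℝ))),
        {Γ : Set (ℝ × ℝ) | IsLimitCycle ε p₁ p₂ Γ ∧ Γ ⊆ G}.encard ≤ 2 := by
  obtain ⟨ε₁, hε₁, h₁⟩ := DuffingVanDerPol.exists_encard_right_le_two p₁ p₂
  obtain ⟨ε₂, hε₂, h₂⟩ := DuffingVanDerPol.exists_encard_right_le_two p₁ (-p₂)
  obtain ⟨ε₃, hε₃, h₃⟩ := DuffingVanDerPol.exists_encard_outside_le_two p₁ p₂
  refine ⟨min (min ε₁ ε₂) ε₃, by positivity, fun ε hε hεε G hG => ?_⟩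
  rw [lt_min_iff, lt_min_iff] at hεε
  refine (Set.encard_le_encard (t := DuffingVanDerPol.orbitsIn ε p₁ p₂ G)
    fun Γ h => ⟨h.1.1, h.2⟩).trans ?_
  rcases hG with rfl | rfl | rfl
  · exact h₁ ε hε hεε.1.1
  · exact (DuffingVanDerPol.encard_left_le ε p₁ p₂).trans (h₂ ε hε hεε.1.2)
  · exact h₃ ε hε hεε.2
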